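/- Let ℓ ≥ 4 be an integer, let G ∈ 𝒢_ℓ, and let x, y be non-adjacent vertices of G. Let X be a vertex cut of G with {x, y} ⊆ X ⊆ N[{x, y}], and let G1 be the induced subgraph of G whose vertex set consists of X together with the vertex set of a component of G − X. If every induced (x,y)-path in G1 has length k, where 4 ≤ k ≤ ℓ, then G has a degree-2 vertex, a cut-vertex, or a K_2-cut. -/

import Mathlib

open SimpleGraph

variable {V : Type*}

/-- The list of internal vertices of a walk (its support minus the two ends). -/
def interiorL {G : SimpleGraph V} {a b : V} (p : G.Walk a b) : List V :=
  p.support.tail.dropLast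

/-- `p` is an induced path of `G`: a path such that the only edges of `G` between
vertices of `p` are the edges of `p`. -/
def IsInducedPath (G : SimpleGraph V) {a b : V} (p : G.Walk a b) : Prop :=
  p.IsPath ∧ ∀ x ∈ p.support, ∀ y ∈ p.support, G.Adj x y → s(x, y) ∈ p.edges

/-- A hole of `G`: an induced (chordless) cycle of length at least 4. -/
def IsHole (G : SimpleGraph V) {v : V} (c : G.Walk v v) : Prop :=
  c.IsCycle ∧ 4 ≤ c.length ∧
    ∀ x ∈ c.support, ∀ y ∈ c.support, G.Adj x y → s(x, y) ∈ c.edges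

/-- An odd hole of `G`: a hole of odd length. -/
def IsOddHole (G : SimpleGraph V) {v : V} (c : G.Walk v v) : Prop :=
  IsHole G c ∧ Odd c.length

/-- `G ∈ 𝒢ℓ`: `G` has girth `2ℓ+1` and every odd hole of `G` has length exactly `2ℓ+1`
(equivalently, no odd hole of length at least `2ℓ+3`). -/
def InGFamily (ℓ : ℕ) (G : SimpleGraph V) : Prop :=
  G.egirth = (2 * ℓ + 1 : ℕ) ∧
    ∀ (v : V) (c : G.Walk v v), IsOddHole G c → c.length = 2 * ℓ + 1

/-- `G` is `k`-vertex-critical: `χ(G) = k` and `χ(G − v) < k` for every vertex `v`. -/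
def VertexCritical (k : ℕ) (G : SimpleGraph V) : Prop :=
  G.chromaticNumber = (k : ℕ∞) ∧
    ∀ v : V, (G.induce ({v}ᶜ : Set V)).chromaticNumber < (k : ℕ∞)

/-- An odd `K₄`-subdivision in `G`: four distinct branch vertices `u1, u2, u3, u4`
joined by six internally disjoint paths (the arrises), such that the four face cycles
are all odd holes of `G`. -/
structure OddK4 (G : SimpleGraph V) where
  u1 : V
  u2 : V
  u3 : V
  u4 : V
  /-- the arris joining `u1` and `u2` -/
  P1 : G.Walk u1 u2
  /-- the arris joining `u3` and `u4` -/
  P2 : G.Walk u3 u4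
  /-- the arris joining `u2` and `u3` -/
  Q1 : G.Walk u2 u3
  /-- the arris joining `u1` and `u4` -/
  Q2 : G.Walk u1 u4
  /-- the arris joining `u1` and `u3` -/
  L1 : G.Walk u1 u3
  /-- the arris joining `u2` and `u4` -/
  L2 : G.Walk u2 u4
  hP1 : P1.IsPath
  hP2 : P2.IsPath
  hQ1 : Q1.IsPath
  hQ2 : Q2.IsPath
  hL1 : L1.IsPath
  hL2 : L2.IsPath
  /-- the four branch vertices are pairwise distinct -/
  hnodup : List.Nodup [u1, u2, u3, u4]
  /-- the interiors of the six arrises are pairwise disjoint -/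
  hdisj : List.Pairwise List.Disjoint
    [interiorL P1, interiorL P2, interiorL Q1, interiorL Q2, interiorL L1, interiorL L2]
  /-- no branch vertex lies in the interior of an arris -/
  hbranch : ∀ x ∈ interiorL P1 ++ interiorL P2 ++ interiorL Q1 ++ interiorL Q2 ++
      interiorL L1 ++ interiorL L2, x ∉ [u1, u2, u3, u4]
  /-- the face `u1u2u3` is an odd hole of `G` -/
  face1 : IsOddHole G (P1.append (Q1.append L1.reverse))
  /-- the face `u1u2u4` is an odd hole of `G` -/
  face2 : IsOddHole G (P1.append (L2.append Q2.reverse))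
  /-- the face `u1u3u4` is an odd hole of `G` -/
  face3 : IsOddHole G (L1.append (P2.append Q2.reverse))
  /-- the face `u2u3u4` is an odd hole of `G` -/
  face4 : IsOddHole G (Q1.append (P2.append L2.reverse))

/-- The subgraph of `G` formed by an odd `K₄`-subdivision. -/
def OddK4.toSubgraph {G : SimpleGraph V} (K : OddK4 G) : G.Subgraph :=
  K.P1.toSubgraph ⊔ K.P2.toSubgraph ⊔ K.Q1.toSubgraph ⊔ K.Q2.toSubgraph ⊔
    K.L1.toSubgraph ⊔ K.L2.toSubgraph

/-- The vertex set of an odd `K₄`-subdivision. -/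
def OddK4.verts {G : SimpleGraph V} (K : OddK4 G) : Set V :=
  K.toSubgraph.verts

/-- `X` is a vertex cut of `G`: deleting `X` leaves a disconnected graph. -/
def IsVertexCut (G : SimpleGraph V) (X : Set V) : Prop :=
  ¬ (G.induce (Xᶜ : Set V)).Preconnected

/-- `v` is a cut-vertex (`K₁`-cut) of `G`: some two vertices are connected in `G`
but not in `G − v`. -/
def IsCutVertex (G : SimpleGraph V) (v : V) : Prop :=
  ∃ a b : V, ∃ (ha : a ∈ ({v}ᶜ : Set V)) (hb : b ∈ ({v}ᶜ : Set V)),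
    G.Reachable a b ∧ ¬ (G.induce ({v}ᶜ : Set V)).Reachable ⟨a, ha⟩ ⟨b, hb⟩

/-- `G` has a `K₂`-cut: a pair of adjacent vertices whose deletion disconnects `G`. -/
def HasK2Cut (G : SimpleGraph V) : Prop :=
  ∃ u v : V, G.Adj u v ∧ ¬ (G.induce (({u, v} : Set V)ᶜ)).Preconnected

/-- `G` has a `P₃`-cut: a path on three vertices whose deletion disconnects `G`. -/
def HasP3Cut (G : SimpleGraph V) : Prop :=
  ∃ u v w : V, G.Adj u v ∧ G.Adj v w ∧ u ≠ w ∧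
    ¬ (G.induce (({u, v, w} : Set V)ᶜ)).Preconnected

/-- The closed neighbourhood `N[S]` of a set `S` of vertices. -/
def closedNbhd (G : SimpleGraph V) (S : Set V) : Set V :=
  S ∪ {v | ∃ u ∈ S, G.Adj u v}

/-- `S` is the vertex set of a (connected) component of `G − X`. -/
def IsComponentOf (G : SimpleGraph V) (X S : Set V) : Prop :=
  S.Nonempty ∧ Disjoint S X ∧ (G.induce S).Connected ∧
    ∀ a ∈ S, ∀ b, b ∉ S → b ∉ X → ¬ G.Adj a b

/-- `A` and `B` are disjoint and there is no edge between them. -/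
def Far (G : SimpleGraph V) (A B : Set V) : Prop :=
  ∀ a ∈ A, ∀ b ∈ B, a ≠ b ∧ ¬ G.Adj a b

/-- `IP G x y m I`: there is an induced path of `G` of length `m ≥ 1` from `x` to `y` whose set of
internal vertices is `I`. -/
inductive IP (G : SimpleGraph V) : V → V → ℕ → Set V → Prop
  | edge {x y : V} : G.Adj x y → IP G x y 1 ∅
  | cons {x y z : V} {m : ℕ} {I : Set V} : G.Adj x y → IP G y z m I → Far G {x} (I ∪ {z}) →
      IP G x z (m + 1) ({y} ∪ I)

section Framework

variable {G : SimpleGraph V} {x y z u v : V} {A B C I J : Set V} {m k : ℕ}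

theorem far_union_left : Far G (A ∪ B) C ↔ Far G A C ∧ Far G B C := by
  simp only [Far, Set.mem_union]; grind

theorem far_union_right : Far G C (A ∪ B) ↔ Far G C A ∧ Far G C B := by
  simp only [Far, Set.mem_union]; grind

theorem Far.symm (h : Far G A B) : Far G B A := fun b hb a ha =>
  ⟨fun e => (h a ha b hb).1 e.symm, fun e => (h a ha b hb).2 e.symm⟩

theorem far_empty_left : Far G ∅ A := by simp [Far]

theorem far_empty_right : Far G A ∅ := by simp [Far]

theorem Far.mono (h : Far G A B) (h1 : I ⊆ A) (h2 : J ⊆ B) : Far G I J :=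
  fun a ha b hb => h a (h1 ha) b (h2 hb)

theorem far_singleton : Far G {x} {y} ↔ x ≠ y ∧ ¬ G.Adj x y := by simp [Far]

theorem Far.notMem (h : Far G {x} A) : x ∉ A := fun hx => (h x rfl x hx).1 rfl

theorem Far.disjoint (h : Far G A B) : Disjoint A B :=
  Set.disjoint_left.2 fun a ha hb => (h a ha a hb).1 rfl

theorem IP.congr (h : IP G x y m I) (e : I = J) : IP G x y m J := e ▸ h

theorem IP.pos (h : IP G x y m I) : 1 ≤ m := by cases h <;> omega

theorem IP.of_one (h : IP G x y 1 I) : G.Adj x y ∧ I = ∅ := by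
  cases h with
  | edge h => exact ⟨h, rfl⟩
  | cons h h' => exact absurd h'.pos (by omega)

theorem IP.far_ends (h : IP G x y m I) (hm : 2 ≤ m) : Far G {x} {y} := by
  cases h with
  | edge h => omega
  | cons h h' h'' => exact (far_union_right.1 h'').2

theorem IP.left_notMem (h : IP G x y m I) : x ∉ I := by
  cases h with
  | edge h => simp
  | cons h h' h'' =>
    rintro (rfl | h3)
    · exact h.ne rfl
    · exact (far_union_right.1 h'').1.notMem h3

theorem IP.ne (h : IP G x y m I) : x ≠ y := by
  cases h with
  | edge h => exact h.ne
  | cons h h' h'' => exact (far_singleton.1 (far_union_right.1 h'').2).1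

theorem IP.glue (h : IP G x y m I) (h' : IP G y z k J) (hf : Far G ({x} ∪ I) ({z} ∪ J)) :
    IP G x z (m + k) (I ∪ ({y} ∪ J)) := by
  induction h with
  | edge h =>
    rw [Set.empty_union, add_comm]
    refine IP.cons h h' (hf.mono (by simp) (by simp [Set.union_comm]))
  | cons h h1 h2 ih =>
    rw [Set.union_assoc, add_right_comm]
    refine IP.cons h (ih h' (hf.mono ?_ subset_rfl)) ?_
    · exact Set.subset_union_right
    · simp only [far_union_left, far_union_right] at hf h2 ⊢
      tauto

theorem IP.symm (h : IP G x y m I) : IP G y x m I := by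
  induction h with
  | edge h => exact .edge h.symm
  | cons h h1 h2 ih =>
    have := ih.glue (.edge h.symm) (by
      rw [Set.union_empty]; exact h2.symm.mono (by simp [Set.union_comm]) subset_rfl)
    rw [Set.union_empty, Set.union_comm] at this
    exact this

theorem IP.right_notMem (h : IP G x y m I) : y ∉ I := h.symm.left_notMem

/-- Splitting an induced path at an internal vertex. -/
theorem IP.split_mem (h : IP G x y m I) (hz : z ∈ I) : ∃ i j A B, IP G x z i A ∧ IP G z y j B ∧
    Far G ({x} ∪ A) ({y} ∪ B) ∧ I = A ∪ ({z} ∪ B) ∧ i + j = m := by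
  induction h with
  | edge h => exact absurd hz (by simp)
  | @cons x y w m I h h1 h2 ih =>
    rcases hz with rfl | hz
    · exact ⟨1, m, ∅, I, .edge h, h1, by simpa [Set.union_comm] using h2, by simp, by omega⟩
    · obtain ⟨i, j, A, B, hA, hB, hf, rfl, rfl⟩ := ih hz
      refine ⟨i + 1, j, {y} ∪ A, B, .cons h hA (h2.mono subset_rfl ?_), hB, ?_, ?_, by omega⟩
      · intro t; simp; tauto
      · simp only [far_union_left, far_union_right] at *; tauto
      · simp only [Set.union_assoc]

/-- Splitting an induced path at a given distance from its first end. -/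
theorem IP.split_at (h : IP G x y m I) {i j : ℕ} (hi : 1 ≤ i) (hj : 1 ≤ j) (hm : i + j = m) :
    ∃ z A B, IP G x z i A ∧ IP G z y j B ∧
    Far G ({x} ∪ A) ({y} ∪ B) ∧ I = A ∪ ({z} ∪ B) := by
  induction h generalizing i with
  | edge h => omega
  | @cons x y w m I h h1 h2 ih =>
    obtain rfl | hi' := hi.eq_or_lt
    · obtain rfl : j = m := by omega
      exact ⟨y, ∅, I, .edge h, h1, by simpa [Set.union_comm] using h2, by simp⟩
    · obtain ⟨i, rfl⟩ : ∃ i', i = i' + 1 := ⟨i - 1, by omega⟩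
      obtain ⟨z, A, B, hA, hB, hf, rfl⟩ := ih (i := i) (by omega) (by omega)
      refine ⟨z, {y} ∪ A, B, .cons h hA (h2.mono subset_rfl ?_), hB, ?_, ?_⟩
      · intro t; simp; tauto
      · simp only [far_union_left, far_union_right] at *; tauto
      · simp only [Set.union_assoc]

/-- The first internal vertex satisfying a predicate. -/
theorem IP.first_sat (h : IP G x y m I) (P : V → Prop) (hP : ∃ z ∈ I, P z) :
    ∃ z i j A B, IP G x z i A ∧ IP G z y j B ∧ Far G ({x} ∪ A) ({y} ∪ B) ∧
      I = A ∪ ({z} ∪ B) ∧ i + j = m ∧ P z ∧ ∀ t ∈ A, ¬ P t := by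
  induction h with
  | edge h => simp at hP
  | @cons x y w m I h h1 h2 ih =>
    by_cases hy : P y
    · exact ⟨y, 1, m, ∅, I, .edge h, h1, by simpa [Set.union_comm] using h2, by simp, by omega, hy,
        by simp⟩
    · obtain ⟨z, i, j, A, B, hA, hB, hf, rfl, rfl, hz, hlt⟩ := ih (by
        obtain ⟨z, rfl | hz, h'⟩ := hP
        · exact absurd h' hy
        · exact ⟨z, hz, h'⟩)
      refine ⟨z, i + 1, j, {y} ∪ A, B, .cons h hA (h2.mono subset_rfl ?_), hB, ?_, ?_, by omega, hz,
        ?_⟩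
      · intro t; simp; tauto
      · simp only [far_union_left, far_union_right] at *; tauto
      · simp only [Set.union_assoc]
      · rintro t (rfl | ht)
        exacts [hy, hlt t ht]

/-- The last internal vertex satisfying a predicate. -/
theorem IP.last_sat (h : IP G x y m I) (P : V → Prop) (hP : ∃ z ∈ I, P z) :
    ∃ z i j A B, IP G x z i A ∧ IP G z y j B ∧ Far G ({x} ∪ A) ({y} ∪ B) ∧
      I = A ∪ ({z} ∪ B) ∧ i + j = m ∧ P z ∧ ∀ t ∈ B, ¬ P t := by
  obtain ⟨z, i, j, A, B, hA, hB, hf, rfl, rfl, hz, hlt⟩ := h.symm.first_sat P hP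
  refine ⟨z, j, i, B, A, hB.symm, hA.symm, hf.symm, ?_, by omega, hz, hlt⟩
  ext t; simp; tauto

theorem IP.exists_walk (h : IP G x y m I) : ∃ p : G.Walk x y, p.IsPath ∧ p.length = m ∧
    (∀ t, t ∈ p.support ↔ t = x ∨ t = y ∨ t ∈ I) ∧
    ∀ s ∈ p.support, ∀ t ∈ p.support, G.Adj s t → s(s, t) ∈ p.edges := by
  induction h with
  | @edge x y h =>
    refine ⟨.cons h .nil, by simp [h.ne], by simp, by simp, ?_⟩
    intro s hs t ht hst
    simp at hs ht ⊢
    rcases hs with rfl | rfl <;> rcases ht with rfl | rfl <;> simp_all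
  | @cons x y w m I h h1 h2 ih =>
    obtain ⟨p, hp, hl, hs, hc⟩ := ih
    rw [far_union_right] at h2
    have hx : ∀ t ∈ p.support, t ≠ y → t ≠ x ∧ ¬ G.Adj x t := by
      intro t ht hty
      rcases (hs t).1 ht with rfl | rfl | h4
      · exact absurd rfl hty
      · have := far_singleton.1 h2.2; exact ⟨this.1.symm, this.2⟩
      · have := h2.1 x rfl t h4; exact ⟨this.1.symm, this.2⟩
    refine ⟨.cons h p, hp.cons (fun hx' => ?_), by simp [hl], ?_, ?_⟩
    · by_cases hxy : x = y
      · exact h.ne hxy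
      · exact (hx x hx' hxy).1 rfl
    · intro t; simp [hs]; tauto
    · intro s hs' t ht hst
      simp only [Walk.support_cons, List.mem_cons, Walk.edges_cons] at hs' ht ⊢
      by_cases hsx : s = x
      · subst hsx
        rcases ht with rfl | ht
        · exact absurd rfl hst.ne
        · by_cases hty : t = y
          · left; rw [hty]
          · exact absurd hst (hx t ht hty).2
      · rcases hs' with h3 | hs'
        · exact absurd h3 hsx
        · rcases ht with rfl | ht
          · by_cases hty : s = y
            · left; rw [hty, Sym2.eq_swap]
            · exact absurd hst.symm (hx s hs' hty).2
          · right; exact hc s hs' t ht hst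

/-- In a connected set there is an induced path between any two vertices. -/
theorem exists_ipath (h : Relation.ReflTransGen (fun a b => G.Adj a b ∧ b ∈ A) x y) (hxy : x ≠ y) :
    ∃ m I, IP G x y m I ∧ I ⊆ A := by
  induction h with
  | refl => exact absurd rfl hxy
  | @tail y z h h1 ih =>
    by_cases hy : x = y
    · subst hy; exact ⟨1, ∅, .edge h1.1, by simp⟩
    by_cases hxz : G.Adj x z
    · exact ⟨1, ∅, .edge hxz, by simp⟩
    obtain ⟨m, I, hI, hIA⟩ := ih hy
    by_cases hzI : z ∈ I
    · obtain ⟨i, j, B, C, hB, hC, -, rfl, -⟩ := hI.split_mem hzI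
      exact ⟨i, B, hB, fun t ht => hIA (Or.inl ht)⟩
    by_cases hzI' : ∃ w ∈ I, G.Adj w z
    · obtain ⟨w, i, j, B, C, hB, hC, hf, rfl, -, hw, hn⟩ := hI.first_sat (G.Adj · z) hzI'
      refine ⟨_, _, hB.glue (.edge hw) ?_, ?_⟩
      · rintro s (rfl | hs) t (rfl | ht)
        · exact ⟨hxy, hxz⟩
        · exact ht.elim
        · exact ⟨fun e => hzI (e ▸ Or.inl hs), hn s hs⟩
        · exact ht.elim
      · intro t ht; simp at ht; apply hIA; simp; tauto
    · have hyA : y ∈ A := by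
        cases h with
        | refl => exact absurd rfl hy
        | tail _ h => exact h.2
      push Not at hzI'
      refine ⟨_, _, hI.glue (.edge h1.1) ?_, ?_⟩
      · rintro s (rfl | hs) t (rfl | ht)
        · exact ⟨hxy, hxz⟩
        · exact ht.elim
        · exact ⟨fun e => hzI (e ▸ hs), hzI' s hs⟩
        · exact ht.elim
      · intro t ht; simp at ht
        rcases ht with rfl | ht
        exacts [hyA, hIA ht]

end Framework

section Cycles

variable {G : SimpleGraph V} {x y z u v : V} {A B C I J : Set V} {m k ℓ : ℕ}

theorem isCycle_append_reverse {p q : G.Walk x y} (hp : p.IsPath) (hq : q.IsPath)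
    (hpl : 2 ≤ p.length) (hd : ∀ t ∈ p.support, t ∈ q.support → t = x ∨ t = y) :
    (p.append q.reverse).IsCycle := by
  cases p with
  | nil => simp at hpl
  | @cons _ w _ h p =>
    rw [Walk.cons_isPath_iff] at hp
    have hwy : w ≠ y := by
      rintro rfl
      have := Walk.isPath_iff_nil.1 hp.1
      rw [← Walk.length_eq_zero_iff] at this
      simp [this] at hpl
    rw [Walk.cons_append, Walk.cons_isCycle_iff]
    have hd' : ∀ t ∈ p.support, t ∈ q.support → t = y := fun t ht ht' => by
      rcases hd t (by simp [ht]) ht' with rfl | h3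
      exacts [absurd ht hp.2, h3]
    refine ⟨?_, ?_⟩
    · rw [Walk.isPath_def, Walk.support_append, List.nodup_append']
      have hq' := hq.reverse
      refine ⟨hp.1.support_nodup, hq'.support_nodup.tail, fun t ht ht' => ?_⟩
      have : t = y := hd' t ht (by simpa using List.mem_of_mem_tail ht')
      subst this
      have h4 := hq'.support_nodup
      rw [← Walk.cons_tail_support] at h4
      exact (List.nodup_cons.1 h4).1 ht'
    · rw [Walk.edges_append, List.mem_append]
      rintro (h3 | h3)
      · exact hp.2 (Walk.fst_mem_support_of_mem_edges _ h3)
      · rw [Walk.edges_reverse, List.mem_reverse] at h3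
        exact hwy (hd' w (by simp) (Walk.snd_mem_support_of_mem_edges _ h3))

theorem IP.cyc' (hG : InGFamily ℓ G) (h : IP G x y m I) (h' : IP G x y k J) (hd : Disjoint I J)
    (hm : 2 ≤ m) : 2 * ℓ + 1 ≤ m + k := by
  obtain ⟨p, hp, hpl, hps, -⟩ := h.exists_walk
  obtain ⟨q, hq, hql, hqs, -⟩ := h'.exists_walk
  have hc := isCycle_append_reverse hp hq (by omega) (fun t ht ht' => by
    rw [hps] at ht; rw [hqs] at ht'
    have h0 : t ∈ I → t ∉ J := fun h1 => Set.disjoint_left.1 hd h1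
    tauto)
  have := egirth_le_length hc
  rw [hG.1] at this
  simp [hpl, hql] at this
  exact_mod_cast this

/-- The girth bound for the cycle formed by two internally disjoint induced paths. -/
theorem IP.cyc (hG : InGFamily ℓ G) (h : IP G x y m I) (h' : IP G x y k J) (hd : Disjoint I J)
    (hm : 3 ≤ m + k) : 2 * ℓ + 1 ≤ m + k := by
  by_cases h2 : 2 ≤ m
  · exact h.cyc' hG h' hd h2
  · have := h'.cyc' hG h hd.symm (by omega)
    omega

/-- Two induced paths with the same ends and far interiors form a hole. -/
theorem IP.hole (hG : InGFamily ℓ G) (h : IP G x y m I) (h' : IP G x y k J) (hd : Far G I J)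
    (hm : 2 ≤ m) (hk : 2 ≤ k) :
    2 * ℓ + 1 ≤ m + k ∧ ((m + k) % 2 = 1 → m + k = 2 * ℓ + 1) := by
  refine ⟨h.cyc hG h' hd.disjoint (by omega), fun hodd => ?_⟩
  obtain ⟨p, hp, hpl, hps, hpc⟩ := h.exists_walk
  obtain ⟨q, hq, hql, hqs, hqc⟩ := h'.exists_walk
  have hc := isCycle_append_reverse hp hq (by omega) (fun t ht ht' => by
    rw [hps] at ht; rw [hqs] at ht'
    have h0 : t ∈ I → t ∉ J := fun h1 => Set.disjoint_left.1 hd.disjoint h1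
    tauto)
  have hlen : (p.append q.reverse).length = m + k := by simp [hpl, hql]
  rw [← hlen]
  refine hG.2 _ _ ⟨⟨hc, by omega, ?_⟩, ?_⟩
  · intro s hs t ht hst
    simp only [Walk.mem_support_append_iff, Walk.support_reverse, List.mem_reverse,
      Walk.edges_append, Walk.edges_reverse, List.mem_append] at hs ht ⊢
    rcases hs with hs | hs <;> rcases ht with ht | ht
    · exact Or.inl (hpc s hs t ht hst)
    · have hs' := hs
      have ht' := ht
      rw [hps] at hs'; rw [hqs] at ht'
      rcases hs' with rfl | rfl | hs'
      · exact Or.inr (hqc _ (by simp) _ ht hst)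
      · exact Or.inr (hqc _ (by simp) _ ht hst)
      · rcases ht' with rfl | rfl | ht'
        · exact Or.inl (hpc _ hs _ (by simp) hst)
        · exact Or.inl (hpc _ hs _ (by simp) hst)
        · exact absurd hst (hd s hs' t ht').2
    · have hs' := hs
      have ht' := ht
      rw [hqs] at hs'; rw [hps] at ht'
      rcases ht' with rfl | rfl | ht'
      · exact Or.inr (hqc _ hs _ (by simp) hst)
      · exact Or.inr (hqc _ hs _ (by simp) hst)
      · rcases hs' with rfl | rfl | hs'
        · exact Or.inl (hpc _ (by simp) _ ht hst)
        · exact Or.inl (hpc _ (by simp) _ ht hst)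
        · exact absurd hst.symm (hd t ht' s hs').2
    · exact Or.inr (hqc s hs t ht hst)
  · rw [hlen, Nat.odd_iff]; exact hodd

/-- Two common neighbours: the girth bound for the cycle formed by an induced path and a vertex
adjacent to both its ends. -/
theorem IP.cyc_vertex (hG : InGFamily ℓ G) (h : IP G x y m I) (hx : G.Adj x z) (hy : G.Adj z y)
    (hz : z ∉ I) : 2 * ℓ + 1 ≤ m + 2 := by
  obtain ⟨q, hq, hql, hqs, -⟩ := h.exists_walk
  have hp : (Walk.cons hx (Walk.cons hy .nil)).IsPath := by
    simp [Walk.cons_isPath_iff, hx.ne, hy.ne, h.ne]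
  have hc := isCycle_append_reverse hp hq (by simp) (fun t ht ht' => by
    rw [hqs] at ht'
    simp at ht
    rcases ht with rfl | rfl | rfl
    · simp
    · rcases ht' with rfl | rfl | ht'
      exacts [Or.inl rfl, Or.inr rfl, absurd ht' hz]
    · simp)
  have := egirth_le_length hc
  rw [hG.1] at this
  simp [hql] at this
  norm_cast at this
  omega

theorem IP.of_path (hG : InGFamily ℓ G) {p : G.Walk x y} (hp : p.IsPath) (hxy : x ≠ y)
    (hl : p.length ≤ 2 * ℓ - 1) :
    IP G x y p.length {t | t ∈ p.support ∧ t ≠ x ∧ t ≠ y} := by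
  induction p with
  | nil => exact absurd rfl hxy
  | @cons x w y h p ih =>
    rw [Walk.cons_isPath_iff] at hp
    rw [Walk.length_cons] at hl
    by_cases hwy : w = y
    · subst hwy
      have := (Walk.isPath_iff_nil.1 hp.1).eq_nil
      subst this
      exact (IP.edge h).congr (by ext t; simp; tauto)
    have hI := ih hp.1 hwy (by omega)
    have hxy' : ¬ G.Adj x y := fun hadj => by
      have := hI.cyc_vertex hG h.symm hadj (fun e => hp.2 e.1)
      omega
    have hx : ∀ t ∈ p.support, t ≠ w → t ≠ y → ¬ G.Adj x t := by
      intro t ht hne hne' hadj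
      obtain ⟨i, j, A, B, hA, hB, -, hAB, hij⟩ := hI.split_mem (z := t) ⟨ht, hne, hne'⟩
      have := hA.cyc_vertex hG h.symm hadj (fun e => hp.2 (by
        have : x ∈ A ∪ ({t} ∪ B) := Or.inl e
        rw [← hAB] at this
        exact this.1))
      omega
    refine (IP.cons h hI ?_).congr ?_
    · rintro _ rfl t (ht | rfl)
      · exact ⟨fun e => hp.2 (e ▸ ht.1), hx t ht.1 ht.2.1 ht.2.2⟩
      · exact ⟨hxy, hxy'⟩
    · ext t
      simp only [Set.mem_union, Set.mem_singleton_iff, Set.mem_ofPred_eq, Walk.support_cons,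
        List.mem_cons]
      constructor
      · rintro (rfl | ⟨h1, h2, h3⟩)
        · exact ⟨Or.inr (by simp), h.ne.symm, hwy⟩
        · exact ⟨Or.inr h1, fun e => hp.2 (e ▸ h1), h3⟩
      · rintro ⟨h1 | h1, h2, h3⟩
        · exact absurd h1 h2
        · by_cases htw : t = w
          · exact Or.inl htw
          · exact Or.inr ⟨h1, htw, h3⟩

/-- A graph of the family contains an odd hole. -/
theorem exists_oddHole (hG : InGFamily ℓ G) (hℓ : 1 ≤ ℓ) :
    ∃ x z y g, G.Adj x z ∧ G.Adj z y ∧ IP G y x (2 * ℓ - 1) g ∧ Far G {z} g := by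
  have hac : ¬ G.IsAcyclic := fun h => by
    have := egirth_eq_top.2 h
    rw [hG.1] at this
    exact absurd this (ENat.natCast_ne_top _)
  obtain ⟨a, c, hc, hcl⟩ := exists_egirth_eq_length.2 hac
  rw [hG.1] at hcl
  norm_cast at hcl
  cases c with
  | nil => simp at hc
  | @cons _ w _ h c =>
    rw [Walk.cons_isCycle_iff] at hc
    cases c with
    | nil => simp at h
    | @cons _ w' _ h' p =>
      simp only [Walk.length_cons] at hcl
      rw [Walk.cons_isPath_iff] at hc
      have hne : w' ≠ a := by
        rintro rfl
        apply hc.2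
        simp [Sym2.eq_swap]
      have hI := IP.of_path hG hc.1.1 hne (by omega)
      refine ⟨a, w, w', _, h, h', by convert hI using 1; omega, ?_⟩
      rintro s rfl t ht
      refine ⟨fun e => hc.1.2 (e ▸ ht.1), fun hadj => ?_⟩
      obtain ⟨i, j, A, B, hA, hB, -, hAB, hij⟩ := hI.split_mem ht
      have := hA.cyc_vertex hG h'.symm hadj (fun e => hc.1.2 (by
        have : s ∈ A ∪ ({t} ∪ B) := Or.inl e
        rw [← hAB] at this
        exact this.1))
      have := hB.pos
      omega

end Cycles

section Thetas

variable {G : SimpleGraph V} {x y z u v h : V} {A B C A' B' R I J f g g₂ S T T₁ T₂ : Set V}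
  {m k ℓ e g' L i i' j j' s t : ℕ}

theorem IP.two_le_of_far (h : IP G x y m I) (hf : Far G {x} {y}) : 2 ≤ m := by
  have := h.pos
  by_contra hm
  obtain rfl : m = 1 := by omega
  exact (far_singleton.1 hf).2 h.of_one.1

/-- An ear of an odd hole with far interior except along a short arc, where the short arc can be
replaced by a path of the same parity, cannot exist. -/
theorem IP.flip_false (hG : InGFamily ℓ G) (hf : IP G x y e f) (hg : IP G x y g' g)
    (he : 2 ≤ e) (heℓ : e ≤ ℓ) (heg : e + g' = 2 * ℓ + 1) (hg₂ : IP G x y k g₂)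
    (hk : k % 2 = e % 2) (hek : 2 * ℓ + 1 ≤ e + k) (hR : IP G x y L R)
    (h1 : Far G R g) (h2 : Far G R g₂) (h3 : Disjoint R f) : False := by
  have hL := hR.two_le_of_far (hf.far_ends he)
  have a1 := hR.hole hG hg h1 hL (by omega)
  have a2 := hR.hole hG hg₂ h2 hL (by omega)
  have a3 := hR.cyc hG hf h3 (by omega)
  omega

/-- The length of an ear of an odd hole. -/
theorem IP.ear_length (hG : InGFamily ℓ G) (hf : IP G x y e f) (hg : IP G x y g' g)
    (he : 2 ≤ e) (heℓ : e ≤ ℓ) (heg : e + g' = 2 * ℓ + 1) (hR : IP G x y L R)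
    (h1 : Far G R f) (h2 : Far G R g) : L = g' := by
  have hL := hR.two_le_of_far (hf.far_ends he)
  have a1 := hR.hole hG hg h2 hL (by omega)
  have a3 := hR.hole hG hf h1 hL (by omega)
  omega

/-- Three induced paths with common ends, pairwise far interiors and lengths `s, t, t`, where
`s + t = 2ℓ + 1` and `s ≤ ℓ`. -/
structure Theta (G : SimpleGraph V) (ℓ : ℕ) (u v : V) (s t : ℕ) (S T₁ T₂ : Set V) : Prop where
  hS : IP G u v s S
  h1 : IP G u v t T₁
  h2 : IP G u v t T₂
  f01 : Far G S T₁
  f02 : Far G S T₂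
  f12 : Far G T₁ T₂
  sum : s + t = 2 * ℓ + 1
  two_le : 2 ≤ s
  le : s ≤ ℓ

theorem Theta.rev (h : Theta G ℓ u v s t S T₁ T₂) : Theta G ℓ v u s t S T₁ T₂ :=
  ⟨h.hS.symm, h.h1.symm, h.h2.symm, h.f01, h.f02, h.f12, h.sum, h.two_le, h.le⟩

theorem IP.theta (hG : InGFamily ℓ G) (hf : IP G x y e f) (hg : IP G x y g' g)
    (he : 2 ≤ e) (heℓ : e ≤ ℓ) (heg : e + g' = 2 * ℓ + 1) (hfg : Far G f g) (hR : IP G x y L R)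
    (h1 : Far G R f) (h2 : Far G R g) : Theta G ℓ x y e g' f g R := by
  have := hf.ear_length hG hg he heℓ heg hR h1 h2
  subst this
  exact ⟨hf, hg, hR, hfg, h1.symm, h2.symm, heg, he, heℓ⟩

/-- The holes through a clean ear joining two internal vertices of different paths of a theta. -/
theorem ear_holes (hG : InGFamily ℓ G) (hA : IP G u x i A) (hA' : IP G x v i' A')
    (hB : IP G u h j B) (hB' : IP G h v j' B') (hS : IP G u v s S) (hR : IP G x h L R)
    (ha : Far G ({u} ∪ A) ({v} ∪ A')) (hb : Far G ({u} ∪ B) ({v} ∪ B'))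
    (hab : Far G (A ∪ ({x} ∪ A')) (B ∪ ({h} ∪ B')))
    (hSa : Far G S (A ∪ ({x} ∪ A'))) (hSb : Far G S (B ∪ ({h} ∪ B')))
    (hRu : Far G R (({u} ∪ {v}) ∪ (S ∪ (A ∪ A') ∪ (B ∪ B')))) :
    (2 * ℓ + 1 ≤ i + j + L ∧ ((i + j + L) % 2 = 1 → i + j + L = 2 * ℓ + 1)) ∧
    (2 * ℓ + 1 ≤ i' + j' + L ∧ ((i' + j' + L) % 2 = 1 → i' + j' + L = 2 * ℓ + 1)) ∧
    (2 ≤ i' → 2 ≤ j →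
      2 * ℓ + 1 ≤ i + s + j' + L ∧ ((i + s + j' + L) % 2 = 1 → i + s + j' + L = 2 * ℓ + 1)) ∧
    (2 ≤ i → 2 ≤ j' →
      2 * ℓ + 1 ≤ i' + s + j + L ∧ ((i' + s + j + L) % 2 = 1 → i' + s + j + L = 2 * ℓ + 1)) := by
  have hxh : Far G {x} {h} := by grind [far_union_left, far_union_right]
  have hL := hR.two_le_of_far hxh
  have p1 := hA.pos
  have p2 := hA'.pos
  have p3 := hB.pos
  have p4 := hB'.pos
  have p5 := hS.pos
  have k1 : i' ≥ 2 → Far G {x} {v} := hA'.far_ends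
  have k2 : i ≥ 2 → Far G {u} {x} := hA.far_ends
  have k3 : j' ≥ 2 → Far G {h} {v} := hB'.far_ends
  have k4 : j ≥ 2 → Far G {u} {h} := hB.far_ends
  refine ⟨?_, ?_, ?_, ?_⟩
  · have := (hA.symm.glue hB (by grind [far_union_left, far_union_right, Far.symm])).hole hG hR
      (by grind [far_union_left, far_union_right, Far.symm]) (by omega) (by omega)
    exact this
  · have := (hA'.glue hB'.symm (by grind [far_union_left, far_union_right, Far.symm])).hole hG hR
      (by grind [far_union_left, far_union_right, Far.symm]) (by omega) (by omega)
    exact this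
  · intro h1 h2
    have := ((hA.symm.glue hS (by grind [far_union_left, far_union_right, Far.symm])).glue hB'.symm
      (by grind [far_union_left, far_union_right, Far.symm])).hole hG hR
      (by grind [far_union_left, far_union_right, Far.symm]) (by omega) (by omega)
    exact this
  · intro h1 h2
    have := ((hA'.glue hS.symm (by grind [far_union_left, far_union_right, Far.symm])).glue hB
      (by grind [far_union_left, far_union_right, Far.symm])).hole hG hR
      (by grind [far_union_left, far_union_right, Far.symm]) (by omega) (by omega)
    exact this

end Thetas

section Local

theorem reach_mono {r r' : V → V → Prop} {p q : V} (h : Relation.ReflTransGen r p q)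
    (hr : ∀ p q, r p q → r' p q) : Relation.ReflTransGen r' p q := by
  induction h with
  | refl => exact .refl
  | tail _ h ih => exact ih.tail (hr _ _ h)

variable {G : SimpleGraph V} {x y z u v h d a b : V} {A B C H K R I J : Set V} {m k ℓ L : ℕ}

theorem IP.reach (h : IP G x y m I) :
    Relation.ReflTransGen (fun p q => G.Adj p q ∧ q ∈ I ∪ {y}) x y := by
  induction h with
  | edge h => exact .single ⟨h, by simp⟩
  | cons h h1 h2 ih =>
    refine .head ⟨h, by simp⟩ (reach_mono ih fun p q hpq => ⟨hpq.1, ?_⟩)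
    have := hpq.2
    simp at this ⊢
    tauto

theorem IP.reach_interior (h : IP G x y m I) (hu : u ∈ I) (hv : v ∈ I) :
    Relation.ReflTransGen (fun p q => G.Adj p q ∧ q ∈ I) u v := by
  have key : ∀ {x y m I u}, IP G x y m I → u ∈ I →
      Relation.ReflTransGen (fun p q => G.Adj p q ∧ q ∈ I ∪ {y}) u y := by
    intro x y m I u h hu
    obtain ⟨i, j, A, B, hA, hB, -, rfl, -⟩ := h.split_mem hu
    refine reach_mono hB.reach fun p q hpq => ⟨hpq.1, ?_⟩
    have := hpq.2
    simp at this ⊢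
    tauto
  have key2 : ∀ {x y m I u}, IP G x y m I → u ∈ I → ∀ v, v ∈ I → v ≠ u →
      (∃ A B, I = A ∪ ({v} ∪ B) ∧
        Relation.ReflTransGen (fun p q => G.Adj p q ∧ q ∈ A ∪ {v}) u v) ∨
      (∃ A B, I = A ∪ ({v} ∪ B) ∧
        Relation.ReflTransGen (fun p q => G.Adj p q ∧ q ∈ B ∪ {v}) u v) := by
    intro x y m I u h hu v hv hne
    obtain ⟨i, j, A, B, hA, hB, -, rfl, -⟩ := h.split_mem hv
    rcases hu with hu | hu | hu
    · exact Or.inl ⟨A, B, rfl, key hA hu⟩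
    · exact absurd hu.symm hne
    · exact Or.inr ⟨A, B, rfl, key hB.symm hu⟩
  by_cases huv : v = u
  · rw [huv]
  · rcases key2 h hu v hv huv with ⟨A, B, rfl, h1⟩ | ⟨A, B, rfl, h1⟩ <;>
    · refine reach_mono h1 fun p q hpq => ⟨hpq.1, ?_⟩
      have := hpq.2
      simp at this ⊢
      tauto

/-- In a graph without `K₂`-cuts, a component of `G - H` containing a neighbour of `d` has a
neighbour in `H` outside of `{d, a}`. -/
theorem exists_exit (hN : ¬ HasK2Cut G) (hda : G.Adj d a) {w : V} (hd : d ∈ H) (ha : a ∈ H)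
    (hb : b ∈ H) (hbd : b ≠ d) (hba : b ≠ a) (hw : w ∉ H) :
    ∃ t s, Relation.ReflTransGen (fun p q => G.Adj p q ∧ p ∉ H ∧ q ∉ H) w t ∧ s ∈ H ∧ s ≠ d ∧
      s ≠ a ∧ G.Adj t s := by
  have hc : (G.induce (({d, a} : Set V)ᶜ)).Preconnected := by
    by_contra hc
    exact hN ⟨d, a, hda, hc⟩
  have hw' : w ∈ (({d, a} : Set V)ᶜ) := by
    rintro (rfl | rfl)
    exacts [hw hd, hw ha]
  have hb' : b ∈ (({d, a} : Set V)ᶜ) := by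
    rintro (rfl | rfl)
    exacts [hbd rfl, hba rfl]
  by_contra hcon
  push Not at hcon
  obtain ⟨p⟩ := hc ⟨w, hw'⟩ ⟨b, hb'⟩
  have key : ∀ (r s : (({d, a} : Set V)ᶜ : Set V)) (p : (G.induce (({d, a} : Set V)ᶜ)).Walk r s),
      r.1 ∉ H → Relation.ReflTransGen (fun p q => G.Adj p q ∧ p ∉ H ∧ q ∉ H) w r.1 → s.1 ∉ H := by
    intro r s p
    induction p with
    | nil => exact fun h _ => h
    | @cons r t s h p ih =>
      intro hr hwr
      have hadj : G.Adj r.1 t.1 := h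
      have ht : t.1 ∉ H := fun ht => by
        have h2 : ¬ (t.1 = d ∨ t.1 = a) := fun e => t.2 (by simpa using e)
        exact hcon r.1 t.1 hwr ht (fun e => h2 (Or.inl e)) (fun e => h2 (Or.inr e)) hadj
      exact ih ht (hwr.tail ⟨hadj, hr, ht⟩)
  exact key _ _ p hw .refl hb

/-- The two ways in which an ear at `d` can attach to the neighbour `a` of `d` as well. -/
def SideEar (G : SimpleGraph V) (ℓ : ℕ) (H : Set V) (d a b : V) : Prop :=
  ∃ h ∈ H, h ≠ a ∧ h ≠ d ∧ h ≠ b ∧ ∃ L R, IP G d h L R ∧ Disjoint R H ∧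
    Far G R (H \ {d, h, a}) ∧ (G.Adj a h ∨
      ∃ L' R', IP G a h L' R' ∧ Far G R' (H \ {a, h}) ∧ L' + 2 * ℓ ≤ L + 2)

theorem sideEar_of (hG : InGFamily ℓ G)
    (hd : d ∈ H) (ha : a ∈ H) (hda : G.Adj d a)
    (uniq : ∀ w ∉ H, ∀ s ∈ H, ∀ t ∈ H, G.Adj w s → G.Adj w t → s = t)
    {r : V} (hI : IP G d r m I) (hIH : ∀ t ∈ I, t ∉ H) (hrH : r ∉ H)
    (hhH : h ∈ H) (hrh : G.Adj r h) (hha : h ≠ a) (hhd : h ≠ d) (hhb : h ≠ b)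
    (hO : ∀ t ∈ I, ∀ s ∈ H, s ≠ a → s ≠ d → s ≠ b → ¬ G.Adj t s)
    (hIh : IP G d h (m + 1) (I ∪ {r}))
    (hQa : ∃ t ∈ I, G.Adj t a) (hQb : ∀ t ∈ I, ¬ G.Adj t b) : SideEar G ℓ H d a b := by
  have hru : ∀ s ∈ H, G.Adj r s → s = h := fun s hs e => uniq r hrH s hs h hhH e hrh
  refine ⟨h, hhH, hha, hhd, hhb, m + 1, I ∪ {r}, hIh, ?_, ?_, ?_⟩
  · rw [Set.disjoint_left]
    rintro t (ht | rfl)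
    exacts [hIH t ht, hrH]
  · rintro t ht s ⟨hs, hs'⟩
    simp at hs'
    rcases ht with ht | rfl
    · refine ⟨fun e => hIH t ht (e ▸ hs), fun e => ?_⟩
      by_cases hsb : s = b
      · exact hQb t ht (hsb ▸ e)
      · exact hO t ht s hs hs'.2.2 hs'.1 hsb e
    · exact ⟨fun e => hrH (e ▸ hs), fun e => hs'.2.1 (hru s hs e)⟩
  · by_cases hah : G.Adj a h
    · exact Or.inl hah
    right
    obtain ⟨z, i, j, A, B, hA, hB, hf, rfl, rfl, hz, hlt⟩ := hI.last_sat (G.Adj · a) hQa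
    have hzH : z ∉ H := hIH z (by simp)
    have hBH : ∀ t ∈ B, t ∉ H := fun t ht => hIH t (by simp [ht])
    have hBI : ∀ t ∈ B, t ∈ A ∪ ({z} ∪ B) := fun t ht => by simp [ht]
    have hzI : z ∈ A ∪ ({z} ∪ B) := by simp
    have hcyc := hA.cyc_vertex hG hda hz.symm (fun e => hIH a (Or.inl e) ha)
    have h1 : IP G a r (1 + j) (∅ ∪ ({z} ∪ B)) := (IP.edge hz.symm).glue hB (by
      rintro s (rfl | hs) t (rfl | ht)
      · exact ⟨fun e => hrH (e ▸ ha), fun e => hha (hru _ ha e.symm).symm⟩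
      · exact ⟨fun e => hBH t ht (e ▸ ha), fun e => hlt t ht e.symm⟩
      · exact hs.elim
      · exact hs.elim)
    have h2 := h1.glue (IP.edge hrh) (by
      rintro s (rfl | hs | rfl | hs) t (rfl | ht)
      · exact ⟨hha.symm, hah⟩
      · exact ht.elim
      · exact hs.elim
      · exact ht.elim
      · exact ⟨fun e => hzH (e ▸ hhH), hO s hzI _ hhH hha hhd hhb⟩
      · exact ht.elim
      · exact ⟨fun e => hBH s hs (e ▸ hhH), hO s (hBI s hs) _ hhH hha hhd hhb⟩
      · exact ht.elim)
    refine ⟨_, _, h2, ?_, by omega⟩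
    rintro t ht s ⟨hs, hs'⟩
    simp at hs' ht
    have hdz : ¬ G.Adj z d := fun e => hda.ne (uniq z hzH d hd a ha e hz)
    rw [far_union_left, far_union_right] at hf
    rcases ht with rfl | rfl | ht
    · exact ⟨fun e => hrH (e ▸ hs), fun e => hs'.2 (hru s hs e)⟩
    · refine ⟨fun e => hzH (e ▸ hs), fun e => ?_⟩
      by_cases hsb : s = b
      · exact hQb t hzI (hsb ▸ e)
      by_cases hsd : s = d
      · exact hdz (hsd ▸ e)
      exact hO t hzI s hs hs'.1 hsd hsb e
    · refine ⟨fun e => hBH t ht (e ▸ hs), fun e => ?_⟩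
      by_cases hsb : s = b
      · exact hQb t (hBI t ht) (hsb ▸ e)
      by_cases hsd : s = d
      · exact (hf.1.2 d rfl t ht).2 (hsd ▸ e.symm)
      exact hO t (hBI t ht) s hs hs'.1 hsd hsb e

/-- The ears at a vertex `d` of `H` having exactly two neighbours in `H`. -/
theorem local_ears [Fintype V] [DecidableRel G.Adj] (hG : InGFamily ℓ G)
    (hN1 : ∀ v, G.degree v ≠ 2) (hN3 : ¬ HasK2Cut G)
    (hd : d ∈ H) (ha : a ∈ H) (hb : b ∈ H) (hda : G.Adj d a) (hdb : G.Adj d b) (hab : a ≠ b)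
    (hH : ∀ t ∈ H, G.Adj d t → t = a ∨ t = b)
    (uniq : ∀ w ∉ H, ∀ s ∈ H, ∀ t ∈ H, G.Adj w s → G.Adj w t → s = t) :
    (∃ h ∈ H, h ≠ a ∧ h ≠ d ∧ h ≠ b ∧ ∃ L R, IP G d h L R ∧ Far G R (H \ {d, h})) ∨
    (∃ L R, IP G a b L R ∧ Disjoint R H ∧ Far G R (H \ {a, d, b})) ∨
    SideEar G ℓ H d a b ∨ SideEar G ℓ H d b a := by
  classical
  obtain ⟨w, hdw, hwH⟩ : ∃ w, G.Adj d w ∧ w ∉ H := by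
    by_contra hcon
    push Not at hcon
    apply hN1 d
    have : G.neighborFinset d = {a, b} := by
      ext t
      simp only [mem_neighborFinset, Finset.mem_insert, Finset.mem_singleton]
      constructor
      · exact fun e => hH t (hcon t e) e
      · rintro (rfl | rfl) <;> assumption
    rw [← card_neighborFinset_eq_degree, this, Finset.card_pair hab]
  set rel : V → V → Prop := fun p q => G.Adj p q ∧ p ∉ H ∧ q ∉ H with hrel
  set K : Set V := {t | Relation.ReflTransGen rel w t} with hK
  have hKH : ∀ t ∈ K, t ∉ H := by
    intro t ht
    cases ht with
    | refl => exact hwH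
    | tail _ h => exact h.2.2
  have hrs : ∀ {p q}, Relation.ReflTransGen rel p q → Relation.ReflTransGen rel q p := by
    intro p q h
    induction h with
    | refl => exact .refl
    | tail _ h ih => exact .head ⟨h.1.symm, h.2.2, h.2.1⟩ ih
  have hconn : ∀ {p q}, p ∈ K → q ∈ K →
      Relation.ReflTransGen (fun p q => G.Adj p q ∧ q ∈ K) p q := by
    intro p q hp hq
    have h1 : Relation.ReflTransGen rel p q := (hrs hp).trans hq
    clear hq
    induction h1 with
    | refl => exact .refl
    | tail h1 h ih => exact ih.tail ⟨h.1, Relation.ReflTransGen.trans hp (h1.tail h)⟩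
  have hE4 : ∀ K' : Set V, (∀ t ∈ K', t ∉ H) → (∃ t ∈ K', G.Adj a t ∧ ∃ s ∈ K', G.Adj s b ∧
      Relation.ReflTransGen (fun p q => G.Adj p q ∧ q ∈ K') t s) →
      (∀ t ∈ K', ∀ s ∈ H, s ≠ a → s ≠ d → s ≠ b → ¬ G.Adj t s) →
      ∃ L R, IP G a b L R ∧ Disjoint R H ∧ Far G R (H \ {a, d, b}) := by
    rintro K' hK' ⟨t, ht, hat, s, hs, hsb, hts⟩ hO
    obtain ⟨L, R, hR, hRK⟩ := exists_ipath (G := G) (A := K' ∪ {b}) (x := a) (y := b)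
      (.head ⟨hat, by simp [ht]⟩ ((reach_mono hts fun p q h => ⟨h.1, Or.inl h.2⟩).tail
        ⟨hsb, by simp⟩)) hab
    have hRK' : ∀ p ∈ R, p ∈ K' := fun p hp => by
      rcases hRK hp with h | rfl
      exacts [h, absurd hp hR.right_notMem]
    refine ⟨L, R, hR, Set.disjoint_left.2 fun p hp => hK' p (hRK' p hp), ?_⟩
    rintro p hp q ⟨hq, hq'⟩
    simp at hq'
    have hpK := hRK' p hp
    exact ⟨fun e => hK' p hpK (e ▸ hq), hO p hpK q hq hq'.1 hq'.2.1 hq'.2.2⟩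
  by_cases hKO : ∃ k ∈ K, ∃ h ∈ H, h ≠ a ∧ h ≠ d ∧ h ≠ b ∧ G.Adj k h
  swap
  · push Not at hKO
    refine Or.inr (Or.inl (hE4 K hKH ?_ hKO))
    obtain ⟨t, s, ht, hs, hsd, hsa, hts⟩ :=
      exists_exit hN3 hda hd ha hb hdb.ne.symm hab.symm hwH
    obtain ⟨t', s', ht', hs', hsd', hsa', hts'⟩ :=
      exists_exit hN3 hdb hd hb ha hda.ne.symm hab hwH
    have hsb : s = b := by
      by_contra hsb
      exact hKO t ht s hs hsa hsd hsb hts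
    have hsb' : s' = a := by
      by_contra hsb
      exact hKO t' ht' s' hs' hsb hsd' hsa' hts'
    subst hsb hsb'
    exact ⟨t', ht', hts'.symm, t, ht, hts, hconn ht' ht⟩
  · obtain ⟨r, m, I, hI, hIK, hrK, ⟨h, hhH, hha, hhd, hhb, hrh⟩, hO⟩ : ∃ r m I, IP G d r m I ∧
        I ⊆ K ∧ r ∈ K ∧ (∃ h ∈ H, h ≠ a ∧ h ≠ d ∧ h ≠ b ∧ G.Adj r h) ∧
        ∀ t ∈ I, ∀ s ∈ H, s ≠ a → s ≠ d → s ≠ b → ¬ G.Adj t s := by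
      obtain ⟨k, hk, hk'⟩ := hKO
      have hdk : d ≠ k := fun e => hKH k hk (e ▸ hd)
      have hwK : w ∈ K := .refl
      obtain ⟨m, I, hI, hIK⟩ := exists_ipath (G := G) (A := K) (.head ⟨hdw, hwK⟩ (hconn hwK hk)) hdk
      by_cases hP : ∃ t ∈ I, ∃ h ∈ H, h ≠ a ∧ h ≠ d ∧ h ≠ b ∧ G.Adj t h
      · obtain ⟨z, i, j, A, B, hA, hB, hf, rfl, rfl, hz, hlt⟩ := hI.first_sat _ hP
        push Not at hlt
        exact ⟨z, i, A, hA, fun t ht => hIK (Or.inl ht), hIK (by simp), hz, hlt⟩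
      · push Not at hP
        exact ⟨k, m, I, hI, hIK, hk, hk', hP⟩
    have hrH := hKH r hrK
    have hIH : ∀ t ∈ I, t ∉ H := fun t ht => hKH t (hIK ht)
    have hru : ∀ s ∈ H, G.Adj r s → s = h := fun s hs e => uniq r hrH s hs h hhH e hrh
    have hIh : IP G d h (m + 1) (I ∪ {r}) := by
      have := hI.glue (IP.edge hrh) (by
        rintro s (rfl | hs) t (rfl | ht)
        · refine ⟨hhd.symm, fun e => ?_⟩
          rcases hH _ hhH e with e | e
          exacts [hha e, hhb e]
        · exact ht.elim
        · exact ⟨fun e => hIH s hs (e ▸ hhH), hO s hs _ hhH hha hhd hhb⟩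
        · exact ht.elim)
      rwa [Set.union_empty] at this
    by_cases hQa : ∃ t ∈ I, G.Adj t a
    · by_cases hQb : ∃ t ∈ I, G.Adj t b
      · obtain ⟨t, ht, hta⟩ := hQa
        obtain ⟨s, hs, hsb⟩ := hQb
        exact Or.inr (Or.inl (hE4 I hIH ⟨t, ht, hta.symm, s, hs, hsb, hI.reach_interior ht hs⟩ hO))
      · push Not at hQb
        exact Or.inr (Or.inr (Or.inl (sideEar_of hG hd ha hda uniq hI hIH hrH hhH hrh hha hhd hhb
          hO hIh hQa hQb)))
    · push Not at hQa
      by_cases hQb : ∃ t ∈ I, G.Adj t b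
      · exact Or.inr (Or.inr (Or.inr (sideEar_of hG hd hb hdb uniq hI hIH hrH hhH hrh hhb hhd hha
          (fun t ht s hs h1 h2 h3 => hO t ht s hs h3 h2 h1) hIh hQb hQa)))
      · push Not at hQb
        refine Or.inl ⟨h, hhH, hha, hhd, hhb, m + 1, I ∪ {r}, hIh, ?_⟩
        rintro t ht s ⟨hs, hs'⟩
        simp at hs'
        rcases ht with ht | rfl
        · refine ⟨fun e => hIH t ht (e ▸ hs), fun e => ?_⟩
          by_cases hsb : s = b
          · exact hQb t ht (hsb ▸ e)
          by_cases hsa : s = a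
          · exact hQa t ht (hsa ▸ e)
          exact hO t ht s hs hsa hs'.1 hsb e
        · exact ⟨fun e => hrH (e ▸ hs), fun e => hs'.2 (hru s hs e)⟩

end Local

section Holes

variable {G : SimpleGraph V} {x y z u v w h d a b : V} {A B A' B' D H K R I J S T T₁ T₂ f g : Set V}
  {m k ℓ L s t e g' i i' j j' : ℕ}

theorem IP.one_of_adj (hI : IP G x y m I) (h : G.Adj x y) : m = 1 ∧ I = ∅ := by
  have hm : m = 1 := by
    by_contra hm
    have := hI.pos
    exact (far_singleton.1 (hI.far_ends (by omega))).2 h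
  subst hm
  exact ⟨rfl, hI.of_one.2⟩

theorem arcs_end_mem (hS : IP G u v s S) (hT : IP G u v t T) (hf : Far G S T)
    (hy : y ∈ S) (hxy : Far G {u} {y}) :
    ∃ e f g' g, IP G u y e f ∧ IP G u y g' g ∧ Far G f g ∧ e + g' = s + t ∧
      {u} ∪ ({v} ∪ (S ∪ T)) = {u} ∪ ({y} ∪ (f ∪ g)) := by
  obtain ⟨i, j, A, B, hA, hB, hAB, rfl, rfl⟩ := hS.split_mem hy
  refine ⟨i, A, _, _, hA, hT.glue hB.symm ?_, ?_, by omega, ?_⟩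
  · grind [far_union_left, far_union_right, Far.symm]
  · grind [far_union_left, far_union_right, Far.symm]
  · ext r; simp only [Set.mem_union, Set.mem_singleton_iff]; tauto

theorem arcs_mem_mem (hS : IP G u v s S) (hT : IP G u v t T) (hf : Far G S T)
    (hx : x ∈ S) (hy : y ∈ S) (hxy : Far G {x} {y}) (hs : 2 ≤ s) :
    ∃ e f g' g, IP G x y e f ∧ IP G x y g' g ∧ Far G f g ∧ e + g' = s + t ∧
      {u} ∪ ({v} ∪ (S ∪ T)) = {x} ∪ ({y} ∪ (f ∪ g)) := by
  have huv := hS.far_ends hs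
  obtain ⟨i, j, A, B, hA, hB, hAB, rfl, rfl⟩ := hS.split_mem hx
  rcases hy with hy | rfl | hy
  · obtain ⟨i', j', A', B', hA', hB', hAB', rfl, rfl⟩ := hA.split_mem hy
    refine ⟨_, _, _, _, hB'.symm, (hB.glue hT.symm ?_).glue hA' ?_, ?_, by omega, ?_⟩
    · grind [far_union_left, far_union_right, Far.symm]
    · grind [far_union_left, far_union_right, Far.symm]
    · grind [far_union_left, far_union_right, Far.symm]
    · ext r; simp only [Set.mem_union, Set.mem_singleton_iff]; tauto
  · exact absurd rfl (far_singleton.1 hxy).1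
  · obtain ⟨i', j', A', B', hA', hB', hAB', rfl, rfl⟩ := hB.split_mem hy
    refine ⟨_, _, _, _, hA', (hA.symm.glue hT ?_).glue hB'.symm ?_, ?_, by omega, ?_⟩
    · grind [far_union_left, far_union_right, Far.symm]
    · grind [far_union_left, far_union_right, Far.symm]
    · grind [far_union_left, far_union_right, Far.symm]
    · ext r; simp only [Set.mem_union, Set.mem_singleton_iff]; tauto

theorem arcs_mem_mem' (hS : IP G u v s S) (hT : IP G u v t T) (hf : Far G S T)
    (hx : x ∈ S) (hy : y ∈ T) :
    ∃ e f g' g, IP G x y e f ∧ IP G x y g' g ∧ Far G f g ∧ e + g' = s + t ∧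
      {u} ∪ ({v} ∪ (S ∪ T)) = {x} ∪ ({y} ∪ (f ∪ g)) := by
  obtain ⟨i, j, A, B, hA, hB, hAB, rfl, rfl⟩ := hS.split_mem hx
  obtain ⟨i', j', A', B', hA', hB', hAB', rfl, rfl⟩ := hT.split_mem hy
  refine ⟨_, _, _, _, hA.symm.glue hA' ?_, hB.glue hB'.symm ?_, ?_, by omega, ?_⟩
  · grind [far_union_left, far_union_right, Far.symm]
  · grind [far_union_left, far_union_right, Far.symm]
  · grind [far_union_left, far_union_right, Far.symm]
  · ext r; simp only [Set.mem_union, Set.mem_singleton_iff]; tauto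

/-- The two arcs of a hole determined by two non-adjacent vertices. -/
theorem hole_arcs (hS : IP G u v s S) (hT : IP G u v t T) (hf : Far G S T)
    (hs : 2 ≤ s) (ht : 2 ≤ t) (hx : x ∈ {u} ∪ ({v} ∪ (S ∪ T))) (hy : y ∈ {u} ∪ ({v} ∪ (S ∪ T)))
    (hxy : Far G {x} {y}) :
    ∃ e f g' g, IP G x y e f ∧ IP G x y g' g ∧ Far G f g ∧ e + g' = s + t ∧
      {u} ∪ ({v} ∪ (S ∪ T)) = {x} ∪ ({y} ∪ (f ∪ g)) ∧ e ≤ g' := by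
  suffices ∃ e f g' g, IP G x y e f ∧ IP G x y g' g ∧ Far G f g ∧ e + g' = s + t ∧
      {u} ∪ ({v} ∪ (S ∪ T)) = {x} ∪ ({y} ∪ (f ∪ g)) by
    obtain ⟨e, f, g', g, h1, h2, h3, h4, h5⟩ := this
    rcases le_total e g' with h6 | h6
    · exact ⟨e, f, g', g, h1, h2, h3, h4, h5, h6⟩
    · exact ⟨g', g, e, f, h2, h1, h3.symm, by omega, by rw [h5, Set.union_comm f g], h6⟩
  have c1 : ({u} ∪ ({v} ∪ (S ∪ T)) : Set V) = {u} ∪ ({v} ∪ (T ∪ S)) := by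
    rw [Set.union_comm S]
  have c2 : ({u} ∪ ({v} ∪ (S ∪ T)) : Set V) = {v} ∪ ({u} ∪ (S ∪ T)) := by
    rw [Set.union_left_comm]
  have c3 : ({u} ∪ ({v} ∪ (S ∪ T)) : Set V) = {v} ∪ ({u} ∪ (T ∪ S)) := by
    rw [c1, Set.union_left_comm]
  have flip : (∃ e f g' g, IP G y x e f ∧ IP G y x g' g ∧ Far G f g ∧ e + g' = s + t ∧
      {u} ∪ ({v} ∪ (S ∪ T)) = {y} ∪ ({x} ∪ (f ∪ g))) → ∃ e f g' g, IP G x y e f ∧ IP G x y g' g ∧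
      Far G f g ∧ e + g' = s + t ∧ {u} ∪ ({v} ∪ (S ∪ T)) = {x} ∪ ({y} ∪ (f ∪ g)) := by
    rintro ⟨e, f, g', g, h1, h2, h3, h4, h5⟩
    exact ⟨e, f, g', g, h1.symm, h2.symm, h3, h4, by rw [h5, Set.union_left_comm]⟩
  have hne := (far_singleton.1 hxy).1
  have full : Far G S T := hf
  have e1 : s + t = t + s := by omega
  have uS : ∀ {y}, y ∈ S → Far G {u} {y} → _ := fun h h' => arcs_end_mem hS hT hf h h'
  have vS : ∀ {y}, y ∈ S → Far G {v} {y} → _ := fun h h' => arcs_end_mem hS.symm hT.symm hf h h'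
  have uT : ∀ {y}, y ∈ T → Far G {u} {y} → _ := fun h h' => arcs_end_mem hT hS hf.symm h h'
  have vT : ∀ {y}, y ∈ T → Far G {v} {y} → _ := fun h h' => arcs_end_mem hT.symm hS.symm hf.symm h h'
  rcases hx with rfl | rfl | hx | hx <;> rcases hy with rfl | rfl | hy | hy
  · exact absurd rfl hne
  · exact ⟨s, S, t, T, hS, hT, hf, rfl, rfl⟩
  · exact uS hy hxy
  · rw [c1, e1]; exact uT hy hxy
  · exact ⟨s, S, t, T, hS.symm, hT.symm, hf, rfl, c2⟩
  · exact absurd rfl hne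
  · rw [c2]; exact vS hy hxy
  · rw [c3, e1]; exact vT hy hxy
  · apply flip; exact uS hx hxy.symm
  · apply flip; rw [c2]; exact vS hx hxy.symm
  · exact arcs_mem_mem hS hT hf hx hy hxy hs
  · exact arcs_mem_mem' hS hT hf hx hy
  · apply flip; rw [c1, e1]; exact uT hx hxy.symm
  · apply flip; rw [c3, e1]; exact vT hx hxy.symm
  · apply flip; exact arcs_mem_mem' hS hT hf hy hx
  · rw [c1, e1]; exact arcs_mem_mem hT hS hf.symm hx hy hxy ht

/-- A vertex outside of a short hole has at most one neighbour in it. -/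
theorem hole_uniq (hG : InGFamily ℓ G) (hℓ : 4 ≤ ℓ) (hS : IP G u v s S) (hT : IP G u v t T)
    (hf : Far G S T) (hs : 2 ≤ s) (ht : 2 ≤ t) (hst : s + t + 2 < 4 * ℓ)
    (hw : w ∉ {u} ∪ ({v} ∪ (S ∪ T))) (hx : x ∈ {u} ∪ ({v} ∪ (S ∪ T)))
    (hy : y ∈ {u} ∪ ({v} ∪ (S ∪ T))) (hwx : G.Adj w x) (hwy : G.Adj w y) : x = y := by
  by_contra hne
  by_cases hadj : G.Adj x y
  · have := (IP.edge hadj).cyc_vertex hG hwx.symm hwy (by simp)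
    omega
  · obtain ⟨e, f, g', g, h1, h2, h3, h4, h5, h6⟩ :=
      hole_arcs hS hT hf hs ht hx hy (far_singleton.2 ⟨hne, hadj⟩)
    have := h1.cyc_vertex hG hwx.symm hwy (fun e => hw (by rw [h5]; simp [e]))
    omega

/-- The complementary arc of a path of length two in a hole. -/
theorem hole_around (hG : InGFamily ℓ G) (hℓ : 4 ≤ ℓ) (hS : IP G u v s S) (hT : IP G u v t T)
    (hf : Far G S T) (hs : 2 ≤ s) (ht : 2 ≤ t)
    (ha : a ∈ {u} ∪ ({v} ∪ (S ∪ T))) (hx : x ∈ {u} ∪ ({v} ∪ (S ∪ T)))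
    (hy : y ∈ {u} ∪ ({v} ∪ (S ∪ T))) (hax : G.Adj a x) (hay : G.Adj a y) (hxy : x ≠ y) :
    ∃ g, IP G x y 2 {a} ∧ IP G x y (s + t - 2) g ∧ Far G {a} g ∧
      {u} ∪ ({v} ∪ (S ∪ T)) = {x} ∪ ({y} ∪ ({a} ∪ g)) := by
  have hadj : ¬ G.Adj x y := fun hadj => by
    have := (IP.edge hadj).cyc_vertex hG hax.symm hay (by simp)
    omega
  obtain ⟨e, f, g', g, h1, h2, h3, h4, h5, -⟩ :=
    hole_arcs hS hT hf hs ht hx hy (far_singleton.2 ⟨hxy, hadj⟩)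
  rw [h5] at ha ⊢
  have key : ∀ {e f}, IP G x y e f → a ∈ f → f = {a} ∧ e = 2 := by
    intro e f h1 ha
    obtain ⟨i, j, A, B, hA, hB, -, rfl, rfl⟩ := h1.split_mem ha
    have := hA.one_of_adj hax.symm
    have := hB.one_of_adj hay
    simp [*]
  rcases ha with rfl | rfl | ha | ha
  · exact absurd rfl hax.ne
  · exact absurd rfl hay.ne
  · obtain ⟨rfl, rfl⟩ := key h1 ha
    exact ⟨g, h1, by rwa [show s + t - 2 = g' by omega], h3, rfl⟩
  · obtain ⟨rfl, rfl⟩ := key h2 ha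
    refine ⟨f, h2, by rwa [show s + t - 2 = e by omega], h3.symm, by rw [Set.union_comm f]⟩

end Holes

section ThetaEars

variable {G : SimpleGraph V} {x y z u v w h d a b : V} {A B A' B' D H K R I J S T T₁ T₂ f g : Set V}
  {m k ℓ L s t e g' i i' j j' : ℕ}

theorem far_of_diff {D C : Set V} (hR : Far G R (H \ D)) (hC : C ⊆ H) (hD : Disjoint C D) :
    Far G R C :=
  hR.mono subset_rfl fun _ ht => ⟨hC ht, Set.disjoint_left.1 hD ht⟩

theorem Far.diff_pair (hR : Far G R (H \ {x, y})) {C : Set V} (hC : C ⊆ H) (hx : x ∉ C)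
    (hy : y ∉ C) : Far G R C :=
  hR.mono subset_rfl fun t ht => ⟨hC ht, by
    rintro (rfl | rfl)
    exacts [hx ht, hy ht]⟩

/-- The vertex set of a theta. -/
def thetaSet (u v : V) (S T₁ T₂ : Set V) : Set V := {u} ∪ ({v} ∪ (S ∪ (T₁ ∪ T₂)))

/-- No theta has a shortest path longer than `s`. -/
def MaxTheta (G : SimpleGraph V) (ℓ s : ℕ) : Prop :=
  ∀ u v s' t S T₁ T₂, Theta G ℓ u v s' t S T₁ T₂ → s' ≤ s

theorem thetaSet_rev : thetaSet u v S T₁ T₂ = thetaSet v u S T₁ T₂ := by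
  unfold thetaSet; rw [Set.union_left_comm]

theorem Theta.no_flip (hth : Theta G ℓ u v s t S T₁ T₂) (hG : InGFamily ℓ G) (hℓ : 4 ≤ ℓ)
    (ha : a ∈ T₁) (hx : x ∈ thetaSet u v S T₁ T₂) (hy : y ∈ thetaSet u v S T₁ T₂)
    (hax : G.Adj a x) (hay : G.Adj a y) (hxy : x ≠ y) (hR : IP G x y L R)
    (hRH : Far G R (thetaSet u v S T₁ T₂ \ {x, a, y})) (hd : Disjoint R (thetaSet u v S T₁ T₂)) :
    False := by
  have hsum := hth.sum
  have hle := hth.le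
  have h2 := hth.two_le
  have key : ∀ x, x ∈ thetaSet u v S T₁ T₂ → G.Adj a x → x ∈ {u} ∪ ({v} ∪ T₁) := by
    rintro x (hx | hx | hx | hx | hx) hax
    · exact Or.inl hx
    · exact Or.inr (Or.inl hx)
    · exact absurd hax.symm (hth.f01 x hx a ha).2
    · exact Or.inr (Or.inr hx)
    · exact absurd hax (hth.f12 a ha x hx).2
  have hx' := key x hx hax
  have hy' := key y hy hay
  have sub1 : ({u} ∪ ({v} ∪ T₁) : Set V) ⊆ {u} ∪ ({v} ∪ (S ∪ T₁)) := by
    intro r; simp only [Set.mem_union]; tauto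
  have sub2 : ({u} ∪ ({v} ∪ T₁) : Set V) ⊆ {u} ∪ ({v} ∪ (T₂ ∪ T₁)) := by
    intro r; simp only [Set.mem_union]; tauto
  obtain ⟨g, hg1, hg2, hg3, hg4⟩ := hole_around hG hℓ hth.hS hth.h1 hth.f01 h2 (by omega)
    (by simp [ha]) (sub1 hx') (sub1 hy') hax hay hxy
  obtain ⟨g₂, hk1, hk2, hk3, hk4⟩ := hole_around hG hℓ hth.h2 hth.h1 hth.f12.symm (by omega)
    (by omega) (by simp [ha]) (sub2 hx') (sub2 hy') hax hay hxy
  have haH : a ∈ thetaSet u v S T₁ T₂ := by simp [thetaSet, ha]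
  refine hg1.flip_false hG hg2 le_rfl (by omega) (by omega) hk2 (by omega) (by omega) hR ?_ ?_
    (Set.disjoint_singleton_right.2 fun e => Set.disjoint_left.1 hd e haH)
  · refine far_of_diff hRH (fun r hr => ?_) (Set.disjoint_left.2 fun r hr => ?_)
    · have : r ∈ {u} ∪ ({v} ∪ (S ∪ T₁)) := by rw [hg4]; simp [hr]
      simp only [thetaSet, Set.mem_union] at this ⊢; tauto
    · rintro (rfl | rfl | rfl)
      exacts [hg2.left_notMem hr, hg3.notMem hr, hg2.right_notMem hr]
  · refine far_of_diff hRH (fun r hr => ?_) (Set.disjoint_left.2 fun r hr => ?_)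
    · have : r ∈ {u} ∪ ({v} ∪ (T₂ ∪ T₁)) := by rw [hk4]; simp [hr]
      simp only [thetaSet, Set.mem_union] at this ⊢; tauto
    · rintro (rfl | rfl | rfl)
      exacts [hk2.left_notMem hr, hk3.notMem hr, hk2.right_notMem hr]

end ThetaEars

section MaxThetas

variable {G : SimpleGraph V} {x y z u v w h d a b : V}
  {A B A' B' D H K R I J S T T₁ T₂ f g W W₂ : Set V}
  {m k ℓ L s t e g' i i' j j' k₂ n : ℕ}

/-- A segment of a path, and its complement in any hole through the path. -/
theorem IP.segment (hT : IP G u v t T) (hx : x ∈ T) (hh : h ∈ {u} ∪ ({v} ∪ T))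
    (hxh : Far G {x} {h}) : ∃ e f, IP G x h e f ∧ f ⊆ T ∧ e < t ∧
      ∀ k W, IP G u v k W → Far G W T → ∃ g' g, IP G x h g' g ∧ Far G f g ∧ e + g' = t + k ∧
        g ⊆ {u} ∪ ({v} ∪ (W ∪ T)) := by
  have key : ∀ {u v T}, IP G u v t T → x ∈ T → (h = u ∨
      ∃ i j A B, IP G u x i A ∧ IP G x v j B ∧ Far G ({u} ∪ A) ({v} ∪ B) ∧
        T = A ∪ ({x} ∪ B) ∧ i + j = t ∧ h ∈ A) → ∃ e f, IP G x h e f ∧ f ⊆ T ∧ e < t ∧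
      ∀ k W, IP G u v k W → Far G W T → ∃ g' g, IP G x h g' g ∧ Far G f g ∧ e + g' = t + k ∧
        g ⊆ {u} ∪ ({v} ∪ (W ∪ T)) := by
    intro u v T hT hx hh
    have hpos := hT.far_ends
    rcases hh with rfl | ⟨i, j, A, B, hA, hB, hAB, rfl, rfl, hh⟩
    · obtain ⟨i, j, A, B, hA, hB, hAB, rfl, rfl⟩ := hT.split_mem hx
      have p1 := hA.pos
      have p2 := hB.pos
      refine ⟨i, A, hA.symm, fun r hr => Or.inl hr, by omega, fun k W hW hWT => ?_⟩
      refine ⟨_, _, hB.glue hW.symm ?_, ?_, by omega, ?_⟩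
      · grind [far_union_left, far_union_right, Far.symm]
      · grind [far_union_left, far_union_right, Far.symm]
      · intro r; simp only [Set.mem_union]; tauto
    · obtain ⟨i', j', A', B', hA', hB', hAB', rfl, rfl⟩ := hA.split_mem hh
      have p1 := hA'.pos
      have p2 := hB'.pos
      have p3 := hB.pos
      have hpos' := hpos (by omega)
      refine ⟨_, _, hB'.symm, ?_, by omega, fun k W hW hWT => ?_⟩
      · intro r; simp only [Set.mem_union]; tauto
      refine ⟨_, _, (hB.glue hW.symm ?_).glue hA' ?_, ?_, by omega, ?_⟩
      · grind [far_union_left, far_union_right, Far.symm]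
      · grind [far_union_left, far_union_right, Far.symm]
      · grind [far_union_left, far_union_right, Far.symm]
      · intro r; simp only [Set.mem_union]; tauto
  have key' : (h = v ∨
      ∃ i j A B, IP G v x i A ∧ IP G x u j B ∧ Far G ({v} ∪ A) ({u} ∪ B) ∧
        T = A ∪ ({x} ∪ B) ∧ i + j = t ∧ h ∈ A) → ∃ e f, IP G x h e f ∧ f ⊆ T ∧ e < t ∧
      ∀ k W, IP G u v k W → Far G W T → ∃ g' g, IP G x h g' g ∧ Far G f g ∧ e + g' = t + k ∧
        g ⊆ {u} ∪ ({v} ∪ (W ∪ T)) := by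
    intro hh
    obtain ⟨e, f, h1, h2, h3, h4⟩ := key hT.symm hx hh
    refine ⟨e, f, h1, h2, h3, fun k W hW hWT => ?_⟩
    rw [Set.union_left_comm]
    exact h4 k W hW.symm hWT
  rcases hh with rfl | rfl | hh
  · exact key hT hx (Or.inl rfl)
  · exact key' (Or.inl rfl)
  · obtain ⟨i, j, A, B, hA, hB, hAB, rfl, rfl⟩ := hT.split_mem hx
    rcases hh with hh | rfl | hh
    · exact key hT hx (Or.inr ⟨i, j, A, B, hA, hB, hAB, rfl, rfl, hh⟩)
    · exact absurd rfl (far_singleton.1 hxh).1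
    · refine key' (Or.inr ⟨j, i, B, A, hB.symm, hA.symm, hAB.symm, ?_, by omega, hh⟩)
      ext r; simp only [Set.mem_union]; tauto

theorem IP.segment_ear (hG : InGFamily ℓ G) (hT : IP G u v t T) (hx : x ∈ T)
    (hh : h ∈ {u} ∪ ({v} ∪ T)) (hxh : Far G {x} {h}) (hW : IP G u v k W) (hWT : Far G W T)
    (htk : t + k = 2 * ℓ + 1) (hW₂ : IP G u v k₂ W₂) (hWT₂ : Far G W₂ T) (hk₂ : k₂ % 2 = t % 2)
    (hk : 2 * ℓ + 1 ≤ t + k₂) (hR : IP G x h L R) (hRH : Far G R (H \ {x, h}))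
    (hH : {u} ∪ ({v} ∪ T) ⊆ H) (hWH : W ⊆ H) (hWH₂ : W₂ ⊆ H) :
    ∃ s' t' S' T', t' < t ∧ ℓ < t' ∧ Theta G ℓ x h s' t' S' T' R := by
  obtain ⟨e, f, hf, hfT, het, hg⟩ := hT.segment hx hh hxh
  obtain ⟨g', g, hg1, hfg, heg, hgH⟩ := hg k W hW hWT
  obtain ⟨k', g₂, hk1, hfk, hek, hkH⟩ := hg k₂ W₂ hW₂ hWT₂
  have he := hf.two_le_of_far hxh
  have hTH : T ⊆ H := fun r hr => hH (by simp [hr])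
  have a1 : Far G R f := hRH.diff_pair (hfT.trans hTH) hf.left_notMem hf.right_notMem
  have a2 : Far G R g := by
    refine hRH.diff_pair (hgH.trans fun r hr => ?_) hg1.left_notMem hg1.right_notMem
    have := @hH r; have := @hWH r; simp only [Set.mem_union] at *; tauto
  have a3 : Far G R g₂ := by
    refine hRH.diff_pair (hkH.trans fun r hr => ?_) hk1.left_notMem hk1.right_notMem
    have := @hH r; have := @hWH₂ r; simp only [Set.mem_union] at *; tauto
  by_cases heℓ : e ≤ ℓ
  · exact (hf.flip_false hG hg1 he heℓ (by omega) hk1 (by omega) (by omega) hR a2 a3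
      a1.disjoint).elim
  · exact ⟨g', e, g, f, het, by omega, hg1.theta hG hf (hg1.two_le_of_far hxh) (by omega)
      (by omega) hfg.symm hR a2 a1⟩

/-- A clean ear of an odd hole gives a theta. -/
theorem hole_ear (hG : InGFamily ℓ G) (hS : IP G u v s S) (hT : IP G u v t T)
    (hf : Far G S T) (hs : 2 ≤ s) (ht : 2 ≤ t) (hst : s + t = 2 * ℓ + 1)
    (hx : x ∈ {u} ∪ ({v} ∪ (S ∪ T))) (hh : h ∈ {u} ∪ ({v} ∪ (S ∪ T)))
    (hxh : Far G {x} {h}) (hR : IP G x h L R)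
    (hRH : Far G R (({u} ∪ ({v} ∪ (S ∪ T))) \ {x, h})) :
    ∃ e f g' g, Theta G ℓ x h e g' f g R := by
  obtain ⟨e, f, g', g, h1, h2, h3, h4, h5, h6⟩ := hole_arcs hS hT hf hs ht hx hh hxh
  rw [h5] at hRH
  exact ⟨e, f, g', g, h1.theta hG h2 (h1.two_le_of_far hxh) (by omega) (by omega) h3 hR
    (hRH.diff_pair (by intro r; simp; tauto) h1.left_notMem h1.right_notMem)
    (hRH.diff_pair (by intro r; simp; tauto) h2.left_notMem h2.right_notMem)⟩

set_option maxHeartbeats 1000000 in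
theorem theta_of_attach (hG : InGFamily ℓ G) (hℓ : 4 ≤ ℓ) (hA : IP G u x i A)
    (hA' : IP G x v i' A') (hB : IP G u y j B) (hB' : IP G y v j' B') (hS : IP G u v s S)
    (hAA : Far G ({u} ∪ A) ({v} ∪ A')) (hBB : Far G ({u} ∪ B) ({v} ∪ B'))
    (hAB : Far G (A ∪ ({x} ∪ A')) (B ∪ ({y} ∪ B')))
    (f01 : Far G S (A ∪ ({x} ∪ A'))) (f02 : Far G S (B ∪ ({y} ∪ B')))
    (hwx : G.Adj w x) (hwy : G.Adj w y) (hw1 : Far G {w} ({u} ∪ ({v} ∪ (S ∪ (A ∪ A')))))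
    (hw2 : Far G {w} (B ∪ B')) (hs : s = 2) (hi : i + i' = 2 * ℓ - 1) (hj : j + j' = 2 * ℓ - 1) :
    ∃ i t T T', 3 ≤ i ∧ Theta G ℓ u x i t A T T' := by
  have p1 := hA.pos
  have p2 := hA'.pos
  have p3 := hB.pos
  have p4 := hB'.pos
  have k1 : i' ≥ 2 → Far G {x} {v} := hA'.far_ends
  have k2 : i ≥ 2 → Far G {u} {x} := hA.far_ends
  have k3 : j' ≥ 2 → Far G {y} {v} := hB'.far_ends
  have k4 : j ≥ 2 → Far G {u} {y} := hB.far_ends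
  have hwA : w ∉ {u} ∪ ({v} ∪ (S ∪ (A ∪ A'))) := hw1.notMem
  have hwB : w ∉ B ∪ B' := hw2.notMem
  simp only [Set.mem_union] at hwA hwB
  have c1 := (hA.symm.glue hB (by grind [far_union_left, far_union_right, Far.symm])).cyc_vertex
    hG hwx.symm hwy (by grind)
  have c2 := (hA'.glue hB'.symm (by
    grind [far_union_left, far_union_right, Far.symm])).cyc_vertex
    hG hwx.symm hwy (by grind)
  obtain ⟨rfl, rfl⟩ : j = i' ∧ j' = i := by omega
  have c3 : 2 ≤ j → 2 * ℓ + 1 ≤ j' + s + j' + 2 := fun hj2 =>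
    ((hA.symm.glue hS (by grind [far_union_left, far_union_right, Far.symm])).glue hB'.symm (by
      grind [far_union_left, far_union_right, Far.symm])).cyc_vertex
    hG hwx.symm hwy (by grind)
  have c4 : 2 ≤ j' → 2 * ℓ + 1 ≤ j + s + j + 2 := fun hj2 =>
    ((hA'.glue hS.symm (by grind [far_union_left, far_union_right, Far.symm])).glue hB (by
      grind [far_union_left, far_union_right, Far.symm])).cyc_vertex
    hG hwx.symm hwy (by grind)
  have hj2 : 2 ≤ j := by omega
  have hj2' : 2 ≤ j' := by omega
  have c3 := c3 hj2
  have c4 := c4 hj2'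
  have k1 := k1 hj2
  have k2 := k2 hj2'
  have k3 := k3 hj2'
  have k4 := k4 hj2
  have e1 : IP G y x 2 {w} := by
    have := (IP.edge hwy.symm).glue (IP.edge hwx) (by
      grind [far_union_left, far_union_right, Far.symm, far_empty_left, far_empty_right])
    simpa using this
  have g1 := hB.glue e1 (by grind [far_union_left, far_union_right, Far.symm])
  have g2 := hS.glue hA'.symm (by grind [far_union_left, far_union_right, Far.symm])
  exact ⟨_, _, _, _, by omega, hA.theta hG g1 hj2' (by omega) (by omega)
    (by grind [far_union_left, far_union_right, Far.symm]) g2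
    (by grind [far_union_left, far_union_right, Far.symm])
    (by grind [far_union_left, far_union_right, Far.symm])⟩

theorem Theta.uniq (hth : Theta G ℓ u v s t S T₁ T₂) (hG : InGFamily ℓ G) (hℓ : 4 ≤ ℓ)
    (hmax : MaxTheta G ℓ s) (hw : w ∉ thetaSet u v S T₁ T₂)
    (hx : x ∈ thetaSet u v S T₁ T₂) (hy : y ∈ thetaSet u v S T₁ T₂)
    (hwx : G.Adj w x) (hwy : G.Adj w y) : x = y := by
  have hsum := hth.sum
  have hle := hth.le
  have h2 := hth.two_le
  have u1 : ∀ {x y}, x ∈ {u} ∪ ({v} ∪ (S ∪ T₁)) → y ∈ {u} ∪ ({v} ∪ (S ∪ T₁)) → G.Adj w x →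
      G.Adj w y → x = y := hole_uniq hG hℓ hth.hS hth.h1 hth.f01 h2 (by omega) (by omega)
      (fun e => hw (by simp only [thetaSet, Set.mem_union] at e ⊢; tauto))
  have u2 : ∀ {x y}, x ∈ {u} ∪ ({v} ∪ (S ∪ T₂)) → y ∈ {u} ∪ ({v} ∪ (S ∪ T₂)) → G.Adj w x →
      G.Adj w y → x = y := hole_uniq hG hℓ hth.hS hth.h2 hth.f02 h2 (by omega) (by omega)
      (fun e => hw (by simp only [thetaSet, Set.mem_union] at e ⊢; tauto))
  have key : ∀ {x y}, x ∈ T₁ → y ∈ T₂ → G.Adj w x → G.Adj w y → False := by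
    clear hx hy hwx hwy
    intro x y hx hy hwx hwy
    by_cases hs3 : 3 ≤ s
    · have := hole_uniq hG hℓ hth.h1 hth.h2 hth.f12 (by omega) (by omega) (by omega)
        (fun e => hw (by simp only [thetaSet, Set.mem_union] at e ⊢; tauto))
        (x := x) (y := y) (by simp [hx]) (by simp [hy]) hwx hwy
      subst this
      exact (hth.f12 x hx x hy).1 rfl
    have f01 := hth.f01
    have f02 := hth.f02
    obtain ⟨i, i', A, A', hA, hA', hAA, rfl, hi⟩ := hth.h1.split_mem hx
    obtain ⟨j, j', B, B', hB, hB', hBB, rfl, hj⟩ := hth.h2.split_mem hy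
    have hw1 : Far G {w} ({u} ∪ ({v} ∪ (S ∪ (A ∪ A')))) := by
      rintro _ rfl r hr
      refine ⟨fun e => hw ?_, fun e => ?_⟩
      · subst e
        simp only [thetaSet, Set.mem_union] at hr ⊢; tauto
      · have := u1 (x := x) (y := r) (by simp) (by
          simp only [Set.mem_union] at hr ⊢; tauto) hwx e
        subst this
        rcases hr with rfl | rfl | hr | hr | hr
        · exact hA.ne rfl
        · exact hA'.ne rfl
        · exact (f01 _ hr x (by simp)).1 rfl
        · exact hA.right_notMem hr
        · exact hA'.left_notMem hr
    have hw2 : Far G {w} (B ∪ B') := by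
      rintro _ rfl r hr
      refine ⟨fun e => hw ?_, fun e => ?_⟩
      · subst e
        simp only [thetaSet, Set.mem_union] at hr ⊢; tauto
      · have := u2 (x := y) (y := r) (by simp) (by
          simp only [Set.mem_union] at hr ⊢; tauto) hwy e
        subst this
        rcases hr with hr | hr
        · exact hB.right_notMem hr
        · exact hB'.left_notMem hr
    obtain ⟨i, t', T, T', hi3, hT⟩ := theta_of_attach hG hℓ hA hA' hB hB' hth.hS hAA hBB hth.f12
      f01 f02 hwx hwy hw1 hw2 (by omega) (by omega) (by omega)
    have := hmax _ _ _ _ _ _ _ hT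
    omega
  simp only [thetaSet, Set.mem_union] at hx hy
  rcases em (x ∈ T₁) with h1 | h1 <;> rcases em (y ∈ T₂) with h2 | h2
  · exact (key h1 h2 hwx hwy).elim
  · exact u1 (by simp [h1]) (by simp only [Set.mem_union]; tauto) hwx hwy
  · exact u2 (by simp only [Set.mem_union]; tauto) (by simp [h2]) hwx hwy
  · rcases em (y ∈ T₁) with h3 | h3
    · rcases em (x ∈ T₂) with h4 | h4
      · exact (key h3 h4 hwy hwx).elim
      · exact u1 (by simp only [Set.mem_union]; tauto) (by simp [h3]) hwx hwy
    · exact u2 (by simp only [Set.mem_union]; tauto) (by simp only [Set.mem_union]; tauto) hwx hwy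

end MaxThetas

section Tetrahedra

variable {G : SimpleGraph V} {x y z u v w h d a b u1 u2 u3 u4 : V}
  {A B A' B' H R S P1 P2 Q1 Q2 L1 L2 : Set V}
  {m k ℓ L s t i i' j j' p q l : ℕ}

/-- An induced subdivision of `K₄` in which opposite edges are subdivided equally often and all
the faces have length `2ℓ + 1`. -/
structure Tetra (G : SimpleGraph V) (ℓ : ℕ) (u1 u2 u3 u4 : V) (p q l : ℕ)
    (P1 P2 Q1 Q2 L1 L2 : Set V) : Prop where
  hP1 : IP G u1 u2 p P1
  hP2 : IP G u3 u4 p P2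
  hQ1 : IP G u2 u3 q Q1
  hQ2 : IP G u1 u4 q Q2
  hL1 : IP G u1 u3 l L1
  hL2 : IP G u2 u4 l L2
  fP1 : Far G P1 ({u3} ∪ {u4} ∪ (P2 ∪ Q1 ∪ Q2 ∪ L1 ∪ L2))
  fP2 : Far G P2 ({u1} ∪ {u2} ∪ (Q1 ∪ Q2 ∪ L1 ∪ L2))
  fQ1 : Far G Q1 ({u1} ∪ {u4} ∪ (Q2 ∪ L1 ∪ L2))
  fQ2 : Far G Q2 ({u2} ∪ {u3} ∪ (L1 ∪ L2))
  fL1 : Far G L1 ({u2} ∪ {u4} ∪ L2)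
  fL2 : Far G L2 ({u1} ∪ {u3})
  sum : p + q + l = 2 * ℓ + 1
  hp2 : 2 ≤ p
  hq2 : 2 ≤ q
  hl2 : 2 ≤ l
  hp : p ≤ ℓ
  hq : q ≤ ℓ
  hl : l ≤ ℓ

/-- The vertex set of a subdivision of `K₄`. -/
def tetraSet (u1 u2 u3 u4 : V) (P1 P2 Q1 Q2 L1 L2 : Set V) : Set V :=
  {u1} ∪ {u2} ∪ {u3} ∪ {u4} ∪ P1 ∪ P2 ∪ Q1 ∪ Q2 ∪ L1 ∪ L2

theorem Tetra.swap34 (K : Tetra G ℓ u1 u2 u3 u4 p q l P1 P2 Q1 Q2 L1 L2) :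
    Tetra G ℓ u1 u2 u4 u3 p l q P1 P2 L2 L1 Q2 Q1 := by
  obtain ⟨h1, h2, h3, h4, h5, h6, f1, f2, f3, f4, f5, f6, k1, k2, k3, k4, k5, k6, k7⟩ := K
  refine ⟨h1, h2.symm, h6, h5, h4, h3, ?_, ?_, ?_, ?_, ?_, ?_, by omega, k2, k4, k3, k5, k7, k6⟩ <;>
  grind [far_union_left, far_union_right, Far.symm]

theorem Tetra.swap12 (K : Tetra G ℓ u1 u2 u3 u4 p q l P1 P2 Q1 Q2 L1 L2) :
    Tetra G ℓ u2 u1 u4 u3 p q l P1 P2 Q2 Q1 L2 L1 := by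
  obtain ⟨h1, h2, h3, h4, h5, h6, f1, f2, f3, f4, f5, f6, k1, k2, k3, k4, k5, k6, k7⟩ := K
  refine ⟨h1.symm, h2.symm, h4, h3, h6, h5, ?_, ?_, ?_, ?_, ?_, ?_, by omega, k2, k3, k4, k5, k6,
    k7⟩ <;>
  grind [far_union_left, far_union_right, Far.symm]

theorem Tetra.swap23 (K : Tetra G ℓ u1 u2 u3 u4 p q l P1 P2 Q1 Q2 L1 L2) :
    Tetra G ℓ u1 u3 u2 u4 l q p L1 L2 Q1 Q2 P1 P2 := by
  obtain ⟨h1, h2, h3, h4, h5, h6, f1, f2, f3, f4, f5, f6, k1, k2, k3, k4, k5, k6, k7⟩ := K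
  refine ⟨h5, h6, h3.symm, h4, h1, h2, ?_, ?_, ?_, ?_, ?_, ?_, by omega, k4, k3, k2, k7, k6,
    k5⟩ <;>
  grind [far_union_left, far_union_right, Far.symm]

theorem tetraSet_swap34 : tetraSet u1 u2 u3 u4 P1 P2 Q1 Q2 L1 L2 =
    tetraSet u1 u2 u4 u3 P1 P2 L2 L1 Q2 Q1 := by
  ext; simp only [tetraSet, Set.mem_union]; tauto

theorem tetraSet_swap12 : tetraSet u1 u2 u3 u4 P1 P2 Q1 Q2 L1 L2 =
    tetraSet u2 u1 u4 u3 P1 P2 Q2 Q1 L2 L1 := by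
  ext; simp only [tetraSet, Set.mem_union]; tauto

theorem tetraSet_swap23 : tetraSet u1 u2 u3 u4 P1 P2 Q1 Q2 L1 L2 =
    tetraSet u1 u3 u2 u4 L1 L2 Q1 Q2 P1 P2 := by
  ext; simp only [tetraSet, Set.mem_union]; tauto

/-- The theta obtained by deleting an edge of the subdivided `K₄`. -/
theorem Tetra.theta (K : Tetra G ℓ u1 u2 u3 u4 p q l P1 P2 Q1 Q2 L1 L2) :
    Theta G ℓ u2 u3 q (p + l) Q1 (P1 ∪ ({u1} ∪ L1)) (L2 ∪ ({u4} ∪ P2)) := by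
  obtain ⟨h1, h2, h3, h4, h5, h6, f1, f2, f3, f4, f5, f6, k1, k2, k3, k4, k5, k6, k7⟩ := K
  have e3 := h3.far_ends k3
  have e4 := h4.far_ends k3
  refine ⟨h3, h1.symm.glue h5 ?_, ?_, ?_, ?_, ?_, by omega, k3, k6⟩
  · grind [far_union_left, far_union_right, Far.symm]
  · rw [add_comm p]
    exact h6.glue h2.symm (by grind [far_union_left, far_union_right, Far.symm])
  · grind [far_union_left, far_union_right, Far.symm]
  · grind [far_union_left, far_union_right, Far.symm]
  · grind [far_union_left, far_union_right, Far.symm]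

theorem Tetra.uniq_opposite (K : Tetra G ℓ u1 u2 u3 u4 p q l P1 P2 Q1 Q2 L1 L2)
    (hG : InGFamily ℓ G) (hw : w ∉ tetraSet u1 u2 u3 u4 P1 P2 Q1 Q2 L1 L2)
    (hx : x ∈ P1) (hy : y ∈ P2) (hwx : G.Adj w x) (hwy : G.Adj w y) : False := by
  obtain ⟨h1, h2, h3, h4, h5, h6, f1, f2, f3, f4, f5, f6, k1, k2, k3, k4, k5, k6, k7⟩ := K
  have e3 := h3.far_ends k3
  have e4 := h4.far_ends k3
  have e5 := h5.far_ends k4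
  have e6 := h6.far_ends k4
  simp only [far_union_right] at f1 f2 f3 f4 f5 f6
  obtain ⟨i, i', A, A', hA, hA', hAA, rfl, rfl⟩ := h1.split_mem hx
  obtain ⟨j, j', B, B', hB, hB', hBB, rfl, hj⟩ := h2.split_mem hy
  simp only [tetraSet, Set.mem_union, not_or] at hw
  have c1 := ((hA.symm.glue h5 (by grind [far_union_left, far_union_right, Far.symm])).glue hB (by
    grind [far_union_left, far_union_right, Far.symm])).cyc_vertex hG hwx.symm hwy
      (by simp only [Set.mem_union, hw, or_self, not_false_eq_true])
  have c2 := ((hA.symm.glue h4 (by grind [far_union_left, far_union_right, Far.symm])).glue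
    hB'.symm (by
    grind [far_union_left, far_union_right, Far.symm])).cyc_vertex hG hwx.symm hwy
      (by simp only [Set.mem_union, hw, or_self, not_false_eq_true])
  have c3 := ((hA'.glue h3 (by grind [far_union_left, far_union_right, Far.symm])).glue hB (by
    grind [far_union_left, far_union_right, Far.symm])).cyc_vertex hG hwx.symm hwy
      (by simp only [Set.mem_union, hw, or_self, not_false_eq_true])
  have c4 := ((hA'.glue h6 (by grind [far_union_left, far_union_right, Far.symm])).glue hB'.symm (by
    grind [far_union_left, far_union_right, Far.symm])).cyc_vertex hG hwx.symm hwy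
      (by simp only [Set.mem_union, hw, or_self, not_false_eq_true])
  omega

theorem Tetra.uniq_face (K : Tetra G ℓ u1 u2 u3 u4 p q l P1 P2 Q1 Q2 L1 L2)
    (hG : InGFamily ℓ G) (hℓ : 4 ≤ ℓ) (hw : w ∉ tetraSet u1 u2 u3 u4 P1 P2 Q1 Q2 L1 L2)
    (hx : x ∈ {u1} ∪ {u2} ∪ {u3} ∪ P1 ∪ Q1 ∪ L1) (hy : y ∈ {u1} ∪ {u2} ∪ {u3} ∪ P1 ∪ Q1 ∪ L1)
    (hwx : G.Adj w x) (hwy : G.Adj w y) : x = y := by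
  have hth := K.theta
  have := K.hp2
  have := K.hl2
  have := K.sum
  refine hole_uniq hG hℓ hth.hS hth.h1 hth.f01 K.hq2 (by omega) (by omega)
    (fun h => hw ?_) ?_ ?_ hwx hwy
  · clear * - h
    simp only [tetraSet, Set.mem_union] at *
    tauto
  · clear * - hx
    simp only [Set.mem_union] at *
    tauto
  · clear * - hy
    simp only [Set.mem_union] at *
    tauto

theorem Tetra.uniq (K : Tetra G ℓ u1 u2 u3 u4 p q l P1 P2 Q1 Q2 L1 L2)
    (hG : InGFamily ℓ G) (hℓ : 4 ≤ ℓ) (hw : w ∉ tetraSet u1 u2 u3 u4 P1 P2 Q1 Q2 L1 L2)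
    (hx : x ∈ tetraSet u1 u2 u3 u4 P1 P2 Q1 Q2 L1 L2)
    (hy : y ∈ tetraSet u1 u2 u3 u4 P1 P2 Q1 Q2 L1 L2)
    (hwx : G.Adj w x) (hwy : G.Adj w y) : x = y := by
  have w1 := hw
  rw [tetraSet_swap12] at w1
  have w2 := hw
  rw [tetraSet_swap23] at w2
  have w3 := hw
  rw [tetraSet_swap34, tetraSet_swap23] at w3
  have w4 := w2
  rw [tetraSet_swap12] at w4
  have w5 := w1
  rw [tetraSet_swap23, tetraSet_swap34] at w5
  have g1 := K.uniq_face (x := x) (y := y) hG hℓ hw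
  have g2 := K.swap12.uniq_face (x := x) (y := y) hG hℓ w1
  have g3 := K.swap23.swap12.uniq_face (x := x) (y := y) hG hℓ w4
  have g4 := K.swap12.swap23.swap34.uniq_face (x := x) (y := y) hG hℓ w5
  have o1 := K.uniq_opposite (x := x) (y := y) hG hw
  have o2 := K.swap23.uniq_opposite (x := x) (y := y) hG w2
  have o3 := K.swap34.swap23.uniq_opposite (x := x) (y := y) hG w3
  have o4 := K.uniq_opposite (x := y) (y := x) hG hw
  have o5 := K.swap23.uniq_opposite (x := y) (y := x) hG w2
  have o6 := K.swap34.swap23.uniq_opposite (x := y) (y := x) hG w3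
  clear w1 w2 w3 w4 w5 hw K
  simp only [hwx, hwy, forall_true_left] at g1 g2 g3 g4 o1 o2 o3 o4 o5 o6
  simp only [tetraSet, Set.mem_union] at hx hy g1 g2 g3 g4
  rcases hx with ((((((((hx | hx) | hx) | hx) | hx) | hx) | hx) | hx) | hx) | hx <;>
  rcases hy with ((((((((hy | hy) | hy) | hy) | hy) | hy) | hy) | hy) | hy) | hy <;>
  first
  | exact g1 (by simp only [hx, true_or, or_true]) (by simp only [hy, true_or, or_true])
  | exact g2 (by simp only [hx, true_or, or_true]) (by simp only [hy, true_or, or_true])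
  | exact g3 (by simp only [hx, true_or, or_true]) (by simp only [hy, true_or, or_true])
  | exact g4 (by simp only [hx, true_or, or_true]) (by simp only [hy, true_or, or_true])
  | exact (o1 hx hy).elim
  | exact (o2 hx hy).elim
  | exact (o3 hx hy).elim
  | exact (o4 hy hx).elim
  | exact (o5 hy hx).elim
  | exact (o6 hy hx).elim

/-- Ears between two vertices of one subdivided edge. -/
theorem Tetra.no_ear_edge (K : Tetra G ℓ u1 u2 u3 u4 p q l P1 P2 Q1 Q2 L1 L2)
    (hG : InGFamily ℓ G) (hx : x ∈ P1) (hh : h ∈ {u1} ∪ {u2} ∪ P1) (hxh : Far G {x} {h})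
    (hR : IP G x h L R)
    (hRH : Far G R (tetraSet u1 u2 u3 u4 P1 P2 Q1 Q2 L1 L2 \ {x, h})) : False := by
  have hth := K.theta
  obtain ⟨h1, h2, h3, h4, h5, h6, f1, f2, f3, f4, f5, f6, k1, k2, k3, k4, k5, k6, k7⟩ := K
  have e3 := h3.far_ends k3
  have e4 := h4.far_ends k3
  have e5 := h5.far_ends k4
  have e6 := h6.far_ends k4
  have e1 := h1.far_ends k2
  have e2 := h2.far_ends k2
  have W := h5.glue h3.symm (by grind [far_union_left, far_union_right, Far.symm])
  have W2 := h5.glue hth.h2.symm (by grind [far_union_left, far_union_right, Far.symm])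
  obtain ⟨s, t, S, T, ht, ht', -⟩ := h1.segment_ear hG hx (by
    simp only [Set.mem_union] at hh ⊢; tauto) hxh W (by
    grind [far_union_left, far_union_right, Far.symm]) (by omega) W2 (by
    grind [far_union_left, far_union_right, Far.symm]) (by omega) (by omega) hR hRH
    (by intro r; simp only [tetraSet, Set.mem_union]; tauto)
    (by intro r; simp only [tetraSet, Set.mem_union]; tauto)
    (by intro r; simp only [tetraSet, Set.mem_union]; tauto)
  omega

theorem Tetra.no_ear_ends (K : Tetra G ℓ u1 u2 u3 u4 p q l P1 P2 Q1 Q2 L1 L2)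
    (hG : InGFamily ℓ G) (hR : IP G u1 u2 L R)
    (hRH : Far G R (tetraSet u1 u2 u3 u4 P1 P2 Q1 Q2 L1 L2 \ {u1, u2})) : False := by
  have hth := K.theta
  obtain ⟨h1, h2, h3, h4, h5, h6, f1, f2, f3, f4, f5, f6, k1, k2, k3, k4, k5, k6, k7⟩ := K
  have e3 := h3.far_ends k3
  have e4 := h4.far_ends k3
  have e5 := h5.far_ends k4
  have e6 := h6.far_ends k4
  have e1 := h1.far_ends k2
  have e2 := h2.far_ends k2
  have W := h5.glue h3.symm (by grind [far_union_left, far_union_right, Far.symm])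
  have W2 := h5.glue hth.h2.symm (by grind [far_union_left, far_union_right, Far.symm])
  refine h1.flip_false hG W k2 k5 (by omega) W2 (by omega) (by omega) hR ?_ ?_ ?_
  · exact hRH.diff_pair (by intro r; simp only [tetraSet, Set.mem_union]; tauto) W.left_notMem
      W.right_notMem
  · exact hRH.diff_pair (by intro r; simp only [tetraSet, Set.mem_union]; tauto) W2.left_notMem
      W2.right_notMem
  · exact (hRH.diff_pair (by intro r; simp only [tetraSet, Set.mem_union]; tauto) h1.left_notMem
      h1.right_notMem).disjoint

end Tetrahedra

section TetrahedronEars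

variable {G : SimpleGraph V} {x y z u v w h d a b u1 u2 u3 u4 : V}
  {A B A' B' H R S T₁ T₂ P1 P2 Q1 Q2 L1 L2 : Set V}
  {m k ℓ L s t i i' j j' p q l : ℕ}

theorem IP.disjoint_of_clean (hR : IP G x h L R) (hRH : Far G R (H \ {x, h})) : Disjoint R H := by
  refine Set.disjoint_left.2 fun r hr hrH => ?_
  by_cases e : r ∈ ({x, h} : Set V)
  · rcases e with rfl | rfl
    exacts [hR.left_notMem hr, hR.right_notMem hr]
  · exact (hRH r hr r ⟨hrH, e⟩).1 rfl

theorem Theta.ear_far (hth : Theta G ℓ u v s t S (A ∪ ({x} ∪ A')) (B ∪ ({h} ∪ B')))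
    (hA : IP G u x i A) (hA' : IP G x v i' A') (hB : IP G u h j B) (hB' : IP G h v j' B')
    (hRH : Far G R (H \ {x, h}))
    (hH : thetaSet u v S (A ∪ ({x} ∪ A')) (B ∪ ({h} ∪ B')) ⊆ H) :
    Far G R (({u} ∪ {v}) ∪ (S ∪ (A ∪ A') ∪ (B ∪ B'))) := by
  have f01 := hth.f01
  have f02 := hth.f02
  have f12 := hth.f12
  have n1 : ∀ {C : Set V}, Far G C (A ∪ ({x} ∪ A')) → x ∉ C := fun hC hx =>
    (hC x hx x (by simp)).1 rfl
  have n2 : ∀ {C : Set V}, Far G C (B ∪ ({h} ∪ B')) → h ∉ C := fun hC hx =>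
    (hC h hx h (by simp)).1 rfl
  refine hRH.diff_pair (fun r hr => hH ?_) ?_ ?_
  · simp only [thetaSet, Set.mem_union] at *
    tauto
  · have := n1 f01
    have := n1 f12.symm
    simp only [Set.mem_union, Set.mem_singleton_iff, not_or] at *
    have := hA.ne
    have := hA'.ne
    have := hA.right_notMem
    have := hA'.left_notMem
    tauto
  · have := n2 f02
    have := n2 f12
    simp only [Set.mem_union, Set.mem_singleton_iff, not_or] at *
    have := hB.ne
    have := hB'.ne
    have := hB.right_notMem
    have := hB'.left_notMem
    tauto

theorem Theta.ear_holes (hth : Theta G ℓ u v s t S T₁ T₂) (hG : InGFamily ℓ G)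
    (hA : IP G u x i A) (hA' : IP G x v i' A') (hB : IP G u h j B) (hB' : IP G h v j' B')
    (ha : Far G ({u} ∪ A) ({v} ∪ A')) (hb : Far G ({u} ∪ B) ({v} ∪ B'))
    (hT₁ : T₁ = A ∪ ({x} ∪ A')) (hT₂ : T₂ = B ∪ ({h} ∪ B')) (hR : IP G x h L R)
    (hRH : Far G R (H \ {x, h})) (hH : thetaSet u v S T₁ T₂ ⊆ H) :
    (2 * ℓ + 1 ≤ i + j + L ∧ ((i + j + L) % 2 = 1 → i + j + L = 2 * ℓ + 1)) ∧
    (2 * ℓ + 1 ≤ i' + j' + L ∧ ((i' + j' + L) % 2 = 1 → i' + j' + L = 2 * ℓ + 1)) ∧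
    (2 ≤ i' → 2 ≤ j →
      2 * ℓ + 1 ≤ i + s + j' + L ∧ ((i + s + j' + L) % 2 = 1 → i + s + j' + L = 2 * ℓ + 1)) ∧
    (2 ≤ i → 2 ≤ j' →
      2 * ℓ + 1 ≤ i' + s + j + L ∧ ((i' + s + j + L) % 2 = 1 → i' + s + j + L = 2 * ℓ + 1)) := by
  subst hT₁ hT₂
  exact _root_.ear_holes hG hA hA' hB hB' hth.hS hR ha hb hth.f12 hth.f01 hth.f02
    (hth.ear_far hA hA' hB hB' hRH hH)

theorem Tetra.thetaSet_subset :
    thetaSet u2 u3 Q1 (P1 ∪ ({u1} ∪ L1)) (L2 ∪ ({u4} ∪ P2)) ⊆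
      tetraSet u1 u2 u3 u4 P1 P2 Q1 Q2 L1 L2 := by
  intro r
  simp only [thetaSet, tetraSet, Set.mem_union]
  tauto

theorem Tetra.no_ear_adjacent (K : Tetra G ℓ u1 u2 u3 u4 p q l P1 P2 Q1 Q2 L1 L2)
    (hG : InGFamily ℓ G) (hℓ : 4 ≤ ℓ) (hqp : q ≤ p) (hlp : l ≤ p)
    (hx : x ∈ P1) (hh : h ∈ L1 ∪ {u3}) (hxh : Far G {x} {h})
    (hR : IP G x h L R)
    (hRH : Far G R (tetraSet u1 u2 u3 u4 P1 P2 Q1 Q2 L1 L2 \ {x, h})) : False := by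
  have hth := K.swap12.theta
  have hsub : thetaSet u1 u4 Q2 (P1 ∪ ({u2} ∪ L2)) (L1 ∪ ({u3} ∪ P2)) ⊆
      tetraSet u1 u2 u3 u4 P1 P2 Q1 Q2 L1 L2 := by
    rw [tetraSet_swap12]
    exact Tetra.thetaSet_subset
  have hL := hR.two_le_of_far hxh
  have K' := K
  obtain ⟨h1, h2, h3, h4, h5, h6, f1, f2, f3, f4, f5, f6, k1, k2, k3, k4, k5, k6, k7⟩ := K
  have e3 := h3.far_ends k3
  have e4 := h4.far_ends k3
  have e5 := h5.far_ends k4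
  have e6 := h6.far_ends k4
  have e1 := h1.far_ends k2
  have e2 := h2.far_ends k2
  simp only [far_union_right] at f1 f2 f3 f4 f5 f6
  obtain ⟨i, i', A, A', hA, hA', hAA, rfl, hi⟩ := h1.split_mem hx
  have gA := hA'.glue h6 (by grind [far_union_left, far_union_right, Far.symm])
  have fA : Far G ({u1} ∪ A) ({u4} ∪ (A' ∪ ({u2} ∪ L2))) := by
    grind [far_union_left, far_union_right, Far.symm]
  have eA : A ∪ ({x} ∪ A') ∪ ({u2} ∪ L2) = A ∪ ({x} ∪ (A' ∪ ({u2} ∪ L2))) := by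
    simp only [Set.union_assoc]
  have hi1 := hA.pos
  have hi2 := hA'.pos
  rcases hh with hh | rfl
  · obtain ⟨j, j', B, B', hB, hB', hBB, rfl, hj⟩ := h5.split_mem hh
    have gB := hB'.glue h2 (by grind [far_union_left, far_union_right, Far.symm])
    have fB : Far G ({u1} ∪ B) ({u4} ∪ (B' ∪ ({u3} ∪ P2))) := by
      grind [far_union_left, far_union_right, Far.symm]
    have eB : B ∪ ({h} ∪ B') ∪ ({u3} ∪ P2) = B ∪ ({h} ∪ (B' ∪ ({u3} ∪ P2))) := by
      simp only [Set.union_assoc]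
    have hj1 := hB.pos
    have hj2 := hB'.pos
    obtain ⟨X1, X2, X3, X4⟩ := hth.ear_holes hG hA gA hB gB fA fB eA eB hR hRH hsub
    by_cases hij : i = 1 ∧ j = 1
    · obtain ⟨rfl, rfl⟩ := hij
      have a1 := hA.of_one.1
      have a2 := hB.of_one.1
      refine K'.theta.no_flip hG hℓ (a := u1) (by simp) (x := x) (y := h) (by simp [thetaSet])
        (by simp [thetaSet]) a1 a2 (far_singleton.1 hxh).1 hR ?_ ?_
      · refine hRH.mono subset_rfl ?_
        intro r hr
        refine ⟨Tetra.thetaSet_subset hr.1, fun e => hr.2 ?_⟩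
        exact Set.insert_subset_insert (by simp) e
      · exact (hR.disjoint_of_clean hRH).mono_right Tetra.thetaSet_subset
    · omega
  · have fB : Far G ({u1} ∪ L1) ({u4} ∪ P2) := by
      grind [far_union_left, far_union_right, Far.symm]
    obtain ⟨X1, X2, X3, X4⟩ := hth.ear_holes hG hA gA h5 h2 fA fB eA rfl hR hRH hsub
    omega

end TetrahedronEars

section TetrahedronEars

variable {G : SimpleGraph V} {x y z u v w h d a b u1 u2 u3 u4 : V}
  {A B A' B' H R S T₁ T₂ P1 P2 Q1 Q2 L1 L2 : Set V}
  {m k ℓ L s t i i' j j' p q l : ℕ}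

theorem Tetra.opposite_holes (K : Tetra G ℓ u1 u2 u3 u4 p q l P1 P2 Q1 Q2 L1 L2)
    (hG : InGFamily ℓ G) (hA : IP G u1 x i A) (hA' : IP G x u2 i' A')
    (hAA : Far G ({u1} ∪ A) ({u2} ∪ A')) (hP1 : P1 = A ∪ ({x} ∪ A'))
    (hB : IP G u3 h j B) (hB' : IP G h u4 j' B')
    (hBB : Far G ({u3} ∪ B) ({u4} ∪ B')) (hP2 : P2 = B ∪ ({h} ∪ B'))
    (hR : IP G x h L R)
    (hRH : Far G R (tetraSet u1 u2 u3 u4 P1 P2 Q1 Q2 L1 L2 \ {x, h})) :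
    2 * ℓ + 1 ≤ i + l + j + L ∧ 2 * ℓ + 1 ≤ i + q + j' + L ∧
    ((i + l + j + L) % 2 = 1 → i + l + j + L = 2 * ℓ + 1) ∧
    ((i + q + j' + L) % 2 = 1 → i + q + j' + L = 2 * ℓ + 1) ∧
    (2 ≤ i → 2 ≤ j' → (i' + l + q + l + j + L) % 2 = 1 →
      i' + l + q + l + j + L = 2 * ℓ + 1) := by
  have hth := K.swap12.theta
  have hsub : thetaSet u1 u4 Q2 (P1 ∪ ({u2} ∪ L2)) (L1 ∪ ({u3} ∪ P2)) ⊆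
      tetraSet u1 u2 u3 u4 P1 P2 Q1 Q2 L1 L2 := by
    rw [tetraSet_swap12]
    exact Tetra.thetaSet_subset
  obtain ⟨h1, h2, h3, h4, h5, h6, f1, f2, f3, f4, f5, f6, k1, k2, k3, k4, k5, k6, k7⟩ := K
  have e3 := h3.far_ends k3
  have e4 := h4.far_ends k3
  have e5 := h5.far_ends k4
  have e6 := h6.far_ends k4
  have e1 := h1.far_ends k2
  have e2 := h2.far_ends k2
  subst hP1 hP2
  simp only [far_union_right] at f1 f2 f3 f4 f5 f6
  have gA := hA'.glue h6 (by grind [far_union_left, far_union_right, Far.symm])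
  have fA : Far G ({u1} ∪ A) ({u4} ∪ (A' ∪ ({u2} ∪ L2))) := by
    grind [far_union_left, far_union_right, Far.symm]
  have eA : A ∪ ({x} ∪ A') ∪ ({u2} ∪ L2) = A ∪ ({x} ∪ (A' ∪ ({u2} ∪ L2))) := by
    simp only [Set.union_assoc]
  have gB := h5.glue hB (by grind [far_union_left, far_union_right, Far.symm])
  have fB : Far G ({u1} ∪ (L1 ∪ ({u3} ∪ B))) ({u4} ∪ B') := by
    grind [far_union_left, far_union_right, Far.symm]
  have eB : L1 ∪ ({u3} ∪ (B ∪ ({h} ∪ B'))) = L1 ∪ ({u3} ∪ B) ∪ ({h} ∪ B') := by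
    simp only [Set.union_assoc]
  have hi1 := hA.pos
  have hi2 := hA'.pos
  have hj1 := hB.pos
  have hj2 := hB'.pos
  obtain ⟨X1, X2, X3, X4⟩ := hth.ear_holes hG hA gA gB hB' fA fB eA eB hR hRH hsub
  have Y3 := X3 (by omega) (by omega)
  refine ⟨by omega, by omega, fun e => ?_, fun e => ?_, fun e1 e2 e => ?_⟩
  · have := X1.2 (by omega)
    omega
  · have := Y3.2 (by omega)
    omega
  · have := (X4 (by omega) (by omega)).2 (by omega)
    omega

theorem Tetra.no_ear_opposite (K : Tetra G ℓ u1 u2 u3 u4 p q l P1 P2 Q1 Q2 L1 L2)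
    (hG : InGFamily ℓ G) (hqp : q ≤ p) (hlp : l ≤ p)
    (hx : x ∈ P1) (hh : h ∈ P2) (hxh : Far G {x} {h}) (hR : IP G x h L R)
    (hRH : Far G R (tetraSet u1 u2 u3 u4 P1 P2 Q1 Q2 L1 L2 \ {x, h})) : False := by
  have hL := hR.two_le_of_far hxh
  obtain ⟨i, i', A, A', hA, hA', hAA, hP1, hi⟩ := K.hP1.split_mem hx
  obtain ⟨j, j', B, B', hB, hB', hBB, hP2, hj⟩ := K.hP2.split_mem hh
  have hP1' : P1 = A' ∪ ({x} ∪ A) := by rw [hP1]; ext; simp; tauto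
  have hP2' : P2 = B' ∪ ({h} ∪ B) := by rw [hP2]; ext; simp; tauto
  have r2 := hRH
  rw [tetraSet_swap12] at r2
  have r3 := hRH
  rw [tetraSet_swap34] at r3
  have r4 := r3
  rw [tetraSet_swap12] at r4
  obtain ⟨a1, a2, a3, a4, a5⟩ := K.opposite_holes hG hA hA' hAA hP1 hB hB' hBB hP2 hR hRH
  obtain ⟨b1, b2, b3, b4, b5⟩ := K.swap12.opposite_holes hG hA'.symm hA.symm hAA.symm hP1'
    hB'.symm hB.symm hBB.symm hP2' hR r2
  obtain ⟨c1, c2, c3, c4, c5⟩ := K.swap34.opposite_holes hG hA hA' hAA hP1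
    hB'.symm hB.symm hBB.symm hP2' hR r3
  obtain ⟨d1, d2, d3, d4, d5⟩ := K.swap34.swap12.opposite_holes hG hA'.symm hA.symm hAA.symm hP1'
    hB hB' hBB hP2 hR r4
  have m1 := K.sum
  have m2 := K.hq2
  have m3 := K.hl2
  have m4 := K.hp
  have m5 := hA.pos
  have m6 := hA'.pos
  have m7 := hB.pos
  have m8 := hB'.pos
  clear * - a1 a2 a3 a4 a5 b1 b2 b3 b4 b5 c1 c2 c3 c4 c5 d1 d2 d3
    d4 d5 hi hj hqp hlp hL m1 m2 m3 m4 m5 m6 m7 m8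
  omega

end TetrahedronEars

section TetrahedronEars

variable {G : SimpleGraph V} {x y z u v w h d a b u1 u2 u3 u4 : V}
  {A B A' B' H R S T₁ T₂ P1 P2 Q1 Q2 L1 L2 : Set V}
  {m k ℓ L s t i i' j j' p q l : ℕ}

/-- There are no ears starting inside one of the longest subdivided edges. -/
theorem Tetra.no_ear (K : Tetra G ℓ u1 u2 u3 u4 p q l P1 P2 Q1 Q2 L1 L2)
    (hG : InGFamily ℓ G) (hℓ : 4 ≤ ℓ) (hqp : q ≤ p) (hlp : l ≤ p)
    (hx : x ∈ P1) (hh : h ∈ tetraSet u1 u2 u3 u4 P1 P2 Q1 Q2 L1 L2) (hxh : Far G {x} {h})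
    (hR : IP G x h L R)
    (hRH : Far G R (tetraSet u1 u2 u3 u4 P1 P2 Q1 Q2 L1 L2 \ {x, h})) : False := by
  have r2 := hRH
  rw [tetraSet_swap12] at r2
  have r3 := hRH
  rw [tetraSet_swap34] at r3
  have r4 := r3
  rw [tetraSet_swap12] at r4
  rcases hh with ((((((((hh | hh) | hh) | hh) | hh) | hh) | hh) | hh) | hh) | hh
  · exact K.no_ear_edge hG hx (Or.inl (Or.inl hh)) hxh hR hRH
  · exact K.no_ear_edge hG hx (Or.inl (Or.inr hh)) hxh hR hRH
  · exact K.no_ear_adjacent hG hℓ hqp hlp hx (Or.inr hh) hxh hR hRH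
  · exact K.swap34.no_ear_adjacent hG hℓ hlp hqp hx (Or.inr hh) hxh hR r3
  · exact K.no_ear_edge hG hx (Or.inr hh) hxh hR hRH
  · exact K.no_ear_opposite hG hqp hlp hx hh hxh hR hRH
  · exact K.swap34.swap12.no_ear_adjacent hG hℓ hlp hqp hx (Or.inl hh) hxh hR r4
  · exact K.swap34.no_ear_adjacent hG hℓ hlp hqp hx (Or.inl hh) hxh hR r3
  · exact K.no_ear_adjacent hG hℓ hqp hlp hx (Or.inl hh) hxh hR hRH
  · exact K.swap12.no_ear_adjacent hG hℓ hqp hlp hx (Or.inl hh) hxh hR r2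

theorem Tetra.no_ear_corner_opposite (K : Tetra G ℓ u1 u2 u3 u4 p q l P1 P2 Q1 Q2 L1 L2)
    (hG : InGFamily ℓ G) (hh : h ∈ Q1) (hxh : Far G {u1} {h}) (hR : IP G u1 h L R)
    (hRH : Far G R (tetraSet u1 u2 u3 u4 P1 P2 Q1 Q2 L1 L2 \ {u1, h})) : False := by
  have hth := K.swap34.theta
  have hsub : thetaSet u2 u4 L2 (P1 ∪ ({u1} ∪ Q2)) (Q1 ∪ ({u3} ∪ P2)) ⊆
      tetraSet u1 u2 u3 u4 P1 P2 Q1 Q2 L1 L2 := by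
    rw [tetraSet_swap34]
    exact Tetra.thetaSet_subset
  have hL := hR.two_le_of_far hxh
  obtain ⟨h1, h2, h3, h4, h5, h6, f1, f2, f3, f4, f5, f6, k1, k2, k3, k4, k5, k6, k7⟩ := K
  have e3 := h3.far_ends k3
  have e4 := h4.far_ends k3
  have e5 := h5.far_ends k4
  have e6 := h6.far_ends k4
  have e1 := h1.far_ends k2
  have e2 := h2.far_ends k2
  simp only [far_union_right] at f1 f2 f3 f4 f5 f6
  obtain ⟨j, j', B, B', hB, hB', hBB, rfl, hj⟩ := h3.split_mem hh
  have fA : Far G ({u2} ∪ P1) ({u4} ∪ Q2) := by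
    grind [far_union_left, far_union_right, Far.symm]
  have eA : P1 ∪ ({u1} ∪ Q2) = P1 ∪ ({u1} ∪ Q2) := rfl
  have gB := hB'.glue h2 (by grind [far_union_left, far_union_right, Far.symm])
  have fB : Far G ({u2} ∪ B) ({u4} ∪ (B' ∪ ({u3} ∪ P2))) := by
    grind [far_union_left, far_union_right, Far.symm]
  have eB : B ∪ ({h} ∪ B') ∪ ({u3} ∪ P2) = B ∪ ({h} ∪ (B' ∪ ({u3} ∪ P2))) := by
    simp only [Set.union_assoc]
  have hj1 := hB.pos
  have hj2 := hB'.pos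
  obtain ⟨X1, X2, X3, X4⟩ := hth.ear_holes hG h1.symm h4 hB gB fA fB eA eB hR hRH hsub
  clear * - X1 X2 X3 X4 hj1 hj2 hj hL k1 k2 k3 k4 k5 k6 k7
  omega

/-- There are no ears starting at a branch vertex. -/
theorem Tetra.no_ear_corner (K : Tetra G ℓ u1 u2 u3 u4 p q l P1 P2 Q1 Q2 L1 L2)
    (hG : InGFamily ℓ G) (hh : h ∈ tetraSet u1 u2 u3 u4 P1 P2 Q1 Q2 L1 L2)
    (hxh : Far G {u1} {h}) (hR : IP G u1 h L R)
    (hRH : Far G R (tetraSet u1 u2 u3 u4 P1 P2 Q1 Q2 L1 L2 \ {u1, h})) : False := by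
  have r2 := hRH
  rw [tetraSet_swap23] at r2
  have r3 := hRH
  rw [tetraSet_swap34] at r3
  have r4 := r3
  rw [tetraSet_swap23] at r4
  have r5 := r2
  rw [tetraSet_swap34] at r5
  rcases hh with ((((((((hh | rfl) | rfl) | rfl) | hh) | hh) | hh) | hh) | hh) | hh
  · exact absurd hh.symm (far_singleton.1 hxh).1
  · exact K.no_ear_ends hG hR hRH
  · exact K.swap23.no_ear_ends hG hR r2
  · exact K.swap34.swap23.no_ear_ends hG hR r4
  · rw [Set.pair_comm] at hRH
    exact K.no_ear_edge hG hh (by simp) hxh.symm hR.symm hRH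
  · exact K.swap23.swap34.no_ear_corner_opposite hG hh hxh hR r5
  · exact K.no_ear_corner_opposite hG hh hxh hR hRH
  · rw [Set.pair_comm] at r4
    exact K.swap34.swap23.no_ear_edge hG hh (by simp) hxh.symm hR.symm r4
  · rw [Set.pair_comm] at r2
    exact K.swap23.no_ear_edge hG hh (by simp) hxh.symm hR.symm r2
  · exact K.swap34.no_ear_corner_opposite hG hh hxh hR r3

end TetrahedronEars

section TetrahedronFalse

variable {G : SimpleGraph V} {x y z u v w h d a b u1 u2 u3 u4 : V}
  {A B A' B' H R S T₁ T₂ P1 P2 Q1 Q2 L1 L2 : Set V}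
  {m k ℓ L s t i i' j j' p q l : ℕ}

theorem Tetra.no_flip (K : Tetra G ℓ u1 u2 u3 u4 p q l P1 P2 Q1 Q2 L1 L2)
    (hG : InGFamily ℓ G) (hℓ : 4 ≤ ℓ) (ha : a ∈ {u1} ∪ P1) (hx : x ∈ {u1} ∪ P1)
    (hy : y ∈ tetraSet u1 u2 u3 u4 P1 P2 Q1 Q2 L1 L2) (hax : G.Adj a x) (hay : G.Adj a y)
    (hxy : x ≠ y) (hR : IP G x y L R)
    (hRH : Far G R (tetraSet u1 u2 u3 u4 P1 P2 Q1 Q2 L1 L2 \ {x, a, y}))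
    (hd : Disjoint R (tetraSet u1 u2 u3 u4 P1 P2 Q1 Q2 L1 L2)) : False := by
  have ha' : ∀ {C : Set V}, a ∈ P1 ∪ ({u1} ∪ C) := by
    intro C
    rcases ha with rfl | ha
    · simp
    · simp [ha]
  have hx' : ∀ {C D E : Set V} {u v : V}, x ∈ thetaSet u v D (P1 ∪ ({u1} ∪ C)) E := by
    intro C D E u v
    rcases hx with rfl | hx
    · simp [thetaSet]
    · simp [thetaSet, hx]
  have sub := Tetra.thetaSet_subset (u1 := u1) (u2 := u2) (u3 := u3) (u4 := u4) (P1 := P1)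
    (P2 := P2) (Q1 := Q1) (Q2 := Q2) (L1 := L1) (L2 := L2)
  by_cases hyQ : y ∈ Q2
  · have hy' : y ∈ thetaSet u2 u4 L2 (P1 ∪ ({u1} ∪ Q2)) (Q1 ∪ ({u3} ∪ P2)) := by
      simp [thetaSet, hyQ]
    have sub' := Tetra.thetaSet_subset (u1 := u1) (u2 := u2) (u3 := u4) (u4 := u3) (P1 := P1)
      (P2 := P2) (Q1 := L2) (Q2 := L1) (L1 := Q2) (L2 := Q1)
    rw [← tetraSet_swap34] at sub'
    exact K.swap34.theta.no_flip hG hℓ ha' hx' hy' hax hay hxy hR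
      (hRH.mono subset_rfl (Set.sdiff_subset_sdiff_left sub')) (hd.mono_right sub')
  · have hy' : y ∈ thetaSet u2 u3 Q1 (P1 ∪ ({u1} ∪ L1)) (L2 ∪ ({u4} ∪ P2)) := by
      simp only [thetaSet, tetraSet, Set.mem_union] at hy ⊢
      clear * - hy hyQ
      tauto
    exact K.theta.no_flip hG hℓ ha' hx' hy' hax hay hxy hR
      (hRH.mono subset_rfl (Set.sdiff_subset_sdiff_left sub)) (hd.mono_right sub)

theorem Tetra.false [Fintype V] [DecidableRel G.Adj]
    (K : Tetra G ℓ u1 u2 u3 u4 p q l P1 P2 Q1 Q2 L1 L2)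
    (hG : InGFamily ℓ G) (hℓ : 4 ≤ ℓ) (hmax : MaxTheta G ℓ p)
    (hN1 : ∀ v, G.degree v ≠ 2) (hN3 : ¬ HasK2Cut G) : False := by
  have hqp := hmax _ _ _ _ _ _ _ K.theta
  have hlp := hmax _ _ _ _ _ _ _ K.swap34.theta
  have hsum := K.sum
  obtain ⟨d, A, B, hA, hB, hAB, hP⟩ := K.hP1.split_at (i := 1) (j := p - 1) le_rfl
    (by omega) (by omega)
  obtain ⟨b, C, D, hC, hD, hCD, rfl⟩ := hB.split_at (i := 1) (j := p - 2) le_rfl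
    (by omega) (by omega)
  obtain ⟨had, rfl⟩ := hA.of_one
  obtain ⟨hdb, rfl⟩ := hC.of_one
  have hd : d ∈ P1 := by simp [hP]
  have hb : b ∈ P1 := by simp [hP]
  have hPH : ∀ r ∈ {u1} ∪ P1, r ∈ tetraSet u1 u2 u3 u4 P1 P2 Q1 Q2 L1 L2 := by
    intro r hr
    simp only [tetraSet, Set.mem_union] at hr ⊢
    clear * - hr
    tauto
  have hab : u1 ≠ b := fun e => K.hP1.left_notMem (e ▸ hb)
  have hH : ∀ t ∈ tetraSet u1 u2 u3 u4 P1 P2 Q1 Q2 L1 L2, G.Adj d t → t = u1 ∨ t = b := by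
    intro t ht hdt
    have f := K.fP1
    have key : ∀ {C : Set V}, Far G P1 C → t ∉ C := fun hC htC => (hC d hd t htC).2 hdt
    simp only [far_union_right] at f
    obtain ⟨⟨f3, f4⟩, ⟨⟨⟨f5, f6⟩, f7⟩, f8⟩, f9⟩ := f
    have key2 : t ∉ {u2} ∪ D := fun htC => (hCD d (by simp) t htC).2 hdt
    have g3 := key f3
    have g4 := key f4
    have g5 := key f5
    have g6 := key f6
    have g7 := key f7
    have g8 := key f8
    have g9 := key f9
    have g10 := hdt.ne'
    rw [hP] at ht
    clear * - ht g3 g4 g5 g6 g7 g8 g9 key2 g10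
    simp only [tetraSet, Set.mem_union, Set.mem_singleton_iff, Set.mem_empty_iff_false] at *
    tauto
  have hfar : ∀ {x t}, x ≠ t → ¬ G.Adj x t → Far G {x} {t} := fun h1 h2 => far_singleton.2 ⟨h1, h2⟩
  rcases local_ears hG hN1 hN3 (hPH d (Or.inr hd)) (hPH u1 (Or.inl rfl)) (hPH b (Or.inr hb))
    had.symm hdb hab hH (fun w hw s hs t ht => K.uniq hG hℓ hw hs ht) with
    ⟨h, hh, h1, h2, h3, L, R, hR, hRH⟩ | ⟨L, R, hR, hRd, hRH⟩ |
    ⟨h, hh, h1, h2, h3, L, R, hR, hRd, hRH, hE⟩ | ⟨h, hh, h1, h2, h3, L, R, hR, hRd, hRH, hE⟩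
  · exact K.no_ear hG hℓ hqp hlp hd hh
      (hfar h2.symm fun e => by rcases hH h hh e with e | e <;> tauto) hR hRH
  · exact K.no_flip hG hℓ (Or.inr hd) (Or.inl rfl) (hPH b (Or.inr hb)) had.symm hdb hab hR hRH hRd
  · by_cases e : G.Adj u1 h
    · refine K.no_flip hG hℓ (Or.inl rfl) (Or.inr hd) hh had e h2.symm hR ?_ hRd
      rwa [show ({d, u1, h} : Set V) = {d, h, u1} by rw [Set.pair_comm]]
    · obtain e' | ⟨L', R', hR', hRH', -⟩ := hE
      · exact e e'
      · exact K.no_ear_corner hG hh (hfar h1.symm e) hR' hRH'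
  · by_cases e : G.Adj b h
    · refine K.no_flip hG hℓ (Or.inr hb) (Or.inr hd) hh hdb.symm e h2.symm hR ?_ hRd
      rwa [show ({d, b, h} : Set V) = {d, h, b} by rw [Set.pair_comm]]
    · obtain e' | ⟨L', R', hR', hRH', -⟩ := hE
      · exact e e'
      · exact K.no_ear hG hℓ hqp hlp hb hh (hfar h1.symm e) hR' hRH'

end TetrahedronFalse

section ThetaEars

variable {G : SimpleGraph V} {x y z u v w h d a b : V}
  {A B A' B' H R S T₁ T₂ : Set V}
  {m k ℓ L s t i i' j j' : ℕ}

theorem split_set_comm (A B : Set V) (x : V) : A ∪ ({x} ∪ B) = B ∪ ({x} ∪ A) := by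
  ext
  simp only [Set.mem_union]
  tauto

theorem Theta.no_ear_side (hth : Theta G ℓ u v s t S T₁ T₂) (hG : InGFamily ℓ G)
    (hmax : MaxTheta G ℓ s) (hx : x ∈ T₁) (hh : h ∈ {u} ∪ ({v} ∪ T₁)) (hxh : Far G {x} {h})
    (hR : IP G x h L R) (hRH : Far G R (thetaSet u v S T₁ T₂ \ {x, h})) : False := by
  have := hth.sum
  have := hth.le
  obtain ⟨s', t', S', T', h1, h2, h3⟩ := hth.h1.segment_ear hG hx hh hxh hth.hS hth.f01
    (by omega) hth.h2 hth.f12.symm rfl (by omega) hR hRH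
    (by intro r; simp only [thetaSet, Set.mem_union]; tauto)
    (by intro r; simp only [thetaSet, Set.mem_union]; tauto)
    (by intro r; simp only [thetaSet, Set.mem_union]; tauto)
  have := hmax _ _ _ _ _ _ _ h3
  have := h3.sum
  omega

theorem Theta.no_ear_shore (hth : Theta G ℓ u v s t S T₁ T₂) (hG : InGFamily ℓ G)
    (hmax : MaxTheta G ℓ s) (hA : IP G u x i A) (hA' : IP G x v i' A')
    (hAA : Far G ({u} ∪ A) ({v} ∪ A')) (hT : T₁ = A ∪ ({x} ∪ A'))
    (hB : IP G u h j B) (hB' : IP G h v j' B')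
    (hBB : Far G ({u} ∪ B) ({v} ∪ B')) (hS : S = B ∪ ({h} ∪ B'))
    (hi : 2 ≤ i) (hi' : 2 ≤ i') (hit : i + i' = t) (hjs : j + j' = s) (hij : i + j ≤ ℓ)
    (hxh : Far G {x} {h}) (hR : IP G x h L R)
    (hRH : Far G R (thetaSet u v S T₁ T₂ \ {x, h})) : False := by
  have hL := hR.two_le_of_far hxh
  have hS2 := hth.hS.far_ends hth.two_le
  have ht2 : 2 ≤ t := by omega
  have hsum := hth.sum
  have f01 := hth.f01
  have f02 := hth.f02
  have f12 := hth.f12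
  have h2 := hth.h2
  have hA2 := hA.far_ends hi
  have hA'2 := hA'.far_ends hi'
  subst hT hS
  have hf := hA.symm.glue hB (by grind [far_union_left, far_union_right, Far.symm])
  have hg := hA'.glue hB'.symm (by grind [far_union_left, far_union_right, Far.symm])
  have hfg : Far G (A ∪ ({u} ∪ B)) (A' ∪ ({v} ∪ B')) := by
    grind [far_union_left, far_union_right, Far.symm]
  have r1 := hRH.diff_pair (C := A ∪ ({u} ∪ B))
    (by intro r; simp only [thetaSet, Set.mem_union]; tauto) hf.left_notMem hf.right_notMem
  have r2 := hRH.diff_pair (C := A' ∪ ({v} ∪ B'))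
    (by intro r; simp only [thetaSet, Set.mem_union]; tauto) hg.left_notMem hg.right_notMem
  have hj := hB.pos
  have hθ := hf.theta hG hg (by omega) (by omega) (by omega) hfg hR r1 r2
  have hle := hmax _ _ _ _ _ _ _ hθ
  have hLL := hf.ear_length hG hg (by omega) (by omega) (by omega) hR r1 r2
  have hB'2 := hB'.far_ends (by omega)
  have hW := hB.symm.glue (h2.glue hA'.symm (by grind [far_union_left, far_union_right, Far.symm]))
    (by grind [far_union_left, far_union_right, Far.symm])
  have r3 := hRH.diff_pair (C := B ∪ ({u} ∪ (T₂ ∪ ({v} ∪ A'))))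
    (by intro r; simp only [thetaSet, Set.mem_union]; tauto) hW.right_notMem hW.left_notMem
  have := hR.symm.hole hG hW r3 hL (by omega)
  omega

theorem Theta.no_ear_neighbor (hth : Theta G ℓ u v s t S T₁ T₂) (hG : InGFamily ℓ G)
    (hmax : MaxTheta G ℓ s) (hA : IP G u x i A) (hA' : IP G x v i' A')
    (hAA : Far G ({u} ∪ A) ({v} ∪ A')) (hT : T₁ = A ∪ ({x} ∪ A'))
    (huh : G.Adj u h) (hi : 2 ≤ i) (hi' : 2 ≤ i') (hit : i + i' = t)
    (hh : h ∈ T₂) (hhv : Far G {h} {v}) (hLi : L + 1 = i) (hxh : Far G {x} {h}) (hR : IP G x h L R)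
    (hRH : Far G R (thetaSet u v S T₁ T₂ \ {x, h})) : False := by
  have hL := hR.two_le_of_far hxh
  have hle := hth.le
  have h2s := hth.two_le
  have hS2 := hth.hS.far_ends h2s
  have hsum := hth.sum
  have f01 := hth.f01
  have f02 := hth.f02
  have f12 := hth.f12
  have hS := hth.hS
  have hA2 := hA.far_ends hi
  have hA'2 := hA'.far_ends hi'
  subst hT
  have hhA : Far G {h} (A ∪ ({x} ∪ A')) := f12.symm.mono (by simpa) subset_rfl
  have hhS : Far G {h} S := f02.symm.mono (by simpa) subset_rfl
  have r1 := hRH.diff_pair (C := A ∪ {u} ∪ (A' ∪ ({v} ∪ S)))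
    (by intro r; simp only [thetaSet, Set.mem_union]; tauto)
    (by
      have n1 := hA.right_notMem
      have n2 := hA'.left_notMem
      have n3 := (far_union_right.1 (far_union_right.1 f01).2).1.symm.notMem
      have n4 := hA.ne
      have n5 := hA'.ne
      clear * - n1 n2 n3 n4 n5
      simp only [Set.mem_union, Set.mem_singleton_iff]
      tauto)
    (by
      have n1 := hhA.notMem
      have n3 := hhS.notMem
      have n4 := huh.ne'
      have n5 := hhv.notMem
      clear * - n1 n3 n4 n5
      simp only [Set.mem_union, Set.mem_singleton_iff] at *
      tauto)
  have hg := hA'.glue hS.symm (by grind [far_union_left, far_union_right, Far.symm])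
  have hA3 := hA2.symm
  have hR' := hR.glue (IP.edge huh.symm) (by
    grind [far_union_left, far_union_right, far_empty_right])
  have hR'A : Far G (R ∪ ({h} ∪ ∅)) A := by
    grind [far_union_left, far_union_right, far_empty_left]
  have hR'g : Far G (R ∪ ({h} ∪ ∅)) (A' ∪ ({v} ∪ S)) := by
    grind [far_union_left, far_union_right, far_empty_left]
  have hgA : Far G (A' ∪ ({v} ∪ S)) A := by
    grind [far_union_left, far_union_right, Far.symm]
  have hi2 := hR'.hole hG hA.symm hR'A (by omega) hi
  have hθ := hg.theta hG hA.symm (by omega) (by omega) (by omega) hgA hR' hR'g hR'A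
  have := hmax _ _ _ _ _ _ _ hθ
  omega

theorem Theta.no_ear_opposite (hth : Theta G ℓ u v s t S T₁ T₂) (hG : InGFamily ℓ G)
    (hmax : MaxTheta G ℓ s)
    (hno : ∀ u1 u2 u3 u4 q l P1 P2 Q1 Q2 L1 L2,
      ¬ Tetra G ℓ u1 u2 u3 u4 s q l P1 P2 Q1 Q2 L1 L2)
    (hx : x ∈ T₁) (hh : h ∈ T₂) (hxu : Far G {x} {u}) (hxv : Far G {x} {v}) (hxh : Far G {x} {h})
    (hR : IP G x h L R) (hRH : Far G R (thetaSet u v S T₁ T₂ \ {x, h})) : False := by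
  have hL := hR.two_le_of_far hxh
  have hle := hth.le
  have h2s := hth.two_le
  have hS2 := hth.hS.far_ends h2s
  have hsum := hth.sum
  have f01 := hth.f01
  have f02 := hth.f02
  have f12 := hth.f12
  have hS := hth.hS
  obtain ⟨i, i', A, A', hA, hA', hAA, rfl, hi⟩ := hth.h1.split_mem hx
  obtain ⟨j, j', B, B', hB, hB', hBB, rfl, hj⟩ := hth.h2.split_mem hh
  have i1 := hA.symm.two_le_of_far hxu
  have i2 := hA'.two_le_of_far hxv
  have j1 := hB.pos
  have j2 := hB'.pos
  obtain ⟨X1, X2, X3, X4⟩ := hth.ear_holes hG hA hA' hB hB' hAA hBB rfl rfl hR hRH subset_rfl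
  have no1 : j ≠ 1 := by
    rintro rfl
    have e1 : L + 1 = i := by omega
    exact hth.no_ear_neighbor hG hmax hA hA' hAA rfl hB.of_one.1 i1 i2 hi
      (by simp) (hB'.far_ends (by omega)) e1 hxh hR hRH
  have no2 : j' ≠ 1 := by
    rintro rfl
    have e1 : L + 1 = i' := by omega
    rw [thetaSet_rev] at hRH
    exact hth.rev.no_ear_neighbor hG hmax hA'.symm hA.symm hAA.symm (split_set_comm _ _ _)
      hB'.of_one.1.symm i2 i1 (by omega) (by simp) (hB.symm.far_ends (by omega)) e1 hxh hR hRH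
  have j3 : 2 ≤ j := by omega
  have j4 : 2 ≤ j' := by omega
  have Y3 := X3 i2 j3
  have Y4 := X4 i1 j4
  have key : j = i' ∧ L = s := by
    clear * - X1 X2 Y3 Y4 hi hj hL hsum
    omega
  obtain ⟨e1, e3⟩ := key
  have e2 : j' = i := by omega
  subst e1 e2 e3
  have hA2 := hA.far_ends i1
  have hA'2 := hA'.far_ends i2
  have hB2 := hB.far_ends i2
  have hB'2 := hB'.far_ends i1
  have r1 : Far G R ({u} ∪ {v} ∪ (S ∪ (A ∪ A') ∪ (B ∪ B'))) := by
    exact hth.ear_far hA hA' hB hB' hRH subset_rfl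
  refine hno u v x h j j' S R A' B A B' ⟨hS, hR, hA'.symm, hB, hA, hB'.symm, ?_, ?_, ?_, ?_, ?_, ?_,
    by omega, h2s, i2, i1, hle, by omega, by omega⟩ <;>
  grind [far_union_left, far_union_right, Far.symm]

theorem Theta.no_ear (hth : Theta G ℓ u v s t S T₁ T₂) (hG : InGFamily ℓ G)
    (hmax : MaxTheta G ℓ s)
    (hno : ∀ u1 u2 u3 u4 q l P1 P2 Q1 Q2 L1 L2,
      ¬ Tetra G ℓ u1 u2 u3 u4 s q l P1 P2 Q1 Q2 L1 L2)
    (hx : x ∈ T₁) (hxu : Far G {x} {u}) (hxv : Far G {x} {v})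
    (hh : h ∈ thetaSet u v S T₁ T₂) (hxh : Far G {x} {h})
    (hR : IP G x h L R) (hRH : Far G R (thetaSet u v S T₁ T₂ \ {x, h})) : False := by
  rcases hh with hh | hh | hh | hh | hh
  · exact hth.no_ear_side hG hmax hx (Or.inl hh) hxh hR hRH
  · exact hth.no_ear_side hG hmax hx (Or.inr (Or.inl hh)) hxh hR hRH
  · obtain ⟨i, i', A, A', hA, hA', hAA, hT, hi⟩ := hth.h1.split_mem hx
    obtain ⟨j, j', B, B', hB, hB', hBB, hS, hj⟩ := hth.hS.split_mem hh
    have i1 := hA.symm.two_le_of_far hxu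
    have i2 := hA'.two_le_of_far hxv
    have := hth.sum
    by_cases hij : i + j ≤ ℓ
    · exact hth.no_ear_shore hG hmax hA hA' hAA hT hB hB' hBB hS i1 i2 hi hj hij hxh hR hRH
    · refine hth.rev.no_ear_shore hG hmax hA'.symm hA.symm hAA.symm
        (by rw [hT, split_set_comm]) hB'.symm hB.symm hBB.symm (by rw [hS, split_set_comm])
        i2 i1 (by omega) (by omega) (by omega) hxh hR ?_
      rwa [← thetaSet_rev]
  · exact hth.no_ear_side hG hmax hx (Or.inr (Or.inr hh)) hxh hR hRH
  · exact hth.no_ear_opposite hG hmax hno hx hh hxu hxv hxh hR hRH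

end ThetaEars

section Existence

variable {G : SimpleGraph V} {x y z u v w h d a b c r : V}
  {A B H K R I J S T W P N Q Q' f g : Set V}
  {m k ℓ L L' s t i j : ℕ}

/-- The flip produced by a hole in the absence of thetas. -/
theorem hole_flip [Fintype V] [DecidableRel G.Adj] (hG : InGFamily ℓ G) (hℓ : 4 ≤ ℓ)
    (hN1 : ∀ v, G.degree v ≠ 2) (hN3 : ¬ HasK2Cut G)
    (hno : ∀ u v s t S T₁ T₂, ¬ Theta G ℓ u v s t S T₁ T₂)
    (hS : IP G u v s S) (hT : IP G u v t T) (hf : Far G S T) (hs : 2 ≤ s) (ht : 2 ≤ t)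
    (hst : s + t = 2 * ℓ + 1) (hH : H = {u} ∪ ({v} ∪ (S ∪ T)))
    (hd : d ∈ H) (ha : a ∈ H) (hb : b ∈ H) (hda : G.Adj d a) (hdb : G.Adj d b) (hab : a ≠ b) :
    ∃ c ∈ H, ∃ x ∈ H, ∃ y ∈ H, (c = d ∨ c = a ∨ c = b) ∧ G.Adj c x ∧ G.Adj c y ∧ x ≠ y ∧
      ∃ L Q, IP G x y L Q ∧ Disjoint Q H ∧ Far G Q (H \ {x, c, y}) := by
  subst hH
  have uniq : ∀ w ∉ ({u} ∪ ({v} ∪ (S ∪ T)) : Set V), ∀ s ∈ ({u} ∪ ({v} ∪ (S ∪ T)) : Set V),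
      ∀ t ∈ ({u} ∪ ({v} ∪ (S ∪ T)) : Set V), G.Adj w s → G.Adj w t → s = t :=
    fun w hw p hp q hq => hole_uniq hG hℓ hS hT hf hs ht (by omega) hw hp hq
  have hnbr : ∀ t ∈ ({u} ∪ ({v} ∪ (S ∪ T)) : Set V), G.Adj d t → t = a ∨ t = b := by
    obtain ⟨g, h1, h2, h3, h4⟩ := hole_around hG hℓ hS hT hf hs ht hd ha hb hda hdb hab
    rw [h4]
    rintro t (rfl | rfl | rfl | ht) e
    · exact Or.inl rfl
    · exact Or.inr rfl
    · exact absurd rfl e.ne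
    · exact absurd e (h3 d rfl t ht).2
  have noear : ∀ {p q L R}, p ∈ ({u} ∪ ({v} ∪ (S ∪ T)) : Set V) →
      q ∈ ({u} ∪ ({v} ∪ (S ∪ T)) : Set V) → p ≠ q → ¬ G.Adj p q → IP G p q L R →
      Far G R (({u} ∪ ({v} ∪ (S ∪ T))) \ {p, q}) → False := by
    intro p q L R hp hq hne hadj hR hRH
    obtain ⟨_, _, _, _, h⟩ := hole_ear hG hS hT hf hs ht hst hp hq
      (far_singleton.2 ⟨hne, hadj⟩) hR hRH
    exact hno _ _ _ _ _ _ _ h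
  have side : ∀ {a b}, a ∈ ({u} ∪ ({v} ∪ (S ∪ T)) : Set V) → G.Adj d a →
      SideEar G ℓ ({u} ∪ ({v} ∪ (S ∪ T))) d a b → ∃ x ∈ ({u} ∪ ({v} ∪ (S ∪ T)) : Set V),
      ∃ y ∈ ({u} ∪ ({v} ∪ (S ∪ T)) : Set V), G.Adj a x ∧ G.Adj a y ∧ x ≠ y ∧
      ∃ L Q, IP G x y L Q ∧ Disjoint Q ({u} ∪ ({v} ∪ (S ∪ T))) ∧
        Far G Q (({u} ∪ ({v} ∪ (S ∪ T))) \ {x, a, y}) := by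
    rintro a b ha hda ⟨h, hh, hha, hhd, hhb, L, R, hR, hRd, hRf, h1⟩
    have hah : G.Adj a h := by
      by_contra hah
      obtain h1 | ⟨L', R', hR', hRf', -⟩ := h1
      · exact hah h1
      · exact noear ha hh hha.symm hah hR' hRf'
    refine ⟨d, hd, h, hh, hda.symm, hah, hhd.symm, L, R, hR, hRd, ?_⟩
    convert hRf using 3
    ext; simp; tauto
  rcases local_ears hG hN1 hN3 hd ha hb hda hdb hab hnbr uniq with h1 | h1 | h1 | h1
  · obtain ⟨h, hh, hha, hhd, hhb, L, R, hR, hRf⟩ := h1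
    refine (noear hd hh hhd.symm (fun e => ?_) hR hRf).elim
    rcases hnbr h hh e with e | e
    exacts [hha e, hhb e]
  · obtain ⟨L, R, hR, hRd, hRf⟩ := h1
    exact ⟨d, hd, a, ha, b, hb, Or.inl rfl, hda, hdb, hab, L, R, hR, hRd, hRf⟩
  · obtain ⟨x, hx, y, hy, h1⟩ := side ha hda h1
    exact ⟨a, ha, x, hx, y, hy, by simp, h1⟩
  · obtain ⟨x, hx, y, hy, h1⟩ := side hb hdb h1
    exact ⟨b, hb, x, hx, y, hy, by simp, h1⟩

/-- A connected set `W` disjoint from `H` and attached to both `P` and `N` contains an ear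
between a vertex of `P` and a vertex of `N`. -/
theorem clean_ear (hW : Disjoint W H) (hP : P ⊆ H) (hN : N ⊆ H) (hPN : Disjoint P N)
    (uniq : ∀ w ∉ H, ∀ s ∈ H, ∀ t ∈ H, G.Adj w s → G.Adj w t → s = t)
    (hWH : Far G W (H \ (P ∪ N))) (hu : u ∈ W) (hup : ∃ p ∈ P, G.Adj u p)
    (hvh : ∃ h ∈ N, G.Adj v h) (huv : Relation.ReflTransGen (fun p q => G.Adj p q ∧ q ∈ W) u v) :
    ∃ p ∈ P, ∃ h ∈ N, (∃ w ∈ W, G.Adj w p) ∧ (¬ G.Adj p h →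
      ∃ m I, IP G p h m I ∧ Far G I (H \ {p, h})) := by
  have hWn : ∀ {w}, w ∈ W → w ∉ H := fun h => Set.disjoint_left.1 hW h
  have hPNn : ∀ {p}, p ∈ P → p ∉ N := fun h => Set.disjoint_left.1 hPN h
  have notboth : ∀ {w p h}, w ∈ W → p ∈ P → h ∈ N → G.Adj w p → ¬ G.Adj w h :=
    fun hw hp hh h1 h2 => hPNn hp (uniq _ (hWn hw) _ (hP hp) _ (hN hh) h1 h2 ▸ hh)
  have far_of : ∀ {w p}, w ∈ W → p ∈ H → G.Adj w p → ∀ s ∈ H, s ≠ p → w ≠ s ∧ ¬ G.Adj w s :=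
    fun hw hp h1 s hs hsp => ⟨fun e => hWn hw (e ▸ hs), fun e => hsp
      (uniq _ (hWn hw) _ hs _ hp e h1)⟩
  have key : ∀ m u v I, IP G u v m I → I ⊆ W → u ∈ W → v ∈ W → (∃ p ∈ P, G.Adj u p) →
      (∃ h ∈ N, G.Adj v h) → ∃ p ∈ P, ∃ h ∈ N, (∃ w ∈ W, G.Adj w p) ∧ (¬ G.Adj p h →
      ∃ m I, IP G p h m I ∧ Far G I (H \ {p, h})) := by
    intro m
    induction m using Nat.strong_induction_on with
    | _ m ih =>
    intro u v I hI hIW hu hv hup hvh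
    by_cases c1 : ∃ z ∈ I, ∃ p ∈ P, G.Adj z p
    · obtain ⟨z, hz, hzp⟩ := c1
      obtain ⟨i, j, A, B, hA, hB, -, rfl, rfl⟩ := hI.split_mem hz
      have := hA.pos
      exact ih j (by omega) z v B hB (fun t ht => hIW (by simp [ht])) (hIW hz) hv hzp hvh
    by_cases c2 : ∃ z ∈ I, ∃ h ∈ N, G.Adj z h
    · obtain ⟨z, hz, hzp⟩ := c2
      obtain ⟨i, j, A, B, hA, hB, -, rfl, rfl⟩ := hI.split_mem hz
      have := hB.pos
      exact ih i (by omega) u z A hA (fun t ht => hIW (by simp [ht])) hu (hIW hz) hup hzp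
    push Not at c1 c2
    obtain ⟨p, hp, hup⟩ := hup
    obtain ⟨h, hh, hvh⟩ := hvh
    refine ⟨p, hp, h, hh, ⟨u, hu, hup⟩, fun hph => ?_⟩
    have hpH := hP hp
    have hhH := hN hh
    have hne : p ≠ h := fun e => hPNn hp (e ▸ hh)
    have fI : Far G I H := by
      intro t ht s hs
      refine ⟨fun e => hWn (hIW ht) (e ▸ hs), fun e => ?_⟩
      by_cases h1 : s ∈ P
      · exact c1 t ht s h1 e
      by_cases h2 : s ∈ N
      · exact c2 t ht s h2 e
      exact (hWH t (hIW ht) s ⟨hs, by rintro (h | h); exacts [h1 h, h2 h]⟩).2 e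
    have fv := far_of hv hhH hvh
    have fu := far_of hu hpH hup
    have h1 : IP G p v (1 + m) (∅ ∪ ({u} ∪ I)) := (IP.edge hup.symm).glue hI (by
      rintro s (rfl | hs) t (rfl | ht)
      · exact ⟨(fv _ hpH hne).1.symm, fun e => (fv _ hpH hne).2 e.symm⟩
      · exact ⟨(fI t ht _ hpH).1.symm, fun e => (fI t ht _ hpH).2 e.symm⟩
      · exact hs.elim
      · exact hs.elim)
    have h2 := h1.glue (IP.edge hvh) (by
      rintro s (rfl | hs | rfl | hs) t (rfl | ht)
      · exact ⟨hne, hph⟩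
      · exact ht.elim
      · exact hs.elim
      · exact ht.elim
      · exact fu _ hhH hne.symm
      · exact ht.elim
      · exact fI s hs _ hhH
      · exact ht.elim)
    refine ⟨_, _, h2, ?_⟩
    rintro t ((ht | rfl | ht) | rfl | ht) s ⟨hs, hs'⟩ <;>
      simp only [Set.mem_insert_iff, Set.mem_singleton_iff, not_or] at hs'
    · exact ht.elim
    · exact fu s hs hs'.1
    · exact fI t ht s hs
    · exact fv s hs hs'.2
    · exact ht.elim
  have hv : v ∈ W := by
    induction huv with
    | refl => exact hu
    | tail _ h => exact h.2
  obtain ⟨p, hp, hup'⟩ := id hup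
  obtain ⟨h, hh, hvh'⟩ := id hvh
  have huv' : u ≠ v := by
    rintro rfl
    exact notboth hu hp hh hup' hvh'
  obtain ⟨m, I, hI, hIW⟩ := exists_ipath huv huv'
  exact key m u v I hI hIW hu hv hup hvh

end Existence

section Flips

variable {G : SimpleGraph V} {x y z u v w h d a b c r : V}
  {A B H K R I J S T W P N Q Q' f g : Set V}
  {m k ℓ L L' s t i j : ℕ}

/-- A path two of whose neighbouring flips of the same hole meet at a first vertex `r` adjacent
to the end `a`, where `a` is adjacent to the middle vertex of the other flip's end. -/
theorem flips_touch_first (hG : InGFamily ℓ G) (hℓ : 4 ≤ ℓ) (hxz : G.Adj x z) (hzy : G.Adj z y)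
    (hya : G.Adj y a) (hac : G.Adj a c) (hcb : G.Adj c b) (hB : IP G b x j B) (hj : j + 4 = 2 * ℓ)
    (f1 : Far G {y} ({c} ∪ ({b} ∪ ({x} ∪ B)))) (f2 : Far G {a} ({b} ∪ ({x} ∪ B)))
    (f3 : Far G {c} ({x} ∪ B)) (f4 : Far G {z} ({a} ∪ ({c} ∪ ({b} ∪ B))))
    (hQ : IP G x y L Q) (hQg : Far G Q ({a} ∪ ({c} ∪ ({b} ∪ B)))) (hzQ : z ∉ Q)
    (har : G.Adj a r) (hR : IP G r b m R) (haR : Far G {a} ({b} ∪ R))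
    (hRH : Far G ({r} ∪ R) ({y} ∪ ({z} ∪ ({x} ∪ B)))) (hrc : r ≠ c) (hrQ : r ∉ Q)
    (hRQ : Far G R Q) (hrQ' : ∃ q ∈ Q, G.Adj q r) : False := by
  have nrc : ¬ G.Adj r c := fun e => by
    have := (IP.edge hac).cyc_vertex hG har e (by simp)
    omega
  have fab : IP G a b 2 (∅ ∪ ({c} ∪ ∅)) := (IP.edge hac).glue (IP.edge hcb) (by
    grind [far_union_left, far_union_right, Far.symm, far_empty_left, far_empty_right])
  have nrb : ¬ G.Adj r b := fun e => by
    have := fab.cyc_vertex hG har e (by simp [hrc])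
    omega
  have hm : 2 ≤ m := hR.two_le_of_far (far_singleton.2 ⟨hR.ne, nrb⟩)
  obtain ⟨q, β, β', Q₁, Q₂, hQ1, hQ2, fQ, rfl, hβ, hqr, hQr⟩ := hQ.first_sat _ hrQ'
  simp only [far_union_left, far_union_right] at f1 f2 f3 f4 fQ hQg haR hRH hRQ
  have frb := hR.far_ends hm
  have frc : Far G {r} {c} := far_singleton.2 ⟨hrc, nrc⟩
  have frQ1 : Far G Q₁ {r} := by
    rintro t ht s rfl
    exact ⟨fun e => hrQ (by simp [← e, ht]), hQr t ht⟩
  have fbx := hB.far_ends (by omega)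
  have hxr : IP G x r (β + 1) (Q₁ ∪ ({q} ∪ ∅)) := hQ1.glue (IP.edge hqr) (by
    grind [far_union_left, far_union_right, Far.symm, far_empty_left, far_empty_right])
  have hxa := hxr.glue (IP.edge har.symm) (by
    grind [far_union_left, far_union_right, Far.symm, far_empty_left, far_empty_right])
  have hba : IP G b a 2 (∅ ∪ ({c} ∪ ∅)) := fab.symm
  have hxa' := hB.symm.glue hba (by
    grind [far_union_left, far_union_right, Far.symm, far_empty_left, far_empty_right])
  have hxb := hxr.glue hR (by
    grind [far_union_left, far_union_right, Far.symm, far_empty_left, far_empty_right])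
  have hab := (IP.edge har).glue hR (by
    grind [far_union_left, far_union_right, Far.symm, far_empty_left, far_empty_right])
  have hab' := (((IP.edge hya.symm).glue (IP.edge hzy.symm) (by
    grind [far_union_left, far_union_right, Far.symm, far_empty_left, far_empty_right])).glue
    (IP.edge hxz.symm) (by
    grind [far_union_left, far_union_right, Far.symm, far_empty_left, far_empty_right])).glue
    hB.symm (by
    grind [far_union_left, far_union_right, Far.symm, far_empty_left, far_empty_right])
  have h1 := (hab.hole hG hab' (by
    grind [far_union_left, far_union_right, Far.symm, far_empty_left, far_empty_right])
    (by omega) (by omega)).2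
  have h2 := (hxb.hole hG hB.symm (by
    grind [far_union_left, far_union_right, Far.symm, far_empty_left, far_empty_right])
    (by omega) (by omega)).2
  have h3 := (hxa.hole hG hxa' (by
    grind [far_union_left, far_union_right, Far.symm, far_empty_left, far_empty_right])
    (by omega) (by omega)).2
  have nqy : ¬ G.Adj q y := fun e => by
    have hry := (IP.edge har.symm).glue (IP.edge hya.symm) (by
      grind [far_union_left, far_union_right, Far.symm, far_empty_left, far_empty_right])
    have := hry.cyc_vertex hG hqr.symm e (by
      have := hqr.ne
      grind [Far.notMem])
    omega
  have fqy : Far G {q} {y} := far_singleton.2 ⟨hQ2.ne, nqy⟩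
  have hxy := hxa.glue (IP.edge hya.symm) (by
    grind [far_union_left, far_union_right, Far.symm, far_empty_left, far_empty_right])
  have h4 := hxy.cyc_vertex hG hxz hzy (by
    simp only [Set.mem_union, not_or] at hzQ ⊢
    grind [Far.notMem, Far.symm, far_singleton])
  have := hQ1.pos
  omega

/-- Two flips of a hole whose paths are far from each other cannot coexist. -/
theorem flips_far (hG : InGFamily ℓ G) (hℓ : 4 ≤ ℓ) (hxz : G.Adj x z) (hzy : G.Adj z y)
    (hzg : Far G {z} (A ∪ ({a} ∪ ({c} ∪ ({b} ∪ B))))) (hA : IP G y a i A) (hac : G.Adj a c)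
    (hcb : G.Adj c b) (hB : IP G b x j B) (hyx : Far G {y} {x})
    (f1 : Far G ({y} ∪ A) ({c} ∪ ({b} ∪ ({x} ∪ B)))) (f2 : Far G {a} ({b} ∪ ({x} ∪ B)))
    (hij : i + j + 3 = 2 * ℓ) (hQ : IP G x y L Q) (hL : 2 ≤ L) (hLodd : L % 2 = 1)
    (fQg : Far G Q (A ∪ ({a} ∪ ({c} ∪ ({b} ∪ B))))) (hQ' : IP G a b L' Q') (hcQ' : c ∉ Q')
    (fQ'g : Far G Q' (A ∪ ({y} ∪ ({z} ∪ ({x} ∪ B))))) (hfar : Far G Q' Q) : False := by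
  simp only [far_union_left, far_union_right] at fQg fQ'g f1 f2 hzg
  have fab : IP G a b 2 (∅ ∪ ({c} ∪ ∅)) := (IP.edge hac).glue (IP.edge hcb) (by
    grind [far_union_left, far_union_right, Far.symm, far_empty_left, far_empty_right])
  have hrest := ((hA.symm.glue (IP.edge hzy.symm) (by
    grind [far_union_left, far_union_right, Far.symm, far_empty_left, far_empty_right])).glue (IP.edge hxz.symm) (by
    grind [far_union_left, far_union_right, Far.symm, far_empty_left, far_empty_right])).glue hB.symm (by
    grind [far_union_left, far_union_right, Far.symm, far_empty_left, far_empty_right])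
  have hrest' := (hA.symm.glue hQ.symm (by
    grind [far_union_left, far_union_right, Far.symm, far_empty_left, far_empty_right])).glue hB.symm (by
    grind [far_union_left, far_union_right, Far.symm, far_empty_left, far_empty_right])
  refine fab.flip_false hG hrest le_rfl (by omega) (by omega) hrest' (by omega) (by omega) hQ' ?_ ?_
    (by simpa using hcQ')
  · grind [far_union_left, far_union_right, Far.symm, far_empty_left, far_empty_right]
  · grind [far_union_left, far_union_right, Far.symm, far_empty_left, far_empty_right]

/-- Two flips of a hole whose hubs are not close to each other cannot coexist. -/
theorem flips_false (hG : InGFamily ℓ G) (hℓ : 4 ≤ ℓ)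
    (hno : ∀ u v s t S T₁ T₂, ¬ Theta G ℓ u v s t S T₁ T₂) (hxz : G.Adj x z) (hzy : G.Adj z y)
    (hg : IP G y x (2 * ℓ - 1) g) (hzg : Far G {z} g) (hA : IP G y a i A) (hac : G.Adj a c)
    (hcb : G.Adj c b) (hB : IP G b x j B) (hgs : g = A ∪ ({a} ∪ ({c} ∪ ({b} ∪ B))))
    (f1 : Far G ({y} ∪ A) ({c} ∪ ({b} ∪ ({x} ∪ B)))) (f2 : Far G {a} ({b} ∪ ({x} ∪ B)))
    (f3 : Far G {c} ({x} ∪ B)) (hij : i + j + 3 = 2 * ℓ) (hj : 2 ≤ j)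
    (hH : H = {x} ∪ ({y} ∪ ({z} ∪ g)))
    (hQ : IP G x y L Q) (hQH : Disjoint Q H) (hQg : Far G Q (H \ {x, z, y}))
    (hQ' : IP G a b L' Q') (hQ'H : Disjoint Q' H) (hQ'H' : Far G Q' (H \ {a, c, b})) : False := by
  subst hgs
  have hS : IP G x y 2 (∅ ∪ ({z} ∪ ∅)) := (IP.edge hxz).glue (IP.edge hzy) (by
    have := hg.far_ends (by omega)
    grind [far_union_left, far_union_right, Far.symm, far_empty_left, far_empty_right])
  have hS' : IP G x y 2 {z} := by simpa using hS
  have huniq : ∀ w ∉ H, ∀ s ∈ H, ∀ t ∈ H, G.Adj w s → G.Adj w t → s = t := by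
    rw [hH]
    exact fun w hw p hp q hq => hole_uniq hG hℓ hS' hg.symm hzg le_rfl (by omega) (by omega) hw hp hq
  have ny := hg.left_notMem
  have nx := hg.right_notMem
  have nz := hzg.notMem
  have fQg : Far G Q (A ∪ ({a} ∪ ({c} ∪ ({b} ∪ B)))) := by
    refine far_of_diff hQg (by
      rw [hH]; clear * -; intro t ht; simp only [Set.mem_union] at ht ⊢; tauto)
      (Set.disjoint_right.2 ?_)
    rintro t (rfl | rfl | rfl)
    exacts [nx, nz, ny]
  have hzQ : z ∉ Q := fun e => Set.disjoint_left.1 hQH e (by rw [hH]; simp)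
  have hxQ : x ∉ Q := hQ.left_notMem
  have hyQ : y ∉ Q := hQ.right_notMem
  have hL := hQ.cyc_vertex hG hxz hzy hzQ
  have hLodd := (hQ.hole hG hg.symm fQg (by omega) (by omega)).2
  have fxy := hg.far_ends (by omega)
  have fbx := hB.far_ends hj
  have fAa := hA.right_notMem
  have fAy := hA.left_notMem
  have fBb := hB.left_notMem
  have fBx := hB.right_notMem
  have hxz' := hxz.ne
  have hzy' := hzy.ne
  have hac' := hac.ne
  have hcb' := hcb.ne
  have hay' := hA.ne
  have fAB : A ∪ ({y} ∪ ({z} ∪ ({x} ∪ B))) ⊆ H := by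
    rw [hH]; clear * -; intro t ht; simp only [Set.mem_union] at ht ⊢; tauto
  have hzg' := hzg
  simp only [far_union_left, far_union_right] at f1 f2 f3 hzg
  have fQ'g : Far G Q' (A ∪ ({y} ∪ ({z} ∪ ({x} ∪ B)))) := by
    refine far_of_diff hQ'H' fAB (Set.disjoint_right.2 ?_)
    have hac1 : a ≠ x := (far_singleton.1 f2.2.1).1
    have hac2 : a ≠ z := (far_singleton.1 hzg.2.1).1.symm
    have hac3 := f2.2.2.notMem
    have hc1 := f1.1.1.symm.notMem
    have hc2 := f1.1.2.symm.notMem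
    have hc3 := f3.1.notMem
    have hc4 := f3.2.notMem
    have hc5 := hzg.2.2.1.symm.notMem
    have hb1 := f1.2.1.1.symm.notMem
    have hb2 := f1.2.1.2.symm.notMem
    have hb3 := fbx.notMem
    have hb5 := hzg.2.2.2.1.symm.notMem
    simp only [Set.mem_singleton_iff] at hc1 hc3 hc5 hb1 hb3 hb5
    rintro t (rfl | rfl | rfl) <;>
      simp only [Set.mem_union, Set.mem_singleton_iff, not_or]
    · exact ⟨fAa, hay'.symm, hac2, hac1, hac3⟩
    · exact ⟨hc2, hc1, hc5, hc3, hc4⟩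
    · exact ⟨hb2, hb1, hb5, hb3, fBb⟩
  have hmem : ∀ {t}, t ∈ ({a} ∪ ({c} ∪ {b}) : Set V) → t ∈ H := by
    rw [hH]; clear * -; intro t ht; simp only [Set.mem_union] at ht ⊢; tauto
  have hcQ' : c ∉ Q' := fun e => Set.disjoint_left.1 hQ'H e (hmem (by simp))
  have hfar : ¬ Far G Q' Q := fun hfar => by
    refine flips_far hG hℓ hxz hzy ?_ hA hac hcb hB fxy ?_ ?_ hij hQ ?_ ?_ fQg hQ' hcQ' fQ'g hfar
    · simpa only [far_union_left, far_union_right] using hzg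
    · simpa only [far_union_left, far_union_right] using f1
    · simpa only [far_union_left, far_union_right] using f2
    · omega
    · omega
  have htouch : ∃ t ∈ Q', ∃ q ∈ Q, t = q ∨ G.Adj t q := by
    by_contra hcon
    push Not at hcon
    exact hfar fun t ht q hq => hcon t ht q hq
  obtain ⟨r, m, m', A', R, hA', hR, fAR, rfl, hm, hrt, hRt⟩ := hQ'.last_sat _ htouch
  push Not at hRt
  have hRQ : Far G R Q := hRt
  have hrH : r ∉ H := Set.disjoint_left.1 hQ'H (by simp)
  have hRH : ∀ t ∈ R, t ∉ H := fun t ht => Set.disjoint_left.1 hQ'H (by simp [ht])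
  have hbQ : Far G {b} Q := by
    refine Far.symm (fQg.mono subset_rfl ?_)
    clear * -; intro t; simp only [Set.mem_union]; tauto
  have hrQ : r ∉ Q := by
    intro e
    cases hR with
    | edge h => exact (hbQ _ rfl _ e).2 h.symm
    | cons h _ _ => exact (hRQ _ (by simp) _ e).2 h.symm
  obtain ⟨q₀, hq₀, hrq₀⟩ : ∃ q ∈ Q, G.Adj r q := by
    obtain ⟨q, hq, rfl | h⟩ := hrt
    · exact absurd hq hrQ
    · exact ⟨q, hq, h⟩
  obtain ⟨u, hbu, huR, hur⟩ : ∃ u, G.Adj b u ∧ u ∈ R ∪ {r} ∧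
      Relation.ReflTransGen (fun p q => G.Adj p q ∧ q ∈ R ∪ {r}) u r := by
    rcases Relation.ReflTransGen.cases_head hR.symm.reach with h | ⟨u, h, h'⟩
    · exact absurd h hR.ne.symm
    · exact ⟨u, h.1, h.2, h'⟩
  obtain ⟨v, hxv, hvQ⟩ : ∃ v, G.Adj x v ∧ v ∈ Q := by
    rcases Relation.ReflTransGen.cases_head hQ.reach with h | ⟨v, h, -⟩
    · exact absurd h hQ.ne
    · refine ⟨v, h.1, h.2.resolve_right ?_⟩
      rintro rfl
      exact (far_singleton.1 fxy).2 h.1.symm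
  have hN : ({x} ∪ ({z} ∪ {y}) : Set V) ⊆ H := by
    rw [hH]; clear * -; intro t ht; simp only [Set.mem_union] at ht ⊢; tauto
  have hadj : ∀ p ∈ ({a} ∪ ({c} ∪ {b}) : Set V), ∀ h ∈ ({x} ∪ ({z} ∪ {y}) : Set V),
      p ≠ h ∧ (G.Adj p h → p = a ∧ h = y) := by
    have n1 := far_singleton.1 f2.2.1
    have n2 := far_singleton.1 hzg.2.1
    have n3 := far_singleton.1 f3.1
    have n4 := far_singleton.1 hzg.2.2.1
    have n5 := far_singleton.1 f1.1.1
    have n6 := far_singleton.1 fbx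
    have n7 := far_singleton.1 hzg.2.2.2.1
    have n8 := far_singleton.1 f1.2.1.1
    rintro p (rfl | rfl | rfl) h (rfl | rfl | rfl)
    · exact ⟨n1.1, fun e => absurd e n1.2⟩
    · exact ⟨n2.1.symm, fun e => absurd e.symm n2.2⟩
    · exact ⟨hay'.symm, fun _ => ⟨rfl, rfl⟩⟩
    · exact ⟨n3.1, fun e => absurd e n3.2⟩
    · exact ⟨n4.1.symm, fun e => absurd e.symm n4.2⟩
    · exact ⟨n5.1.symm, fun e => absurd e.symm n5.2⟩
    · exact ⟨n6.1, fun e => absurd e n6.2⟩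
    · exact ⟨n7.1.symm, fun e => absurd e.symm n7.2⟩
    · exact ⟨n8.1.symm, fun e => absurd e.symm n8.2⟩
  have hWH : Disjoint (R ∪ {r} ∪ Q) H := by
    rw [Set.disjoint_left]
    rintro t ((ht | rfl) | ht)
    exacts [hRH t ht, hrH, Set.disjoint_left.1 hQH ht]
  have hWfar : Far G (R ∪ {r} ∪ Q) (H \ (({a} ∪ ({c} ∪ {b})) ∪ ({x} ∪ ({z} ∪ {y})))) := by
    rw [far_union_left]
    refine ⟨hQ'H'.mono (fun t => ?_) fun t ht => ⟨ht.1, fun e => ht.2 (Or.inl ?_)⟩,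
      hQg.mono subset_rfl fun t ht => ⟨ht.1, fun e => ht.2 (Or.inr ?_)⟩⟩
    · clear * -; simp only [Set.mem_union]; tauto
    · rcases e with rfl | rfl | rfl <;> simp
    · rcases e with rfl | rfl | rfl <;> simp
  obtain ⟨p, hp, h, hh, ⟨w, hw, hwp⟩, hear⟩ := clean_ear hWH (fun t => hmem) hN
    (Set.disjoint_left.2 fun p hp hp' => (hadj p hp p hp').1 rfl) huniq hWfar (Or.inl huR)
    ⟨b, by simp, hbu.symm⟩ ⟨x, by simp, hxv.symm⟩
    ((reach_mono hur fun p q hpq => ⟨hpq.1, Or.inl hpq.2⟩).trans (.head ⟨hrq₀, Or.inr hq₀⟩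
      (reach_mono (hQ.reach_interior hq₀ hvQ) fun p q hpq => ⟨hpq.1, Or.inr hpq.2⟩)))
  have hph : G.Adj p h := by
    by_contra hph
    obtain ⟨m, I, hI, hIH⟩ := hear hph
    obtain ⟨_, _, _, _, hth⟩ := hole_ear hG hS' hg.symm hzg' le_rfl (by omega) (by omega)
      (hH ▸ hmem hp) (hH ▸ hN hh) (far_singleton.2 ⟨(hadj p hp h hh).1, hph⟩) hI (hH ▸ hIH)
    exact hno _ _ _ _ _ _ _ hth
  obtain ⟨rfl, rfl⟩ := (hadj p hp h hh).2 hph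
  obtain ⟨rfl, rfl⟩ := hA.one_of_adj hph.symm
  simp only [far_union_left, far_union_right] at fAR fQ'g fQg
  have hwr : w = r := by
    rcases hw with (hw | hw) | hw
    · exact absurd hwp.symm (fAR.2.1 p rfl w hw).2
    · exact hw
    · exact absurd hwp (fQg.2.1 w hw p rfl).2
  subst hwr
  obtain ⟨rfl, rfl⟩ := hA'.one_of_adj hwp.symm
  refine flips_touch_first hG hℓ hxz hzy hph.symm hac hcb hB (by omega) ?_ ?_ ?_ ?_ hQ ?_ hzQ
    hwp.symm hR ?_ ?_ ?_ hrQ hRQ ⟨q₀, hq₀, hrq₀.symm⟩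
  · simp only [far_union_right]; exact ⟨f1.1.1, f1.2.1.1, f1.2.2.1.1, f1.2.2.2.1⟩
  · simp only [far_union_right]; exact f2
  · simp only [far_union_right]; exact f3
  · simp only [far_union_right]; exact hzg.2
  · simp only [far_union_right]; exact fQg.2
  · simp only [far_union_right]; exact ⟨fAR.1.1, fAR.2.1⟩
  · simp only [far_union_left, far_union_right]
    exact ⟨fQ'g.2.1.2, fQ'g.2.2.1.2, fQ'g.2.2.2.1.2, fQ'g.2.2.2.2.2⟩
  · rintro rfl
    exact hrH (hmem (by simp))

end Flips

section Existence

variable {G : SimpleGraph V} {x y z u v w h d a b c r p q : V}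
  {A B H K R I J S T W P N Q Q' f g : Set V}
  {m k ℓ L L' s t i j : ℕ}

theorem hole_nbrs (hG : InGFamily ℓ G) (hℓ : 4 ≤ ℓ) (hS : IP G u v s S) (hT : IP G u v t T)
    (hf : Far G S T) (hs : 2 ≤ s) (ht : 2 ≤ t) (hH : H = {u} ∪ ({v} ∪ (S ∪ T)))
    (hd : d ∈ H) (ha : a ∈ H) (hb : b ∈ H) (hda : G.Adj d a) (hdb : G.Adj d b) (hab : a ≠ b) :
    ∀ t ∈ H, G.Adj d t → t = a ∨ t = b := by
  subst hH
  obtain ⟨g, h1, h2, h3, h4⟩ := hole_around hG hℓ hS hT hf hs ht hd ha hb hda hdb hab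
  rw [h4]
  rintro t (rfl | rfl | rfl | ht) e
  · exact Or.inl rfl
  · exact Or.inr rfl
  · exact absurd rfl e.ne
  · exact absurd e (h3 d rfl t ht).2

theorem no_second_flip (hG : InGFamily ℓ G) (hℓ : 4 ≤ ℓ)
    (hno : ∀ u v s t S T₁ T₂, ¬ Theta G ℓ u v s t S T₁ T₂)
    (hg : IP G y x (2 * ℓ - 1) g) (hz : IP G x y 2 {z}) (hzg : Far G {z} g)
    (hH : H = {x} ∪ ({y} ∪ ({z} ∪ g)))
    (hQ : IP G x y L Q) (hQH : Disjoint Q H) (hQg : Far G Q (H \ {x, z, y}))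
    (hA : IP G y c i A) (hB : IP G c x j B) (hAB : Far G ({y} ∪ A) ({x} ∪ B))
    (hgs : g = A ∪ ({c} ∪ B)) (hi : 2 ≤ i) (hj : 3 ≤ j) (hij : i + j + 1 = 2 * ℓ)
    (hp : p ∈ H) (hq : q ∈ H) (hcp : G.Adj c p) (hcq : G.Adj c q) (hpq : p ≠ q)
    (hQ' : IP G p q L' Q') (hQ'H : Disjoint Q' H) (hQ'g : Far G Q' (H \ {p, c, q})) : False := by
  obtain ⟨a, A, A', hA1, hA2, fA, rfl⟩ := hA.split_at (i := i - 1) (j := 1) (by omega) (by omega)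
    (by omega)
  obtain ⟨b, B', B, hB1, hB2, fB, rfl⟩ := hB.split_at (i := 1) (j := j - 1) (by omega) (by omega)
    (by omega)
  obtain ⟨hac, rfl⟩ := hA2.of_one
  obtain ⟨hcb, rfl⟩ := hB1.of_one
  obtain ⟨z', _, _, hz1, hz2, -, hzs⟩ := hz.split_at (i := 1) (j := 1) le_rfl le_rfl rfl
  obtain ⟨hxz, rfl⟩ := hz1.of_one
  obtain ⟨hzy, rfl⟩ := hz2.of_one
  obtain rfl : z = z' := by
    have : z' ∈ ({z} : Set V) := by rw [hzs]; simp
    exact this.symm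
  simp only [Set.union_empty, Set.empty_union] at *
  have hgs' : g = A ∪ ({a} ∪ ({c} ∪ ({b} ∪ B))) := by rw [hgs]; ac_rfl
  have sub : ({a} ∪ ({c} ∪ {b}) : Set V) ⊆ H := by
    rw [hH, hgs']; clear * -; intro t; simp only [Set.mem_union]; tauto
  have hnb := hole_nbrs hG hℓ hz hg.symm hzg le_rfl (by omega) hH (sub (by simp)) (sub (by simp))
    (sub (by simp)) hac.symm hcb (by
      rintro rfl
      exact (hAB a (by simp) a (by simp)).1 rfl)
  have key : ∀ {p q}, p = a → q = b → IP G p q L' Q' → Far G Q' (H \ {p, c, q}) → False := by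
    rintro p q rfl rfl hQ' hQ'g
    simp only [far_union_left, far_union_right] at fA fB hAB
    refine flips_false hG hℓ hno hxz hzy hg hzg hA1 hac hcb hB2 hgs' ?_ ?_ ?_ (by omega)
      (by omega) hH hQ hQH hQg hQ' hQ'H hQ'g
    · grind [far_union_left, far_union_right]
    · grind [far_union_left, far_union_right]
    · grind [far_union_left, far_union_right, Far.symm]
  rcases hnb p hp hcp with h1 | h1 <;> rcases hnb q hq hcq with h2 | h2
  · exact hpq (h1.trans h2.symm)
  · exact key h1 h2 hQ' hQ'g
  · refine key h2 h1 hQ'.symm ?_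
    rwa [show ({q, c, p} : Set V) = {p, c, q} by clear * -; ext; simp; tauto]
  · exact hpq (h1.trans h2.symm)

theorem exists_theta [Fintype V] [DecidableRel G.Adj] (hG : InGFamily ℓ G) (hℓ : 4 ≤ ℓ)
    (hN1 : ∀ v, G.degree v ≠ 2) (hN3 : ¬ HasK2Cut G) :
    ∃ u v s t S T₁ T₂, Theta G ℓ u v s t S T₁ T₂ := by
  by_contra hno
  push Not at hno
  obtain ⟨x₀, z₀, y₀, g₀, hxz₀, hzy₀, hg₀, hzg₀⟩ := exists_oddHole hG (by omega)
  have hz₀ : IP G x₀ y₀ 2 (∅ ∪ ({z₀} ∪ ∅)) := (IP.edge hxz₀).glue (IP.edge hzy₀) (by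
    have := hg₀.far_ends (by omega)
    grind [far_union_left, far_union_right, Far.symm, far_empty_left, far_empty_right])
  have hz₀' : IP G x₀ y₀ 2 {z₀} := by simpa using hz₀
  obtain ⟨z, hzH, x, hxH, y, hyH, -, hzx, hzy, hxy, L, Q, hQ, hQH, hQg⟩ := hole_flip hG hℓ hN1 hN3
    hno hz₀' hg₀.symm hzg₀ le_rfl (by omega) (by omega) rfl (d := z₀) (a := x₀) (b := y₀) (by simp)
    (by simp) (by simp) hxz₀.symm hzy₀ hg₀.ne.symm
  obtain ⟨g, hz, hg, hzg, hH⟩ := hole_around hG hℓ hz₀' hg₀.symm hzg₀ le_rfl (by omega) hzH hxH hyH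
    hzx hzy hxy
  rw [hH] at hQH hQg
  replace hg : IP G y x (2 * ℓ - 1) g := by
    rw [show 2 * ℓ - 1 = 2 + (2 * ℓ - 1) - 2 by omega]
    exact hg.symm
  obtain ⟨d, A, B, hA, hB, fAB, hgs⟩ := hg.split_at (i := 3) (j := 2 * ℓ - 4) (by omega) (by omega)
    (by omega)
  obtain ⟨a, A₁, A', hA1, hA2, fA, hAs⟩ := hA.split_at (i := 2) (j := 1) (by omega) (by omega)
    (by omega)
  obtain ⟨b, B', B₁, hB1, hB2, fB, hBs⟩ := hB.split_at (i := 1) (j := 2 * ℓ - 5) (by omega)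
    (by omega) (by omega)
  obtain ⟨had, rfl⟩ := hA2.of_one
  obtain ⟨hdb, rfl⟩ := hB1.of_one
  have sub : ({a} ∪ ({d} ∪ {b}) : Set V) ⊆ {x} ∪ ({y} ∪ ({z} ∪ g)) := by
    rw [hgs, hAs, hBs]; clear * -; intro t; simp only [Set.mem_union]; tauto
  have hab : a ≠ b := by
    rintro rfl
    exact (fAB a (by simp [hAs]) a (by simp [hBs])).1 rfl
  obtain ⟨c, hcH, p, hpH, q, hqH, hc, hcp, hcq, hpq, L', Q', hQ', hQ'H, hQ'g⟩ := hole_flip hG hℓ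
    hN1 hN3 hno hz hg.symm hzg le_rfl (by omega) (by omega) rfl (d := d) (a := a) (b := b)
    (sub (by simp)) (sub (by simp)) (sub (by simp)) had.symm hdb hab
  have key : ∀ {i j A B}, IP G y c i A → IP G c x j B → Far G ({y} ∪ A) ({x} ∪ B) →
      g = A ∪ ({c} ∪ B) → 2 ≤ i → 3 ≤ j → i + j + 1 = 2 * ℓ → False :=
    fun h1 h2 h3 h4 h5 h6 h7 => no_second_flip hG hℓ hno hg hz hzg rfl hQ hQH hQg h1 h2 h3 h4 h5 h6
      h7 hpH hqH hcp hcq hpq hQ' hQ'H hQ'g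
  subst hAs hBs
  simp only [far_union_left, far_union_right] at fA fB fAB
  rcases hc with rfl | rfl | rfl
  · refine key hA hB ?_ hgs (by omega) (by omega) (by omega)
    clear * - fAB
    grind [far_union_left, far_union_right, Far.symm, far_empty_left, far_empty_right]
  · refine key hA1 (hA2.glue hB ?_) ?_ ?_ (by omega) (by omega) (by omega)
    · clear * - fAB fA fB
      grind [far_union_left, far_union_right, Far.symm, far_empty_left, far_empty_right]
    · clear * - fAB fA fB
      grind [far_union_left, far_union_right, Far.symm, far_empty_left, far_empty_right]
    · rw [hgs]; clear * -; ext; simp only [Set.mem_union]; tauto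
  · refine key (hA.glue hB1 ?_) hB2 ?_ ?_ (by omega) (by omega) (by omega)
    · clear * - fAB fA fB
      grind [far_union_left, far_union_right, Far.symm, far_empty_left, far_empty_right]
    · clear * - fAB fA fB
      grind [far_union_left, far_union_right, Far.symm, far_empty_left, far_empty_right]
    · rw [hgs]; clear * -; ext; simp only [Set.mem_union]; tauto

end Existence

section Short

variable {G : SimpleGraph V} {x y z u v w h d a b c r p q : V}
  {A B X Y D H R R' S T W W' T₁ T₂ : Set V}
  {m k ℓ L L' s s' t i j j' : ℕ}

theorem no_fan (hG : InGFamily 4 G) (hB : IP G d v 3 B) (hX : IP G u h j X) (hY : IP G h v j' Y)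
    (hXY : Far G ({u} ∪ X) ({v} ∪ Y)) (hj' : 2 ≤ j') (hW' : IP G u v s' W')
    (hs' : 2 ≤ s') (hsum : j + j' + s' = 9)
    (fW : Far G W' (X ∪ ({h} ∪ Y))) (fB : Far G ({d} ∪ B) ({u} ∪ (W' ∪ (X ∪ ({h} ∪ Y)))))
    (hR : IP G d h L R) (hL : 8 ≤ L) (hRf : Far G R (B ∪ ({v} ∪ (Y ∪ (W' ∪ ({u} ∪ X)))))) :
    False := by
  have fhv := hY.far_ends hj'
  have fuv := hW'.far_ends hs'
  have fdv := hB.far_ends (by omega)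
  simp only [far_union_left, far_union_right] at hXY fW fB hRf
  have h1 := hB.glue hY.symm (by
    grind [far_union_left, far_union_right, Far.symm])
  have h2 := (hB.glue hW'.symm (by
    grind [far_union_left, far_union_right, Far.symm])).glue hX (by
    grind [far_union_left, far_union_right, Far.symm])
  have h3 := (hR.hole hG h1 (by
    grind [far_union_left, far_union_right, Far.symm]) (by omega) (by omega)).2
  have h4 := (hR.hole hG h2 (by
    grind [far_union_left, far_union_right, Far.symm]) (by omega) (by omega)).2
  omega

/-- A theta with paths of lengths `4, 5, 5`, where `u`, `a`, `d` are the first vertices of the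
second path. -/
structure Corner (G : SimpleGraph V) (u v a d : V) (S B T₂ : Set V) : Prop where
  hth : Theta G 4 u v 4 5 S ({a} ∪ ({d} ∪ B)) T₂
  hua : G.Adj u a
  had : G.Adj a d
  hB : IP G d v 3 B
  fu : Far G {u} ({d} ∪ (B ∪ {v}))
  fa : Far G {a} (B ∪ {v})

/-- If an ear at `a` is much shorter than an ear at `d` with the same end `h`, then `h` is a
neighbour of `v` on one of the other two paths. -/
theorem Corner.ear (hc : Corner G u v a d S B T₂) (hG : InGFamily 4 G) (hmax : MaxTheta G 4 4)
    (hh : h ∈ thetaSet u v S ({a} ∪ ({d} ∪ B)) T₂) (hah : Far G {a} {h}) (hR' : IP G a h L' R')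
    (hR'f : Far G R' (thetaSet u v S ({a} ∪ ({d} ∪ B)) T₂ \ {a, h})) (hR : IP G d h L R)
    (hRf : Far G R (thetaSet u v S ({a} ∪ ({d} ∪ B)) T₂ \ {d, h, a})) (hL : L' + 6 ≤ L) :
    (∃ D, S = D ∪ {h} ∧ IP G u h 3 D ∧ G.Adj h v ∧ Far G ({u} ∪ D) {v} ∧ L' = 5) ∨
    (∃ D, T₂ = D ∪ {h} ∧ IP G u h 4 D ∧ G.Adj h v ∧ Far G ({u} ∪ D) {v} ∧ L' = 4) := by
  obtain ⟨hth, hua, had, hB, fu, fa⟩ := hc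
  have hL' := hR'.two_le_of_far hah
  have key : ∀ {W W' s s'}, IP G u v s W → IP G u v s' W' → 2 ≤ s' → s + s' = 9 → 3 ≤ s → h ∈ W →
      Far G W' W → Far G ({a} ∪ ({d} ∪ B)) W → Far G ({a} ∪ ({d} ∪ B)) W' →
      thetaSet u v W ({a} ∪ ({d} ∪ B)) W' = thetaSet u v S ({a} ∪ ({d} ∪ B)) T₂ →
      ∃ D, W = D ∪ {h} ∧ IP G u h (s - 1) D ∧ G.Adj h v ∧ Far G ({u} ∪ D) {v} ∧
        IP G a h s ({u} ∪ D) ∧ IP G a h 5 ({d} ∪ (B ∪ {v})) ∧ IP G a h (s' + 2) ({u} ∪ (W' ∪ {v})) ∧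
        Far G R' ({u} ∪ D) ∧ Far G R' ({d} ∪ (B ∪ {v})) ∧ Far G R' ({u} ∪ (W' ∪ {v})) := by
    intro W W' s s' hW hW' hs' hss hs3 hhW f1 f2 f3 hset
    rw [← hset] at hRf hR'f
    obtain ⟨j, j', X, Y, hX, hY, hXY, rfl, rfl⟩ := hW.split_mem hhW
    have hj' : j' = 1 := by
      by_contra hj'
      have := hY.pos
      refine no_fan hG hB hX hY hXY (by omega) hW' hs' (by omega) f1 ?_ hR (by omega) ?_
      · simp only [far_union_left, far_union_right] at *
        grind [far_union_left, far_union_right, Far.symm]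
      · refine far_of_diff hRf ?_ ?_
        · clear * -; intro t; simp only [thetaSet, Set.mem_union]; tauto
        · have n1 := (hY.far_ends (by omega)).notMem
          have n2 := hY.left_notMem
          have n3 := hX.ne
          have n4 := hX.right_notMem
          have n5 := hB.left_notMem
          have n6 := hB.ne
          have n7 := hua.ne
          have n8 : h ∉ B := (f2.symm.mono (I := {h}) (J := B) (by grind) (by grind)).notMem
          have n9 : h ∉ W' := (f1.symm.mono (I := {h}) (J := W') (by grind) (by grind)).notMem
          have n10 : d ∉ Y := (f2.mono (I := {d}) (J := Y) (by grind) (by grind)).notMem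
          have n11 : d ∉ X := (f2.mono (I := {d}) (J := X) (by grind) (by grind)).notMem
          have n12 : d ∉ W' := (f3.mono (I := {d}) (J := W') (by grind) (by grind)).notMem
          have n13 : a ∉ Y := (f2.mono (I := {a}) (J := Y) (by grind) (by grind)).notMem
          have n14 : a ∉ X := (f2.mono (I := {a}) (J := X) (by grind) (by grind)).notMem
          have n15 : a ∉ W' := (f3.mono (I := {a}) (J := W') (by grind) (by grind)).notMem
          have n16 := fa.notMem
          have n17 := (fu.mono (I := {u}) (J := {d}) (by grind) (by grind)).notMem
          rw [Set.disjoint_right]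
          clear * - n1 n2 n3 n4 n5 n6 n7 n8 n9 n10 n11 n12 n13 n14 n15 n16 n17
          grind
    subst hj'
    obtain ⟨hhv, rfl⟩ := hY.of_one
    have n3 := hX.ne
    have n4 := hX.right_notMem
    have n7 := hua.ne
    have n8 : h ∉ B := (f2.symm.mono (I := {h}) (J := B) (by grind) (by grind)).notMem
    have n9 : h ∉ W' := (f1.symm.mono (I := {h}) (J := W') (by grind) (by grind)).notMem
    have n10 : h ≠ d := (far_singleton.1
      (f2.symm.mono (I := {h}) (J := {d}) (by grind) (by grind))).1
    have n14 : a ∉ X := (f2.mono (I := {a}) (J := X) (by grind) (by grind)).notMem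
    have n15 : a ∉ W' := (f3.mono (I := {a}) (J := W') (by grind) (by grind)).notMem
    have n16 := fa.notMem
    have fuv := hW'.far_ends hs'
    have fuh := hX.far_ends (by omega)
    simp only [far_union_left, far_union_right, far_empty_right] at hXY f1 f2 f3 fu fa
    refine ⟨X, by simp, by simpa using hX, hhv, far_union_left.2 ⟨by grind, by grind⟩, ?_, ?_, ?_, ?_, ?_, ?_⟩
    · exact IP.cons hua.symm hX (by grind [far_union_left, far_union_right, Far.symm])
    · have := IP.cons had (hB.glue (IP.edge hhv.symm) (by
        grind [far_union_left, far_union_right, far_empty_right, Far.symm]))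
        (by grind [far_union_left, far_union_right, far_empty_right, Far.symm])
      simpa using this
    · have := IP.cons hua.symm (hW'.glue (IP.edge hhv.symm) (by
        grind [far_union_left, far_union_right, far_empty_right, Far.symm]))
        (by grind [far_union_left, far_union_right, far_empty_right, Far.symm])
      simpa using this
    all_goals
      refine far_of_diff hR'f ?_ ?_
      · clear * -; intro t; simp only [thetaSet, Set.mem_union]; tauto
      · rw [Set.disjoint_right]
        clear * - n3 n4 n7 n8 n9 n10 n14 n15 n16 hhv had
        grind [had.ne, hhv.ne]
  have f01 := hth.f01
  have f02 := hth.f02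
  have f12 := hth.f12
  rcases hh with rfl | rfl | hh | hh | hh
  · exact absurd hua.symm (far_singleton.1 hah).2
  · exact (hth.no_ear_side hG hmax (by simp) (by simp) hah hR' hR'f).elim
  · obtain ⟨D, h1, h2, h3, h4, h5, h6, h7, h8, h9, h10⟩ :=
      key hth.hS hth.h2 (by omega) (by omega) (by omega) hh f02.symm f01.symm f12 rfl
    exact Or.inl ⟨D, h1, h2, h3, h4, h5.ear_length hG h6 (by omega) (by omega) (by omega) hR' h8 h9⟩
  · exact (hth.no_ear_side hG hmax (by simp) (Or.inr (Or.inr hh)) hah hR' hR'f).elim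
  · obtain ⟨D, h1, h2, h3, h4, h5, h6, h7, h8, h9, h10⟩ :=
      key hth.h2 hth.hS (by omega) (by omega) (by omega) hh f02 f12 f01.symm (by
      unfold thetaSet; ext; simp only [Set.mem_union]; tauto)
    refine Or.inr ⟨D, h1, h2, h3, h4, ?_⟩
    have a1 := (hR'.hole hG h6 h9 (by omega) (by omega))
    have a2 := (hR'.hole hG h7 h10 (by omega) (by omega)).2
    omega

end Short

section Finish

variable {G : SimpleGraph V} {x y z u v u' v' w h d a b c r p q : V}
  {A B X Y D H R R' S T W W' T₁ T₂ S' T₁' T₂' : Set V}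
  {m k ℓ L L' s s' t t' i j j' : ℕ}

theorem Theta.nbrs (hth : Theta G ℓ u v s t S T₁ T₂) (hG : InGFamily ℓ G) (hℓ : 4 ≤ ℓ)
    (hd : d ∈ T₁) (ha : a ∈ T₁) (hb : b ∈ T₁) (hda : G.Adj d a) (hdb : G.Adj d b) (hab : a ≠ b) :
    ∀ t ∈ thetaSet u v S T₁ T₂, G.Adj d t → t = a ∨ t = b := by
  have hsum := hth.sum
  have hle := hth.le
  intro w hw e
  have hw' : w ∈ {u} ∪ ({v} ∪ (S ∪ T₁)) := by
    rcases hw with hw | hw | hw | hw | hw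
    · exact Or.inl hw
    · exact Or.inr (Or.inl hw)
    · exact Or.inr (Or.inr (Or.inl hw))
    · exact Or.inr (Or.inr (Or.inr hw))
    · exact absurd e (hth.f12 d hd w hw).2
  exact hole_nbrs hG hℓ hth.hS hth.h1 hth.f01 hth.two_le (by omega) rfl (by simp [hd])
    (by simp [ha]) (by simp [hb]) hda hdb hab w hw' e

/-- A counterexample in which `s` is the largest possible length of the short path of a theta. -/
structure Tight (G : SimpleGraph V) [Fintype V] [DecidableRel G.Adj] (ℓ s : ℕ) : Prop where
  hG : InGFamily ℓ G
  hℓ : 4 ≤ ℓ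
  hN1 : ∀ v, G.degree v ≠ 2
  hN3 : ¬ HasK2Cut G
  hmax : MaxTheta G ℓ s

variable [Fintype V] [DecidableRel G.Adj]

theorem Tight.no_ear (hg : Tight G ℓ s) (hth : Theta G ℓ u v s t S T₁ T₂)
    (hx : x ∈ T₁) (hxu : Far G {x} {u}) (hxv : Far G {x} {v})
    (hh : h ∈ thetaSet u v S T₁ T₂) (hxh : Far G {x} {h})
    (hR : IP G x h L R) (hRH : Far G R (thetaSet u v S T₁ T₂ \ {x, h})) : False :=
  hth.no_ear hg.hG hg.hmax
    (fun _ _ _ _ _ _ _ _ _ _ _ _ K => K.false hg.hG hg.hℓ hg.hmax hg.hN1 hg.hN3)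
    hx hxu hxv hh hxh hR hRH

/-- The ears at a vertex in the middle of a path which is shared by two thetas. -/
theorem Tight.side_ears (hg : Tight G ℓ s) (hth : Theta G ℓ u v s t S T₁ T₂)
    (hth' : Theta G ℓ u' v' s t' S' T₁' T₂')
    (hH : H = thetaSet u v S T₁ T₂ ∪ thetaSet u' v' S' T₁' T₂')
    (hd : d ∈ T₁) (ha : a ∈ T₁) (hb : b ∈ T₁) (hd' : d ∈ T₁') (ha' : a ∈ T₁') (hb' : b ∈ T₁')
    (hda : G.Adj d a) (hdb : G.Adj d b) (hab : a ≠ b)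
    (hdu : Far G {d} {u}) (hdv : Far G {d} {v}) (hdu' : Far G {d} {u'}) (hdv' : Far G {d} {v'})
    (uniq : ∀ w ∉ H, ∀ s ∈ H, ∀ t ∈ H, G.Adj w s → G.Adj w t → s = t) :
    (∃ h ∈ H, Far G {a} {h} ∧ ∃ L R L' R', IP G d h L R ∧ Far G R (H \ {d, h, a}) ∧
      IP G a h L' R' ∧ Far G R' (H \ {a, h}) ∧ L' + 2 * ℓ ≤ L + 2) ∨
    (∃ h ∈ H, Far G {b} {h} ∧ ∃ L R L' R', IP G d h L R ∧ Far G R (H \ {d, h, b}) ∧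
      IP G b h L' R' ∧ Far G R' (H \ {b, h}) ∧ L' + 2 * ℓ ≤ L + 2) := by
  have m : ∀ {x}, x ∈ T₁ → x ∈ thetaSet u v S T₁ T₂ := fun h => by simp [thetaSet, h]
  have m' : ∀ {x}, x ∈ T₁' → x ∈ thetaSet u' v' S' T₁' T₂' := fun h => by simp [thetaSet, h]
  have sub : thetaSet u v S T₁ T₂ ⊆ H := hH ▸ Set.subset_union_left
  have sub' : thetaSet u' v' S' T₁' T₂' ⊆ H := hH ▸ Set.subset_union_right
  have hnb : ∀ t ∈ H, G.Adj d t → t = a ∨ t = b := by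
    rw [hH]
    rintro t (ht | ht)
    · exact hth.nbrs hg.hG hg.hℓ hd ha hb hda hdb hab t ht
    · exact hth'.nbrs hg.hG hg.hℓ hd' ha' hb' hda hdb hab t ht
  have side : ∀ {a b}, a ∈ T₁ → a ∈ T₁' → G.Adj d a → SideEar G ℓ H d a b →
      ∃ h ∈ H, Far G {a} {h} ∧ ∃ L R L' R', IP G d h L R ∧ Far G R (H \ {d, h, a}) ∧
      IP G a h L' R' ∧ Far G R' (H \ {a, h}) ∧ L' + 2 * ℓ ≤ L + 2 := by
    rintro a b ha ha' hda ⟨h, hh, h1, h2, -, L, R, hR, hRd, hRH, hor⟩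
    have hah : ¬ G.Adj a h := by
      intro e
      have hs : ({d, a, h} : Set V) = {d, h, a} := by ext; simp; tauto
      rcases hH ▸ hh with hh' | hh'
      · exact hth.no_flip hg.hG hg.hℓ ha (m hd) hh' hda.symm e h2.symm hR
          (hs ▸ hRH.mono le_rfl (Set.sdiff_subset_sdiff_left sub)) (hRd.mono_right sub)
      · exact hth'.no_flip hg.hG hg.hℓ ha' (m' hd') hh' hda.symm e h2.symm hR
          (hs ▸ hRH.mono le_rfl (Set.sdiff_subset_sdiff_left sub')) (hRd.mono_right sub')
    obtain ⟨L', R', hR', hRH', hL⟩ := hor.resolve_left hah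
    exact ⟨h, hh, far_singleton.2 ⟨h1.symm, hah⟩, L, R, L', R', hR, hRH, hR', hRH', hL⟩
  rcases local_ears hg.hG hg.hN1 hg.hN3 (sub (m hd)) (sub (m ha)) (sub (m hb)) hda hdb hab hnb uniq
    with ⟨h, hh, h1, h2, h3, L, R, hR, hRH⟩ | ⟨L, R, hR, hRd, hRH⟩ | hs | hs
  · have hdh : Far G {d} {h} := far_singleton.2 ⟨h2.symm, fun e => (hnb h hh e).elim h1 h3⟩
    rcases hH ▸ hh with hh' | hh'
    · exact (hg.no_ear hth hd hdu hdv hh' hdh hR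
        (hRH.mono le_rfl (Set.sdiff_subset_sdiff_left sub))).elim
    · exact (hg.no_ear hth' hd' hdu' hdv' hh' hdh hR
        (hRH.mono le_rfl (Set.sdiff_subset_sdiff_left sub'))).elim
  · exact (hth.no_flip hg.hG hg.hℓ hd (m ha) (m hb) hda hdb hab hR
      (hRH.mono le_rfl (Set.sdiff_subset_sdiff_left sub)) (hRd.mono_right sub)).elim
  · exact Or.inl (side ha ha' hda hs)
  · exact Or.inr (side hb hb' hdb hs)

theorem Tight.union_uniq (hg : Tight G ℓ s) (hth : Theta G ℓ u v s t S T₁ T₂)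
    (hth' : Theta G ℓ u' v' s t' S' T₁' T₂')
    (h1 : ∀ x ∈ thetaSet u v S T₁ T₂, x ∈ thetaSet u' v' S' T₁' T₂' ∨ x ∈ A)
    (h2 : ∀ x ∈ thetaSet u' v' S' T₁' T₂', x ∈ thetaSet u v S T₁ T₂ ∨ x ∈ B)
    (cross : ∀ z ∉ thetaSet u v S T₁ T₂ ∪ thetaSet u' v' S' T₁' T₂', ∀ x ∈ A, ∀ y ∈ B,
      G.Adj z x → G.Adj z y → False) :
    ∀ w ∉ thetaSet u v S T₁ T₂ ∪ thetaSet u' v' S' T₁' T₂',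
      ∀ s ∈ thetaSet u v S T₁ T₂ ∪ thetaSet u' v' S' T₁' T₂',
      ∀ t ∈ thetaSet u v S T₁ T₂ ∪ thetaSet u' v' S' T₁' T₂', G.Adj w s → G.Adj w t → s = t := by
  intro z hz x hx y hy hzx hzy
  have u1 := fun hx hy => hth.uniq hg.hG hg.hℓ hg.hmax (fun e => hz (Or.inl e)) (x := x) (y := y)
    hx hy hzx hzy
  have u2 := fun hx hy => hth'.uniq hg.hG hg.hℓ hg.hmax (fun e => hz (Or.inr e)) (x := x) (y := y)
    hx hy hzx hzy
  have c1 := fun hx hy => cross z hz x hx y hy hzx hzy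
  have c2 := fun hx hy => cross z hz y hy x hx hzy hzx
  rcases hx with hx | hx
  · rcases hy with hy | hy
    · exact u1 hx hy
    · rcases h1 x hx with hx' | hx'
      · exact u2 hx' hy
      · rcases h2 y hy with hy' | hy'
        · exact u1 hx hy'
        · exact (c1 hx' hy').elim
  · rcases hy with hy | hy
    · rcases h1 y hy with hy' | hy'
      · exact u2 hx hy'
      · rcases h2 x hx with hx' | hx'
        · exact u1 hx' hy
        · exact (c2 hx' hy').elim
    · exact u2 hx hy

/-- A theta with `t ≥ 6` cannot be extremal. -/
theorem Tight.t_le (hg : Tight G ℓ s) (hth : Theta G ℓ u v s t S T₁ T₂) : t < 6 := by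
  by_contra ht
  obtain ⟨d, A, B, hA, hB, fAB, hT⟩ := hth.h1.split_at (i := 3) (j := t - 3) (by omega) (by omega)
    (by omega)
  obtain ⟨a, A₁, A', hA1, hA2, fA, hAs⟩ := hA.split_at (i := 2) (j := 1) (by omega) (by omega)
    (by omega)
  obtain ⟨b, B', B₁, hB1, hB2, fB, hBs⟩ := hB.split_at (i := 1) (j := t - 4) (by omega)
    (by omega) (by omega)
  obtain ⟨had, rfl⟩ := hA2.of_one
  obtain ⟨hdb, rfl⟩ := hB1.of_one
  have g1 := hA1.far_ends le_rfl
  have g2 := hB2.far_ends (by omega)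
  have g3 := hA.far_ends (by omega)
  have g4 := hB.far_ends (by omega)
  have hd : d ∈ T₁ := by simp [hT]
  have ha : a ∈ T₁ := by simp [hT, hAs]
  have hb : b ∈ T₁ := by simp [hT, hBs]
  have hab : a ≠ b := by
    rintro rfl
    exact (fAB a (by simp [hAs]) a (by simp [hBs])).1 rfl
  have hav : Far G {a} {v} := fAB.mono (by simp [hAs]) (by simp)
  have hbu : Far G {b} {u} := fAB.symm.mono (by simp [hBs]) (by simp)
  rcases hg.side_ears hth hth (Set.union_self _).symm hd ha hb hd ha hb had.symm hdb hab g3.symm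
      g4 g3.symm g4 (fun w hw s hs t ht => hth.uniq hg.hG hg.hℓ hg.hmax hw hs ht) with
    ⟨h, hh, hf, L, R, L', R', -, -, hR', hRf, -⟩ | ⟨h, hh, hf, L, R, L', R', -, -, hR', hRf, -⟩
  · exact hg.no_ear hth ha g1.symm hav hh hf hR' hRf
  · exact hg.no_ear hth hb hbu g2 hh hf hR' hRf

end Finish

section Twin

variable {G : SimpleGraph V} {x y z u v w h d a b c p q : V} {x₀ x₁ x₂ x₃ x₄ x₅ x₆ : V}
  {A B C X Y D H R R₀ R' S T T₂ : Set V}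
  {m k ℓ L L' s t i j : ℕ}

/-- Two disjoint paths with adjacent ends: a new vertex has no neighbours on both of them. -/
theorem cross_uniq (hG : InGFamily 4 G) (hT : IP G u v m T) (hR : IP G p q k R)
    (hup : G.Adj u p) (hvq : G.Adj v q) (f1 : Far G ({u} ∪ ({v} ∪ T)) R)
    (f2 : Far G T ({p} ∪ {q})) (hmk : m + k ≤ 10) (hz : z ∉ {u} ∪ ({v} ∪ ({p} ∪ ({q} ∪ (T ∪ R)))))
    (hx : x ∈ T) (hy : y ∈ R) (hzx : G.Adj z x) (hzy : G.Adj z y) : False := by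
  obtain ⟨i, i', A, A', hA, hA', hAA, rfl, rfl⟩ := hT.split_mem hx
  obtain ⟨j, j', B, B', hB, hB', hBB, rfl, rfl⟩ := hR.split_mem hy
  simp only [far_union_left, far_union_right] at f1 f2
  have h1 := (hA.symm.glue (IP.edge hup) (by
    grind [far_union_left, far_union_right, Far.symm, far_empty_right])).glue hB (by
    grind [far_union_left, far_union_right, Far.symm, far_empty_right])
  have h2 := (hA'.glue (IP.edge hvq) (by
    grind [far_union_left, far_union_right, Far.symm, far_empty_right])).glue hB'.symm (by
    grind [far_union_left, far_union_right, Far.symm, far_empty_right])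
  have c1 := h1.cyc_vertex hG hzx.symm hzy (by
    clear * - hz; simp only [Set.mem_union, Set.mem_empty_iff_false] at hz ⊢; tauto)
  have c2 := h2.cyc_vertex hG hzx.symm hzy (by
    clear * - hz; simp only [Set.mem_union, Set.mem_empty_iff_false] at hz ⊢; tauto)
  omega

/-- The vertices of an induced path of length `6`. -/
structure Chain (G : SimpleGraph V) (x₀ x₁ x₂ x₃ x₄ x₅ x₆ : V) : Prop where
  e0 : G.Adj x₀ x₁
  e1 : G.Adj x₁ x₂
  e2 : G.Adj x₂ x₃
  e3 : G.Adj x₃ x₄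
  e4 : G.Adj x₄ x₅
  e5 : G.Adj x₅ x₆
  f0 : Far G {x₀} ({x₂} ∪ ({x₃} ∪ ({x₄} ∪ ({x₅} ∪ {x₆}))))
  f1 : Far G {x₁} ({x₃} ∪ ({x₄} ∪ ({x₅} ∪ {x₆})))
  f2 : Far G {x₂} ({x₄} ∪ ({x₅} ∪ {x₆}))
  f3 : Far G {x₃} ({x₅} ∪ {x₆})
  f4 : Far G {x₄} {x₆}

theorem Chain.symm (h : Chain G x₀ x₁ x₂ x₃ x₄ x₅ x₆) : Chain G x₆ x₅ x₄ x₃ x₂ x₁ x₀ := by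
  obtain ⟨e0, e1, e2, e3, e4, e5, f0, f1, f2, f3, f4⟩ := h
  simp only [far_union_right] at f0 f1 f2 f3 f4
  constructor <;> grind [SimpleGraph.adj_comm, far_union_right, Far.symm]

theorem Chain.corner (h : Chain G x₀ x₁ x₂ x₃ x₄ x₅ x₆)
    (hth : Theta G 4 x₀ x₅ 4 5 S ({x₁} ∪ ({x₂} ∪ ({x₃} ∪ {x₄}))) T₂) :
    Corner G x₀ x₅ x₁ x₂ S ({x₃} ∪ {x₄}) T₂ := by
  obtain ⟨e0, e1, e2, e3, e4, e5, f0, f1, f2, f3, f4⟩ := h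
  simp only [far_union_right] at f0 f1 f2 f3 f4
  refine ⟨hth, e0, e1, ?_, by grind [far_union_right], by grind [far_union_right]⟩
  have := IP.cons e2 (IP.cons e3 (IP.edge e4) (by grind [far_union_right, far_empty_right]))
    (by grind [far_union_right, far_empty_right])
  simpa only [Set.union_empty] using this

/-- Two thetas `hth` and `hth'` which share most of their vertices, exchanged by a symmetry. -/
structure TwinTheta (G : SimpleGraph V) (x₀ x₁ x₂ x₃ x₄ x₅ x₆ : V) (D T R : Set V) : Prop where
  chain : Chain G x₀ x₁ x₂ x₃ x₄ x₅ x₆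
  hth : Theta G 4 x₀ x₅ 4 5 (D ∪ {x₆}) ({x₁} ∪ ({x₂} ∪ ({x₃} ∪ {x₄}))) T
  hth' : Theta G 4 x₁ x₆ 4 5 ({x₀} ∪ D) ({x₂} ∪ ({x₃} ∪ ({x₄} ∪ {x₅}))) R
  far : Far G T R

theorem TwinTheta.symm (K : TwinTheta G x₀ x₁ x₂ x₃ x₄ x₅ x₆ D T R) :
    TwinTheta G x₆ x₅ x₄ x₃ x₂ x₁ x₀ D R T := by
  refine ⟨K.chain.symm, ?_, ?_, K.far.symm⟩
  · rw [show D ∪ {x₀} = {x₀} ∪ D from Set.union_comm _ _,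
      show ({x₅} ∪ ({x₄} ∪ ({x₃} ∪ {x₂})) : Set V) = {x₂} ∪ ({x₃} ∪ ({x₄} ∪ {x₅})) by ac_rfl]
    exact K.hth'.rev
  · rw [show {x₆} ∪ D = D ∪ {x₆} from Set.union_comm _ _,
      show ({x₄} ∪ ({x₃} ∪ ({x₂} ∪ {x₁})) : Set V) = {x₁} ∪ ({x₂} ∪ ({x₃} ∪ {x₄})) by ac_rfl]
    exact K.hth.rev

theorem Chain.corner' (h : Chain G x₀ x₁ x₂ x₃ x₄ x₅ x₆)
    (hth : Theta G 4 x₁ x₆ 4 5 S ({x₂} ∪ ({x₃} ∪ ({x₄} ∪ {x₅}))) T₂) :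
    Corner G x₁ x₆ x₂ x₃ S ({x₄} ∪ {x₅}) T₂ := by
  obtain ⟨e0, e1, e2, e3, e4, e5, f0, f1, f2, f3, f4⟩ := h
  simp only [far_union_right] at f0 f1 f2 f3 f4
  refine ⟨hth, e1, e2, ?_, by grind [far_union_right], by grind [far_union_right]⟩
  have := IP.cons e3 (IP.cons e4 (IP.edge e5) (by grind [far_union_right, far_empty_right]))
    (by grind [far_union_right, far_empty_right])
  simpa only [Set.union_empty] using this

variable [Fintype V] [DecidableRel G.Adj]

theorem TwinTheta.no_side (K : TwinTheta G x₀ x₁ x₂ x₃ x₄ x₅ x₆ D T R₀) (hg : Tight G 4 4)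
    (hH : H = thetaSet x₀ x₅ (D ∪ {x₆}) ({x₁} ∪ ({x₂} ∪ ({x₃} ∪ {x₄}))) T ∪
      thetaSet x₁ x₆ ({x₀} ∪ D) ({x₂} ∪ ({x₃} ∪ ({x₄} ∪ {x₅}))) R₀)
    (hh : h ∈ H) (hf : Far G {x₂} {h}) (hR : IP G x₃ h L R) (hRH : Far G R (H \ {x₃, h, x₂}))
    (hR' : IP G x₂ h L' R') (hRH' : Far G R' (H \ {x₂, h})) (hL : L' + 2 * 4 ≤ L + 2) : False := by
  obtain ⟨hch, hth, hth', fTR⟩ := K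
  have hco := hch.corner' hth'
  obtain ⟨e0, e1, e2, e3, e4, e5, f0, f1, f2, f3, f4⟩ := hch
  simp only [far_union_right] at f0 f1 f2 f3 f4
  have sub : thetaSet x₀ x₅ (D ∪ {x₆}) ({x₁} ∪ ({x₂} ∪ ({x₃} ∪ {x₄}))) T ⊆ H :=
    hH ▸ Set.subset_union_left
  have sub' : thetaSet x₁ x₆ ({x₀} ∪ D) ({x₂} ∪ ({x₃} ∪ ({x₄} ∪ {x₅}))) R₀ ⊆ H :=
    hH ▸ Set.subset_union_right
  by_cases hhΘ : h ∈ thetaSet x₀ x₅ (D ∪ {x₆}) ({x₁} ∪ ({x₂} ∪ ({x₃} ∪ {x₄}))) T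
  · exact hg.no_ear hth (x := x₂) (by simp) f0.1.symm f2.2.1 hhΘ hf hR'
      (hRH'.mono le_rfl (Set.sdiff_subset_sdiff_left sub))
  have hh' := hH ▸ hh
  replace hh' := hh'.resolve_left hhΘ
  rcases hco.ear hg.hG hg.hmax hh' hf hR' (hRH'.mono le_rfl (Set.sdiff_subset_sdiff_left sub')) hR
    (hRH.mono le_rfl (Set.sdiff_subset_sdiff_left sub')) (by omega) with
    ⟨E, h1, -⟩ | ⟨E, rfl, hE, h6, fE, h4⟩
  · have : h ∈ {x₀} ∪ D := by simp [h1]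
    exact hhΘ (by clear * - this; simp only [thetaSet, Set.mem_union] at this ⊢; tauto)
  · have g1 := hE.far_ends (by omega)
    have t1 := hth.f02
    have t2 := hth.f12
    have t3 := hth'.f02
    have t4 := hth'.f12
    simp only [far_union_left, far_union_right] at t1 t2 t3 t4 fTR
    have h1 := IP.cons e1.symm (IP.cons e0.symm ((hth.h2.glue (IP.edge e5) (by
      grind [far_union_left, far_union_right, Far.symm, far_empty_right])).glue (IP.edge h6.symm) (by
      grind [far_union_left, far_union_right, Far.symm, far_empty_left, far_empty_right])) (by
      grind [far_union_left, far_union_right, Far.symm, far_empty_left, far_empty_right])) (by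
      grind [far_union_left, far_union_right, Far.symm, far_empty_left, far_empty_right])
    have := (hR'.hole hg.hG h1 (by
      refine far_of_diff hRH' ?_ ?_
      · refine subset_trans ?_ sub
        clear * -; intro t; simp only [thetaSet, Set.mem_union, Set.mem_empty_iff_false]; tauto
      · rw [Set.disjoint_right]
        rintro t (rfl | rfl)
        · exact h1.left_notMem
        · exact h1.right_notMem) (by omega) (by omega)).2
    omega

theorem TwinTheta.false (K : TwinTheta G x₀ x₁ x₂ x₃ x₄ x₅ x₆ D T R) (hg : Tight G 4 4) :
    False := by
  obtain ⟨e0, e1, e2, e3, e4, e5, f0, f1, f2, f3, f4⟩ := K.chain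
  simp only [far_union_right] at f0 f1 f2 f3 f4
  have t1 := K.hth.f02
  have t2 := K.hth.f12
  have t3 := K.hth'.f02
  have t4 := K.hth'.f12
  have t5 := K.far
  simp only [far_union_left] at t1 t2 t3 t4 t5
  have g1 : Far G ({x₀} ∪ ({x₅} ∪ T)) R := by grind [far_union_left, Far.symm]
  have g2 : Far G T ({x₁} ∪ {x₆}) := by grind [far_union_right, Far.symm]
  have huniq := hg.union_uniq K.hth K.hth' (A := T) (B := R)
    (by clear * -; intro x; simp only [thetaSet, Set.mem_union]; tauto)
    (by clear * -; intro x; simp only [thetaSet, Set.mem_union]; tauto)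
    (by
      intro z hz x hx y hy hzx hzy
      refine cross_uniq hg.hG K.hth.h2 K.hth'.h2 e0 e5 g1 g2 le_rfl (fun e => hz ?_) hx hy hzx hzy
      clear * - e; simp only [thetaSet, Set.mem_union] at e ⊢; tauto)
  rcases hg.side_ears K.hth K.hth' rfl (d := x₃) (a := x₂) (b := x₄) (by simp) (by simp) (by simp)
      (by simp) (by simp) (by simp) e2.symm e3 (far_singleton.1 f2.1).1 f0.2.1.symm f3.1 f1.1.symm
      f3.2 huniq with
    ⟨h, hh, hf, L, R, L', R', hR, hRH, hR', hRH', hL⟩ |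
    ⟨h, hh, hf, L, R, L', R', hR, hRH, hR', hRH', hL⟩
  · exact K.no_side hg rfl hh hf hR hRH hR' hRH' hL
  · refine K.symm.no_side hg ?_ hh hf hR hRH hR' hRH' hL
    clear * -; ext; simp only [thetaSet, Set.mem_union]; tauto

end Twin

section Alpha

variable {G : SimpleGraph V} {x y z u v w h : V} {x₀ x₁ x₂ x₃ x₄ x₅ x₆ : V}
  {D H R R₀ R' S T T₁ T₂ I : Set V} {m k ℓ L L' s t : ℕ}

theorem IP.uncons (hI : IP G x z m I) (hm : 2 ≤ m) :
    ∃ y J, G.Adj x y ∧ IP G y z (m - 1) J ∧ Far G {x} (J ∪ {z}) ∧ I = {y} ∪ J := by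
  cases hI with
  | edge => omega
  | cons h1 h2 h3 => exact ⟨_, _, h1, h2, h3, rfl⟩

theorem IP.chain (hT : IP G u v 5 T) (e : G.Adj v w) (f : Far G ({u} ∪ T) {w}) :
    ∃ x₁ x₂ x₃ x₄, T = {x₁} ∪ ({x₂} ∪ ({x₃} ∪ {x₄})) ∧ Chain G u x₁ x₂ x₃ x₄ v w := by
  obtain ⟨x₁, J₁, e1, h1, f1, rfl⟩ := hT.uncons (by omega)
  obtain ⟨x₂, J₂, e2, h2, f2, rfl⟩ := h1.uncons (by omega)
  obtain ⟨x₃, J₃, e3, h3, f3, rfl⟩ := h2.uncons (by omega)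
  obtain ⟨x₄, J₄, e4, h4, f4, rfl⟩ := h3.uncons (by omega)
  obtain ⟨e5, rfl⟩ := h4.of_one
  simp only [far_union_left, far_union_right, Set.union_empty] at f f1 f2 f3 f4
  refine ⟨x₁, x₂, x₃, x₄, by simp, e1, e2, e3, e4, e5, e, ?_, ?_, ?_, ?_, ?_⟩ <;>
  grind [far_union_right]

theorem Chain.path (h : Chain G x₀ x₁ x₂ x₃ x₄ x₅ x₆) :
    IP G x₁ x₆ 5 ({x₂} ∪ ({x₃} ∪ ({x₄} ∪ {x₅}))) := by
  obtain ⟨e0, e1, e2, e3, e4, e5, f0, f1, f2, f3, f4⟩ := h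
  simp only [far_union_right] at f0 f1 f2 f3 f4
  have := IP.cons e1 (IP.cons e2 (IP.cons e3 (IP.cons e4 (IP.edge e5) (by
    grind [far_union_right, far_empty_right])) (by
    grind [far_union_right, far_empty_right])) (by
    grind [far_union_right, far_empty_right])) (by
    grind [far_union_right, far_empty_right])
  simpa only [Set.union_empty] using this

theorem Chain.replace (h : Chain G x₀ x₁ x₂ x₃ x₄ x₅ x₆) (e : G.Adj x₅ w)
    (f : Far G ({x₀} ∪ ({x₁} ∪ ({x₂} ∪ ({x₃} ∪ {x₄})))) {w}) :
    Chain G x₀ x₁ x₂ x₃ x₄ x₅ w := by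
  obtain ⟨e0, e1, e2, e3, e4, e5, f0, f1, f2, f3, f4⟩ := h
  simp only [far_union_left, far_union_right] at f f0 f1 f2 f3 f4
  constructor <;> grind [far_union_right]

theorem Chain.shift (h : Chain G x₀ x₁ x₂ x₃ x₄ x₅ x₆) (e : G.Adj x₆ w)
    (f : Far G ({x₁} ∪ ({x₂} ∪ ({x₃} ∪ ({x₄} ∪ {x₅})))) {w}) :
    Chain G x₁ x₂ x₃ x₄ x₅ x₆ w := by
  obtain ⟨e0, e1, e2, e3, e4, e5, f0, f1, f2, f3, f4⟩ := h
  simp only [far_union_left, far_union_right] at f f0 f1 f2 f3 f4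
  constructor <;> grind [far_union_right]

/-- The path `x₁, x₀, D, x₆` and its relation to the chain. -/
theorem Chain.other_path (h : Chain G x₀ x₁ x₂ x₃ x₄ x₅ x₆) (hD : IP G x₀ x₆ k D)
    (f : Far G ({x₁} ∪ ({x₂} ∪ ({x₃} ∪ {x₄}))) D) (f5 : Far G D {x₅}) :
    IP G x₁ x₆ (k + 1) ({x₀} ∪ D) ∧ Far G ({x₀} ∪ D) ({x₂} ∪ ({x₃} ∪ ({x₄} ∪ {x₅}))) := by
  obtain ⟨e0, e1, e2, e3, e4, e5, f0, f1, f2, f3, f4⟩ := h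
  simp only [far_union_left, far_union_right] at f f0 f1 f2 f3 f4
  refine ⟨IP.cons e0.symm hD ?_, ?_⟩ <;> grind [far_union_left, far_union_right, Far.symm]

variable [Fintype V] [DecidableRel G.Adj]

theorem Chain.ear (hch : Chain G x₀ x₁ x₂ x₃ x₄ x₅ x₆) (hg : Tight G 4 4)
    (hth : Theta G 4 x₀ x₅ 4 5 S ({x₁} ∪ ({x₂} ∪ ({x₃} ∪ {x₄}))) T₂)
    (hh : h ∈ thetaSet x₀ x₅ S ({x₁} ∪ ({x₂} ∪ ({x₃} ∪ {x₄}))) T₂) (hf : Far G {x₁} {h})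
    (hR : IP G x₂ h L R)
    (hRH : Far G R (thetaSet x₀ x₅ S ({x₁} ∪ ({x₂} ∪ ({x₃} ∪ {x₄}))) T₂ \ {x₂, h, x₁}))
    (hR' : IP G x₁ h L' R')
    (hRH' : Far G R' (thetaSet x₀ x₅ S ({x₁} ∪ ({x₂} ∪ ({x₃} ∪ {x₄}))) T₂ \ {x₁, h}))
    (hL : L' + 2 * 4 ≤ L + 2) :
    ∃ D, T₂ = D ∪ {h} ∧ IP G x₀ h 4 D ∧ Far G D {x₅} ∧ L' = 4 ∧
      Chain G x₀ x₁ x₂ x₃ x₄ x₅ h := by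
  have f01 := hth.f01
  have f12 := hth.f12
  rcases (hch.corner hth).ear hg.hG hg.hmax hh hf hR' hRH' hR hRH (by omega) with
    ⟨D, rfl, hD, e, f, rfl⟩ | ⟨D, rfl, hD, e, f, rfl⟩
  · have fD := hD.far_ends (by omega)
    have hch' := hch.replace e.symm (by
      grind [far_union_left, far_union_right, Far.symm])
    obtain ⟨h1, h2⟩ := hch'.other_path hD
      (by grind [far_union_left, far_union_right, Far.symm])
      (by grind [far_union_left, far_union_right, Far.symm])
    have hx : Far G {x₁} T₂ := f12.mono (by simp) le_rfl
    have hx' : Far G {h} T₂ := hth.f02.mono (by simp) le_rfl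
    have key : ∀ {C : Set V}, x₁ ∉ C → h ∉ C →
        C ⊆ thetaSet x₀ x₅ (D ∪ {h}) ({x₁} ∪ ({x₂} ∪ ({x₃} ∪ {x₄}))) T₂ → Far G R' C := by
      intro C c1 c2 c3
      refine far_of_diff hRH' c3 (Set.disjoint_right.2 ?_)
      rintro t (rfl | rfl) <;> assumption
    refine (TwinTheta.false ⟨hch', hth, IP.theta hg.hG h1 hch'.path (by omega) (by omega) rfl h2 hR'
      (key h1.left_notMem h1.right_notMem ?_)
      (key hch'.path.left_notMem hch'.path.right_notMem ?_),
      (key hx.notMem hx'.notMem ?_).symm⟩ hg).elim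
    all_goals
      clear * -; intro x; simp only [thetaSet, Set.mem_union]; tauto
  · have fD := hD.far_ends (by omega)
    refine ⟨D, rfl, hD, f.mono (by simp) le_rfl, rfl, hch.replace e.symm (by
      grind [far_union_left, far_union_right, Far.symm])⟩

/-- Two thetas sharing a path of length `4`. -/
structure CrossTheta (G : SimpleGraph V) (x₀ x₁ x₂ x₃ x₄ x₅ x₆ : V) (D S R : Set V) : Prop where
  chain : Chain G x₀ x₁ x₂ x₃ x₄ x₅ x₆
  hD : IP G x₀ x₆ 4 D
  hth : Theta G 4 x₀ x₅ 4 5 S ({x₁} ∪ ({x₂} ∪ ({x₃} ∪ {x₄}))) (D ∪ {x₆})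
  hth' : Theta G 4 x₁ x₆ 4 5 R ({x₂} ∪ ({x₃} ∪ ({x₄} ∪ {x₅}))) ({x₀} ∪ D)
  far : Far G S R

theorem CrossTheta.false (K : CrossTheta G x₀ x₁ x₂ x₃ x₄ x₅ x₆ D S R₀) (hg : Tight G 4 4) :
    False := by
  obtain ⟨hch, hD, hth, hth', fSR⟩ := K
  obtain ⟨e0, e1, e2, e3, e4, e5, f0, f1, f2, f3, f4⟩ := id hch
  simp only [far_union_right] at f0 f1 f2 f3 f4
  have t0 := hth.f01
  have t1 := hth.f02
  have t2 := hth.f12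
  have t3 := hth'.f01
  have t4 := hth'.f02
  have t5 := hth'.f12
  simp only [far_union_left, far_union_right] at t0 t1 t2 t3 t4 t5
  have g1 : Far G ({x₀} ∪ ({x₅} ∪ S)) R₀ := by grind [far_union_left, Far.symm]
  have g2 : Far G S ({x₁} ∪ {x₆}) := by grind [far_union_right, Far.symm]
  have huniq := hg.union_uniq hth hth' (A := S) (B := R₀)
    (by clear * -; intro x; simp only [thetaSet, Set.mem_union]; tauto)
    (by clear * -; intro x; simp only [thetaSet, Set.mem_union]; tauto)
    (by
      intro z hz x hx y hy hzx hzy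
      refine cross_uniq hg.hG hth.hS hth'.hS e0 e5 g1 g2 (by omega) (fun e => hz ?_) hx hy hzx hzy
      clear * - e; simp only [thetaSet, Set.mem_union] at e ⊢; tauto)
  have sub := Set.subset_union_left (s := thetaSet x₀ x₅ S ({x₁} ∪ ({x₂} ∪ ({x₃} ∪ {x₄}))) (D ∪ {x₆}))
    (t := thetaSet x₁ x₆ R₀ ({x₂} ∪ ({x₃} ∪ ({x₄} ∪ {x₅}))) ({x₀} ∪ D))
  have sub' := Set.subset_union_right (s := thetaSet x₀ x₅ S ({x₁} ∪ ({x₂} ∪ ({x₃} ∪ {x₄}))) (D ∪ {x₆}))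
    (t := thetaSet x₁ x₆ R₀ ({x₂} ∪ ({x₃} ∪ ({x₄} ∪ {x₅}))) ({x₀} ∪ D))
  rcases hg.side_ears hth hth' rfl (d := x₃) (a := x₂) (b := x₄) (by simp) (by simp) (by simp)
      (by simp) (by simp) (by simp) e2.symm e3 (far_singleton.1 f2.1).1 f0.2.1.symm f3.1 f1.1.symm
      f3.2 huniq with
    ⟨h, hh, hf, L, R, L', R', hR, hRH, hR', hRH', hL⟩ |
    ⟨h, hh, hf, L, R, L', R', hR, hRH, hR', hRH', hL⟩
  · by_cases hhΘ : h ∈ thetaSet x₀ x₅ S ({x₁} ∪ ({x₂} ∪ ({x₃} ∪ {x₄}))) (D ∪ {x₆})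
    · exact hg.no_ear hth (x := x₂) (by simp) f0.1.symm f2.2.1 hhΘ hf hR'
        (hRH'.mono le_rfl (Set.sdiff_subset_sdiff_left sub))
    obtain ⟨w, A, B, hA, hB, -, rfl⟩ := hD.split_at (i := 3) (j := 1) (by omega) (by omega) rfl
    obtain ⟨hw, rfl⟩ := hB.of_one
    obtain ⟨E, h1, -⟩ := (hch.shift hw.symm (by
      grind [far_union_left, far_union_right])).ear hg hth' (hh.resolve_left hhΘ) hf hR
      (hRH.mono le_rfl (Set.sdiff_subset_sdiff_left sub')) hR'
      (hRH'.mono le_rfl (Set.sdiff_subset_sdiff_left sub')) hL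
    apply hhΘ
    have : h ∈ {x₀} ∪ (A ∪ ({w} ∪ ∅)) := by rw [h1]; simp
    clear * - this
    simp only [thetaSet, Set.mem_union] at this ⊢
    tauto
  · rcases hh with hh | hh
    · obtain ⟨y, J, ey, hJ, fJ, rfl⟩ := hD.uncons (by omega)
      simp only [far_union_right] at t0 t1 t2 t3 t4 t5 fJ
      have hset : ({x₁} ∪ ({x₂} ∪ ({x₃} ∪ {x₄})) : Set V) = {x₄} ∪ ({x₃} ∪ ({x₂} ∪ {x₁})) := by
        ac_rfl
      have hRH1 := hRH.mono le_rfl (Set.sdiff_subset_sdiff_left sub)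
      have hRH1' := hRH'.mono le_rfl (Set.sdiff_subset_sdiff_left sub)
      have hthr := hth.rev
      rw [thetaSet_rev, hset] at hRH1 hRH1' hh
      rw [hset] at hthr
      obtain ⟨E, h1, -, -, rfl, hch'⟩ := (hch.symm.shift ey (by
        grind [far_union_left, far_union_right, Far.symm])).ear hg hthr hh hf hR hRH1 hR' hRH1' hL
      have hhy : h = y := by
        have hm : h ∈ {y} ∪ J ∪ {x₆} := by rw [h1]; simp
        have e := hch'.e5
        rcases hm with (hm | hm) | hm
        · exact hm
        · exact absurd e (fJ.1 x₀ rfl h hm).2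
        · exact absurd e (fJ.2 x₀ rfl h hm).2
      subst hhy
      have p1 : IP G x₃ x₁ 2 ({x₂} ∪ ∅) := IP.cons e2.symm (IP.edge e1.symm) (by
        grind [far_union_right, far_empty_right, Far.symm])
      have p2 : IP G x₁ h 2 ({x₀} ∪ ∅) := IP.cons e0.symm (IP.edge ey) (by
        grind [far_union_right, far_empty_right, Far.symm])
      have q1 := p1.glue p2 (by
        grind [far_union_left, far_union_right, far_empty_left, far_empty_right, Far.symm])
      have q2 := (p1.glue hth'.hS (by
        grind [far_union_left, far_union_right, far_empty_left, far_empty_right, Far.symm])).glue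
        hJ.symm (by
        grind [far_union_left, far_union_right, far_empty_left, far_empty_right, Far.symm])
      have key : ∀ {C m}, IP G x₃ h m C → x₄ ∉ C →
          C ⊆ {x₂} ∪ ({x₁} ∪ ({x₀} ∪ ({x₆} ∪ (R₀ ∪ J)))) → Far G R C := by
        intro C m hC hx hC'
        refine far_of_diff hRH (hC'.trans ?_) (Set.disjoint_right.2 ?_)
        · clear * -; intro x; simp only [thetaSet, Set.mem_union]; tauto
        · rintro t (rfl | rfl | rfl)
          · exact hC.left_notMem
          · exact hC.right_notMem
          · exact hx
      have hx4 : x₄ ∉ {x₂} ∪ ({x₁} ∪ ({x₀} ∪ ({x₆} ∪ (R₀ ∪ J)))) := by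
        refine Far.notMem (G := G) ?_
        grind [far_union_left, far_union_right, Far.symm]
      have s1 : {x₂} ∪ ∅ ∪ ({x₁} ∪ ({x₀} ∪ ∅)) ⊆ {x₂} ∪ ({x₁} ∪ ({x₀} ∪ ({x₆} ∪ (R₀ ∪ J)))) := by
        clear * -; intro x; simp only [Set.mem_union, Set.mem_empty_iff_false]; tauto
      have s2 : {x₂} ∪ ∅ ∪ ({x₁} ∪ R₀) ∪ ({x₆} ∪ J) ⊆
          {x₂} ∪ ({x₁} ∪ ({x₀} ∪ ({x₆} ∪ (R₀ ∪ J)))) := by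
        clear * -; intro x; simp only [Set.mem_union, Set.mem_empty_iff_false]; tauto
      have r1 := hR.hole hg.hG q1 (key q1 (fun e => hx4 (s1 e)) s1) (by omega) (by omega)
      have r2 := hR.hole hg.hG q2 (key q2 (fun e => hx4 (s2 e)) s2) (by omega) (by omega)
      omega
    · exact hg.no_ear hth' (x := x₄) (by simp) f1.2.1.symm f4 hh hf hR'
        (hRH'.mono le_rfl (Set.sdiff_subset_sdiff_left sub'))

theorem Tight.no_theta_five (hg : Tight G 4 4) (hth : Theta G 4 u v 4 5 S T₁ T₂) : False := by
  obtain ⟨w, A, B, hA, hB, fAB, hS⟩ := hth.hS.split_at (i := 3) (j := 1) (by omega) le_rfl rfl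
  obtain ⟨hwv, rfl⟩ := hB.of_one
  have fuw := hA.far_ends (by omega)
  have f01 := hth.f01
  obtain ⟨x₁, x₂, x₃, x₄, rfl, hch⟩ := hth.h1.chain hwv.symm (far_union_left.2 ⟨fuw,
    f01.symm.mono le_rfl (by simp [hS])⟩)
  obtain ⟨e0, e1, e2, e3, e4, e5, f0, f1, f2, f3, f4⟩ := id hch
  simp only [far_union_right] at f0 f1 f2 f3 f4
  rcases hg.side_ears hth hth (Set.union_self _).symm (d := x₂) (a := x₁) (b := x₃) (by simp)
      (by simp) (by simp) (by simp) (by simp) (by simp) e1.symm e2 (far_singleton.1 f1.1).1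
      f0.1.symm f2.2.1 f0.1.symm f2.2.1
      (fun w hw s hs t ht => hth.uniq hg.hG hg.hℓ hg.hmax hw hs ht) with
    ⟨h, hh, hf, L, R, L', R', hR, hRH, hR', hRH', hL⟩ |
    ⟨h, hh, hf, L, R, L', R', hR, hRH, hR', hRH', hL⟩
  · obtain ⟨D, rfl, hD, f5, rfl, hch'⟩ := hch.ear hg hth hh hf hR hRH hR' hRH' hL
    have f12 := hth.f12
    obtain ⟨h1, h2⟩ := hch'.other_path hD (far_union_right.1 f12).1 f5
    have hx : Far G {x₁} S := f01.symm.mono (by simp) le_rfl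
    have hx' : Far G {h} S := hth.f02.symm.mono (by simp) le_rfl
    have key : ∀ {C : Set V}, x₁ ∉ C → h ∉ C →
        C ⊆ thetaSet u v S ({x₁} ∪ ({x₂} ∪ ({x₃} ∪ {x₄}))) (D ∪ {h}) → Far G R' C := by
      intro C c1 c2 c3
      refine far_of_diff hRH' c3 (Set.disjoint_right.2 ?_)
      rintro t (rfl | rfl) <;> assumption
    refine CrossTheta.false ⟨hch', hD, hth, IP.theta hg.hG hR' hch'.path (by omega) (by omega) rfl
      (key hch'.path.left_notMem hch'.path.right_notMem ?_) h1
      (key h1.left_notMem h1.right_notMem ?_).symm h2,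
      (key hx.notMem hx'.notMem ?_).symm⟩ hg
    all_goals
      clear * -; intro x; simp only [thetaSet, Set.mem_union]; tauto
  · exact hg.no_ear hth (x := x₃) (by simp) f0.2.1.symm f3.1 hh hf hR' hRH'

/-- A graph in the family has a vertex of degree two or a `K₂`-cut. -/
theorem degree_two_or_hasK2Cut (hG : InGFamily ℓ G) (hℓ : 4 ≤ ℓ) :
    (∃ v, G.degree v = 2) ∨ HasK2Cut G := by
  by_contra hcon
  push Not at hcon
  obtain ⟨hN1, hN3⟩ := hcon
  obtain ⟨u, v, s, t, S, T₁, T₂, hth, hmax⟩ : ∃ u v s t S T₁ T₂, Theta G ℓ u v s t S T₁ T₂ ∧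
      MaxTheta G ℓ s := by
    classical
    obtain ⟨u, v, s, t, S, T₁, T₂, hth⟩ := exists_theta hG hℓ hN1 hN3
    set P : ℕ → Prop := fun s => ∃ u v t S T₁ T₂, Theta G ℓ u v s t S T₁ T₂ with hP
    obtain ⟨u', v', t', S', T₁', T₂', hth'⟩ : P (Nat.findGreatest P ℓ) :=
      Nat.findGreatest_spec hth.le ⟨u, v, t, S, T₁, T₂, hth⟩
    exact ⟨u', v', _, t', S', T₁', T₂', hth', fun u v s' t S T₁ T₂ h =>
      Nat.le_findGreatest h.le ⟨u, v, t, S, T₁, T₂, h⟩⟩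
  have hg : Tight G ℓ s := ⟨hG, hℓ, hN1, hN3, hmax⟩
  have ht := hg.t_le hth
  have := hth.sum
  have := hth.le
  obtain rfl : ℓ = 4 := by omega
  obtain rfl : s = 4 := by omega
  obtain rfl : t = 5 := by omega
  exact hg.no_theta_five hth

end Alpha

/-- Lemma 2.5: let `ℓ ≥ 4`, `G ∈ 𝒢ℓ`, and `x, y` non-adjacent vertices.
Let `X` be a vertex cut with `{x,y} ⊆ X ⊆ N[{x,y}]` and `G1` the subgraph induced on `X`
together with a component of `G − X`. If all induced `(x,y)`-paths in `G1` have length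
`k` with `4 ≤ k ≤ ℓ`, then `G` has a degree-2 vertex, a cut-vertex, or a `K₂`-cut. -/
theorem degree2_or_cut {V : Type*} [Fintype V] (G : SimpleGraph V) [DecidableRel G.Adj]
    (ℓ : ℕ) (hℓ : 4 ≤ ℓ) (hG : InGFamily ℓ G)
    (x y : V) (hne : x ≠ y) (hnadj : ¬ G.Adj x y)
    (X : Set V) (hcut : IsVertexCut G X)
    (hxX : x ∈ X) (hyX : y ∈ X) (hXN : X ⊆ closedNbhd G {x, y})
    (S : Set V) (hS : IsComponentOf G X S)
    (k : ℕ) (hk4 : 4 ≤ k) (hkℓ : k ≤ ℓ)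
    (hall : ∀ p : (G.induce (X ∪ S)).Walk ⟨x, Set.mem_union_left S hxX⟩
        ⟨y, Set.mem_union_left S hyX⟩,
      IsInducedPath (G.induce (X ∪ S)) p → p.length = k) :
    (∃ v : V, G.degree v = 2) ∨ (∃ v : V, IsCutVertex G v) ∨ HasK2Cut G := by
  rcases degree_two_or_hasK2Cut hG hℓ with h | h
  · exact Or.inl h
  · exact Or.inr (Or.inr h)
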